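/- arXiv:2412.16738 — 2 statements merged into one kernel-verified Lean document; each statement's English description precedes it below -/
import Mathlib

section
/- (Braun, 2009.) For every integer d ≥ 2 there exist a constant a > 0, positive constants λ_p > 0 for 1 ≤ p ≤ d, real constants c_q for 0 ≤ q ≤ 2d, and a continuous, monotonically increasing function ψ : ℝ → ℝ, such that every continuous real function f on [0,1]^d is representable as f(x₁,…,x_d) = Σ_{q=0}^{2d} g(Σ_{p=1}^{d} λ_p ψ(x_p + qa) + c_q) for some continuous function g : ℝ → ℝ (depending on f). -/
abbrev BKI : Type := Set.Icc (0:ℝ) 1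

lemma bk_sum_split (v w : ℕ → ℝ) (k N : ℕ) (hk : k < N) (h1 : ∀ i, i < k → w i = 1)
    (h0 : ∀ i, k < i → w i = 0) :
    v 0 + ∑ i ∈ Finset.range N, (v (i+1) - v i) * w i = v k + (v (k+1) - v k) * w k := by
  induction N, hk using Nat.le_induction with
  | base =>
    rw [Finset.sum_range_succ]
    have : ∑ i ∈ Finset.range k, (v (i+1) - v i) * w i = ∑ i ∈ Finset.range k, (v (i+1) - v i) := by
      apply Finset.sum_congr rfl
      intro i hi
      rw [h1 i (Finset.mem_range.mp hi), mul_one]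
    rw [this, Finset.sum_range_sub]; ring
  | succ N hN ih =>
    rw [Finset.sum_range_succ, h0 N hN, mul_zero, add_zero, ih]

lemma bk_idx (n q m : ℕ) (hq : q < n) :
    ((m + n - 1 - q) / n) * n + q + 1 ≤ m + n ∧ m ≤ ((m + n - 1 - q) / n) * n + q ∧
    (m % n ≠ q → m + 1 ≤ ((m + n - 1 - q) / n) * n + q) := by
  have hn : 0 < n := by omega
  have h1 := Nat.div_add_mod (m + n - 1 - q) n
  have h2 := Nat.mod_lt (m + n - 1 - q) hn
  set k := (m + n - 1 - q) / n
  rw [mul_comm n k] at h1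
  refine ⟨by omega, by omega, fun h => ?_⟩
  by_contra hc
  have : m = k * n + q := by omega
  apply h
  rw [this, Nat.mul_add_mod', Nat.mod_eq_of_lt hq]

lemma bk_stair (v : ℕ → ℝ) (hv : Monotone v) (n q M : ℕ) (hq : q < n) :
    ∃ S : ℝ → ℝ, Continuous S ∧ Monotone S ∧ ∀ x : ℝ, 0 ≤ x → x ≤ 1 →
      v ((⌊x * M⌋₊ + n - 1 - q) / n) ≤ S x ∧ S x ≤ v ((⌊x * M⌋₊ + n - 1 - q) / n + 1) ∧
      (⌊x * M⌋₊ % n ≠ q → S x = v ((⌊x * M⌋₊ + n - 1 - q) / n)) := by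
  refine ⟨fun x => v 0 + ∑ i ∈ Finset.range (M+1),
    (v (i+1) - v i) * max 0 (min 1 (x * M - (i * n + q))), by fun_prop, ?_, ?_⟩
  · intro x y hxy
    have hM : (0:ℝ) ≤ M := by positivity
    dsimp only
    gcongr with i hi
    exact sub_nonneg.mpr (hv (Nat.le_succ i))
  · intro x hx0 hx1
    obtain ⟨a1, a2, a3⟩ := bk_idx n q ⌊x * M⌋₊ hq
    have hM : (0:ℝ) ≤ M := by positivity
    have f1 : (⌊x * M⌋₊ : ℝ) ≤ x * M := Nat.floor_le (by positivity)
    have f2 : x * M < ⌊x * M⌋₊ + 1 := Nat.lt_floor_add_one _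
    have hm : ⌊x * M⌋₊ ≤ M := by
      have : (⌊x * M⌋₊ : ℝ) ≤ M := by nlinarith
      exact_mod_cast this
    set m := ⌊x * M⌋₊
    set k := (m + n - 1 - q) / n
    have hkN : k < M + 1 := by
      by_contra hc
      push Not at hc
      have : (M + 1) * n ≤ k * n := Nat.mul_le_mul_right _ hc
      have : M ≤ M * n := Nat.le_mul_of_pos_right _ (by omega)
      nlinarith
    have key := bk_sum_split v (fun i => max 0 (min 1 (x * M - (i * n + q)))) k (M+1) hkN
      (by
        intro i hi
        have : (i + 1) * n ≤ k * n := Nat.mul_le_mul_right _ hi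
        have : i * n + q + 1 ≤ m := by nlinarith
        have : (i * n + q + 1 : ℝ) ≤ m := by exact_mod_cast this
        rw [min_eq_left (by linarith)]; simp)
      (by
        intro i hi
        have : (k + 1) * n ≤ i * n := Nat.mul_le_mul_right _ hi
        have : m + 1 ≤ i * n + q := by nlinarith
        have : (m + 1 : ℝ) ≤ i * n + q := by exact_mod_cast this
        apply max_eq_left
        exact (min_le_right _ _).trans (by linarith))
    dsimp only at key ⊢
    rw [key]
    have hvk := hv (Nat.le_succ k)
    have w0 : 0 ≤ max 0 (min 1 (x * M - (k * n + q))) := le_max_left _ _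
    have w1 : max 0 (min 1 (x * M - (k * n + q))) ≤ 1 := max_le zero_le_one (min_le_left _ _)
    refine ⟨by nlinarith, by nlinarith, fun h => ?_⟩
    have := a3 h
    have : (m + 1 : ℝ) ≤ k * n + q := by exact_mod_cast this
    rw [max_eq_left ((min_le_right _ _).trans (by linarith))]; simp

lemma bk_one (φ : C(BKI, ℝ)) (hφ : Monotone φ) (ε : ℝ) (hε : 0 < ε) :
    ∃ δ > 0, ∀ n q M : ℕ, q < n → 0 < M → (n : ℝ) / M < δ →
      ∃ φ' : C(BKI, ℝ), Monotone φ' ∧ (∀ x, |φ' x - φ x| < ε) ∧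
        ∃ v : ℕ → ℚ, StrictMono v ∧ ∀ x : BKI, ⌊(x:ℝ) * M⌋₊ % n ≠ q →
          φ' x = v ((⌊(x:ℝ) * M⌋₊ + n - 1 - q) / n) := by
  have huc := CompactSpace.uniformContinuous_of_continuous φ.continuous
  obtain ⟨δ, hδ, h⟩ := Metric.uniformContinuous_iff.mp huc (ε/2) (by linarith)
  refine ⟨min (δ/2) (1/2), by positivity, ?_⟩
  intro n q M hq hM hnM
  have hM' : (0:ℝ) < M := by exact_mod_cast hM
  have hn1 : (n:ℝ)/M < δ/2 := lt_of_lt_of_le hnM (min_le_left _ _)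
  have hn2 : (n:ℝ)/M < 1/2 := lt_of_lt_of_le hnM (min_le_right _ _)
  have hn0 : 0 < (n:ℝ)/M := by
    have : (0:ℝ) < n := by exact_mod_cast (by omega : 0 < n)
    positivity
  let u : ℝ → ℝ := fun t => φ (Set.projIcc 0 1 zero_le_one t) + ε/8 * t
  have hu : StrictMono u := by
    intro s t hst
    have : φ (Set.projIcc 0 1 zero_le_one s) ≤ φ (Set.projIcc 0 1 zero_le_one t) :=
      hφ (Set.monotone_projIcc _ hst.le)
    have : ε/8 * s < ε/8*t := by gcongr
    simp only [u]; linarith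
  let τ : ℕ → ℝ := fun k => (k - 1) * (n/M) + (q+1)/M
  have hτs : ∀ k, τ (k+1) = τ k + n/M := by
    intro k; simp only [τ]; push_cast; ring
  have hex : ∀ k, ∃ r : ℚ, u (τ k) < r ∧ (r:ℝ) < u (τ (k+1)) := fun k =>
    exists_rat_btwn (hu (by rw [hτs]; linarith))
  choose v hv1 hv2 using hex
  have hv : StrictMono v := strictMono_nat_of_lt_succ fun k => by
    have := (hv2 k).trans (hv1 (k+1))
    exact_mod_cast this
  obtain ⟨S, hSc, hSm, hS⟩ := bk_stair (fun k => (v k : ℝ))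
    (fun i j hij => by
      have := hv.monotone hij
      dsimp only
      exact_mod_cast this) n q M hq
  refine ⟨⟨fun x => S x, by fun_prop⟩, fun x y hxy => hSm hxy, ?_, v, hv, ?_⟩
  · intro x
    obtain ⟨b1, b2, -⟩ := hS x x.2.1 x.2.2
    obtain ⟨a1, a2, -⟩ := bk_idx n q ⌊(x:ℝ) * M⌋₊ hq
    have f1 : (⌊(x:ℝ) * M⌋₊ : ℝ) ≤ x * M := Nat.floor_le (mul_nonneg x.2.1 hM'.le)
    have f2 : (x:ℝ) * M < ⌊(x:ℝ) * M⌋₊ + 1 := Nat.lt_floor_add_one _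
    set m := ⌊(x:ℝ) * M⌋₊
    set k := (m + n - 1 - q) / n
    have a1' : (k * n + q + 1 : ℝ) ≤ m + n := by exact_mod_cast a1
    have a2' : (m : ℝ) ≤ k * n + q := by exact_mod_cast a2
    have t1 : τ k ≤ x := by
      have : τ k = ((k * n + q + 1) - n) / M := by simp only [τ]; ring
      rw [this, div_le_iff₀ hM']; linarith
    have t2 : x ≤ τ (k+1) := by
      have : τ (k+1) = (k * n + q + 1) / M := by simp only [τ]; push_cast; ring
      rw [this, le_div_iff₀ hM']; linarith
    have e1 := hτs k
    have e2 := hτs (k+1)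
    have close : ∀ t : ℝ, |t - (x:ℝ)| < δ → |φ (Set.projIcc 0 1 zero_le_one t) - φ x| < ε/2 := by
      intro t ht
      have : dist (Set.projIcc (0:ℝ) 1 zero_le_one t) x < δ := by
        refine lt_of_le_of_lt ?_ ht
        have := Set.abs_projIcc_sub_projIcc (h := zero_le_one (α := ℝ)) (c := t) (d := x)
        rwa [Set.projIcc_val] at this
      exact h this
    have c1 := abs_lt.mp (close (τ k) (by rw [abs_lt]; constructor <;> linarith))
    have c2 := abs_lt.mp (close (τ (k+2)) (by
      rw [abs_lt]; constructor <;> linarith))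
    have d1 := hv1 k
    have d2 := hv2 (k+1)
    have x0 := x.2.1
    have x1 := x.2.2
    simp only [u] at d1 d2
    change |S x - φ x| < ε
    rw [abs_lt]
    constructor
    · nlinarith
    · have : τ (k+1+1) ≤ 2 := by linarith
      have : ε/8 * τ (k+1+1) ≤ ε/8*2 := by gcongr
      linarith [c2.2]
  · intro x hx
    exact (hS x x.2.1 x.2.2).2.2 hx

lemma bk_cell (n q M : ℕ) (hq : q < n) (hM : 0 < M) (x : ℝ) (hx0 : 0 ≤ x) (hx1 : x ≤ 1) :
    (⌊x * M⌋₊ + n - 1 - q) / n < M + 1 ∧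
    |((((⌊x * M⌋₊ + n - 1 - q) / n : ℕ) : ℝ) * n + q + 1 - n) / M - x| ≤ n / M := by
  obtain ⟨a1, a2, a3⟩ := bk_idx n q ⌊x * M⌋₊ hq
  have hM' : (0:ℝ) < M := by exact_mod_cast hM
  have f1 : (⌊x * M⌋₊ : ℝ) ≤ x * M := Nat.floor_le (by positivity)
  have f2 : x * M < ⌊x * M⌋₊ + 1 := Nat.lt_floor_add_one _
  have hm : ⌊x * M⌋₊ ≤ M := by
    have : (⌊x * M⌋₊ : ℝ) ≤ M := by nlinarith
    exact_mod_cast this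
  set m := ⌊x * M⌋₊
  set k := (m + n - 1 - q) / n
  constructor
  · by_contra hc
    push Not at hc
    have : (M + 1) * n ≤ k * n := Nat.mul_le_mul_right _ hc
    have : M ≤ M * n := Nat.le_mul_of_pos_right _ (by omega)
    nlinarith
  · have a1' : (k * n + q + 1 : ℝ) ≤ m + n := by exact_mod_cast a1
    have a2' : (m : ℝ) ≤ k * n + q := by exact_mod_cast a2
    have e : ((k:ℝ) * n + q + 1 - n) / M - x = (k * n + q + 1 - n - x * M) / M := by
      field_simp
    rw [e, abs_div, abs_of_pos hM']
    gcongr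
    rw [abs_le]
    constructor <;> linarith

lemma bk_interp {ι : Type*} (s : Finset ι) (y r : ι → ℝ) (hy : Set.InjOn y s) (C : ℝ)
    (hC : 0 ≤ C) (hr : ∀ i, |r i| ≤ C) :
    ∃ g : C(ℝ, ℝ), (∀ t, |g t| ≤ C) ∧ ∀ i ∈ s, g (y i) = r i := by
  classical
  refine ⟨⟨fun t => max (-C) (min C ((Lagrange.interpolate s y r).eval t)), by fun_prop⟩, ?_, ?_⟩
  · intro t
    rw [abs_le]
    exact ⟨le_max_left _ _, max_le (by linarith) (min_le_left _ _)⟩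
  · intro i hi
    have := abs_le.mp (hr i)
    simp only [ContinuousMap.coe_mk, Lagrange.eval_interpolate_at_node r hy hi]
    rw [min_eq_right this.2, max_eq_right this.1]

lemma bk_lam (d : ℕ) : ∃ lam : Fin d → ℝ, (∀ p, 0 < lam p) ∧ LinearIndependent ℚ lam := by
  have ht := transcendental_liouvilleNumber (m := 2) le_rfl
  set t := liouvilleNumber (2:ℕ)
  have h1 : LinearIndependent ℤ (fun n : ℕ => t ^ n) := by
    have := (Polynomial.basisMonomials ℤ).linearIndependent.map'
      (Polynomial.aeval t).toLinearMap
      (LinearMap.ker_eq_bot.mpr (transcendental_iff_injective.mp ht))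
    have e : (fun n : ℕ => t ^ n) =
        (Polynomial.aeval t).toLinearMap ∘ (Polynomial.basisMonomials ℤ) := by
      ext n
      simp
    rw [e]
    exact this
  have h2 : LinearIndependent ℚ (fun n : ℕ => t ^ n) :=
    (LinearIndependent.iff_fractionRing ℤ ℚ).mp h1
  have t0 : t ≠ 0 := by
    intro h
    apply ht
    rw [h]
    exact isAlgebraic_zero
  refine ⟨fun p => t ^ (2 * p.val), fun p => ?_, ?_⟩
  · exact (even_two_mul _).pow_pos t0
  · exact h2.comp (fun p : Fin d => 2 * p.val) (fun a b h => by
      apply Fin.ext; simpa using h)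

lemma bk_iter {n : ℕ} {X : Type*} [TopologicalSpace X] [CompactSpace X] (Φ : Fin n → C(X, ℝ))
    (θ : ℝ) (h0 : 0 ≤ θ) (h1 : θ < 1)
    (h : ∀ f : C(X, ℝ), ∃ g : Fin n → C(ℝ, ℝ), (∀ q t, |g q t| ≤ 2 * ‖f‖) ∧
      ‖f - ∑ q, (g q).comp (Φ q)‖ ≤ θ * ‖f‖) (f : C(X, ℝ)) :
    ∃ g : Fin n → C(ℝ, ℝ), ∀ x, f x = ∑ q, g q (Φ q x) := by
  choose s hs1 hs2 using h
  let F : ℕ → C(X, ℝ) := fun k => (fun f => f - ∑ q, (s f q).comp (Φ q))^[k] f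
  have hFs : ∀ k, F (k+1) = F k - ∑ q, (s (F k) q).comp (Φ q) := by
    intro k; simp only [F, Function.iterate_succ_apply']
  have hF : ∀ k, ‖F k‖ ≤ θ ^ k * ‖f‖ := by
    intro k
    induction k with
    | zero => simp [F]
    | succ k ih =>
      rw [hFs]
      refine (hs2 _).trans ?_
      rw [pow_succ', mul_assoc]
      gcongr
  have hb : ∀ q k t, ‖s (F k) q t‖ ≤ 2 * ‖f‖ * θ ^ k := by
    intro q k t
    refine (hs1 _ _ _).trans ?_
    linarith [hF k]
  have hsum : Summable (fun k : ℕ => 2 * ‖f‖ * θ ^ k) :=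
    (summable_geometric_of_lt_one h0 h1).mul_left _
  refine ⟨fun q => ⟨fun t => ∑' k, s (F k) q t,
    continuous_tsum (fun k => (s (F k) q).continuous) hsum (hb q)⟩, fun x => ?_⟩
  have hS : HasSum (fun k => ∑ q, s (F k) q (Φ q x)) (∑ q, ∑' k, s (F k) q (Φ q x)) :=
    hasSum_sum fun q _ => (Summable.of_norm_bounded hsum (fun k => hb q k _)).hasSum
  have e : ∀ N, ∑ k ∈ Finset.range N, ∑ q, s (F k) q (Φ q x) = f x - F N x := by
    intro N
    induction N with
    | zero => simp [F]
    | succ N ih =>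
      rw [Finset.sum_range_succ, ih, hFs]
      simp [ContinuousMap.sum_apply]
      ring
  have hlim : Filter.Tendsto (fun N => f x - F N x) Filter.atTop (nhds (f x - 0)) := by
    refine Filter.Tendsto.sub tendsto_const_nhds ?_
    refine squeeze_zero_norm (a := fun k => θ ^ k * ‖f‖) (fun k => ((F k).norm_coe_le_norm x).trans (hF k)) ?_
    simpa using (tendsto_pow_atTop_nhds_zero_of_lt_one h0 h1).mul_const ‖f‖
  have := hS.tendsto_sum_nat
  simp only [e] at this
  simpa using tendsto_nhds_unique hlim this

lemma bk_dense (d n : ℕ) (hn : n = 2 * d + 1) (lam : Fin d → ℝ) (hlam : LinearIndependent ℚ lam)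
    (f : C(Fin d → BKI, ℝ)) (hf : 0 < ‖f‖) (φ : Fin n → C(BKI, ℝ))
    (hφ : ∀ q, Monotone (φ q)) (ε : ℝ) (hε : 0 < ε) :
    ∃ φ' : Fin n → C(BKI, ℝ), (∀ q, Monotone (φ' q)) ∧ (∀ q x, |φ' q x - φ q x| < ε) ∧
      ∃ g : Fin n → C(ℝ, ℝ), (∀ q t, |g q t| ≤ ‖f‖) ∧
        ∀ x, |f x - ∑ q, g q (∑ p, lam p * φ' q (x p))| ≤ (4*d+1)/(4*d+2) * ‖f‖ := by
  classical
  have hn1 : (n:ℝ) = 2 * d + 1 := by rw [hn]; push_cast; ring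
  have hnpos : (0:ℝ) < n := by rw [hn1]; positivity
  have hn1' : (1:ℝ) ≤ n := by rw [hn1]; linarith [(Nat.cast_nonneg d : (0:ℝ) ≤ d)]
  have huc := CompactSpace.uniformContinuous_of_continuous f.continuous
  obtain ⟨δf, hδf, hfu⟩ := Metric.uniformContinuous_iff.mp huc (‖f‖/(2*n)) (by positivity)
  choose δ hδ hone using fun q => bk_one (φ q) (hφ q) ε hε
  have htend : Filter.Tendsto (fun M : ℕ => (n:ℝ) / M) Filter.atTop (nhds 0) :=
    tendsto_const_div_atTop_nhds_zero_nat (n:ℝ)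
  have hev : ∀ᶠ M : ℕ in Filter.atTop, (0 < M) ∧ (n:ℝ)/M < δf ∧ ∀ q, (n:ℝ)/M < δ q :=
    (Filter.eventually_gt_atTop 0).and ((htend.eventually_lt_const hδf).and
      (Filter.eventually_all.mpr fun q => htend.eventually_lt_const (hδ q)))
  obtain ⟨M, hM0, hMf, hMq⟩ := hev.exists
  choose φ' hφ'm hφ'c v hv hφ'v using fun q : Fin n => hone q n q M q.2 hM0 (hMq q)
  refine ⟨φ', hφ'm, hφ'c, ?_⟩
  let ctr : Fin n → (Fin d → ℕ) → (Fin d → BKI) := fun q k p =>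
    Set.projIcc 0 1 zero_le_one (((k p : ℝ) * n + (q.val:ℝ) + 1 - n) / M)
  have hg : ∀ q : Fin n, ∃ g : C(ℝ, ℝ), (∀ t, |g t| ≤ ‖f‖ / n) ∧
      ∀ k ∈ Fintype.piFinset (fun _ : Fin d => Finset.range (M+1)),
        g (∑ p, lam p * (v q (k p) : ℝ)) = f (ctr q k) / n := by
    intro q
    apply bk_interp (Fintype.piFinset (fun _ : Fin d => Finset.range (M+1)))
      (fun k => ∑ p, lam p * (v q (k p) : ℝ)) (fun k => f (ctr q k) / n)
    · intro k _ k' _ hkk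
      dsimp only at hkk
      have h0 : ∑ p, (v q (k p) - v q (k' p)) • lam p = 0 := by
        have : ∑ p, (v q (k p) - v q (k' p)) • lam p
            = ∑ p, lam p * (v q (k p) : ℝ) - ∑ p, lam p * (v q (k' p) : ℝ) := by
          rw [← Finset.sum_sub_distrib]
          apply Finset.sum_congr rfl
          intro p _
          rw [Rat.smul_def]; push_cast; ring
        rw [this, hkk, sub_self]
      have := Fintype.linearIndependent_iff.mp hlam _ h0
      funext p
      exact (hv q).injective (sub_eq_zero.mp (this p))
    · positivity
    · intro k
      rw [abs_div, abs_of_pos hnpos]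
      gcongr
      exact f.norm_coe_le_norm _
  choose g hgb hgv using hg
  refine ⟨g, fun q t => (hgb q t).trans (div_le_self (norm_nonneg _) hn1'), fun x => ?_⟩
  let bad : Finset (Fin n) := Finset.univ.filter fun q => ∃ p, ⌊(x p : ℝ) * M⌋₊ % n = q.val
  have hbad : bad.card ≤ d := by
    have hnn : 0 < n := by omega
    have : bad ⊆ Finset.univ.image
        (fun p : Fin d => (⟨⌊(x p : ℝ) * M⌋₊ % n, Nat.mod_lt _ hnn⟩ : Fin n)) := by
      intro q hq
      obtain ⟨p, hp⟩ := (Finset.mem_filter.mp hq).2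
      exact Finset.mem_image.mpr ⟨p, Finset.mem_univ _, Fin.ext hp⟩
    refine (Finset.card_le_card this).trans (Finset.card_image_le.trans ?_)
    simp
  have hterm : ∀ q, |f x / n - g q (∑ p, lam p * φ' q (x p))| ≤
      ‖f‖/(2*n)/n + if q ∈ bad then 2 * ‖f‖ / n else 0 := by
    intro q
    by_cases hq : q ∈ bad
    · rw [if_pos hq]
      have h1 : |f x / n| ≤ ‖f‖ / n := by
        rw [abs_div, abs_of_pos hnpos]
        gcongr
        exact f.norm_coe_le_norm _
      have h2 := hgb q (∑ p, lam p * φ' q (x p))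
      have h3 := abs_sub (f x / n) (g q (∑ p, lam p * φ' q (x p)))
      have h4 : 0 ≤ ‖f‖/(2*n)/n := by positivity
      have h5 : 2 * ‖f‖ / n = ‖f‖ / n + ‖f‖ / n := by ring
      linarith
    · rw [if_neg hq, add_zero]
      have hgood : ∀ p, ⌊(x p : ℝ) * M⌋₊ % n ≠ q.val := by
        intro p hp
        exact hq (Finset.mem_filter.mpr ⟨Finset.mem_univ _, p, hp⟩)
      let k : Fin d → ℕ := fun p => (⌊(x p : ℝ) * M⌋₊ + n - 1 - q) / n
      have hcell := fun p => bk_cell n q M q.2 hM0 (x p) (x p).2.1 (x p).2.2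
      have e1 : ∑ p, lam p * φ' q (x p) = ∑ p, lam p * (v q (k p) : ℝ) := by
        apply Finset.sum_congr rfl
        intro p _
        rw [hφ'v q (x p) (hgood p)]
      rw [e1, hgv q k (Fintype.mem_piFinset.mpr fun p => Finset.mem_range.mpr (hcell p).1),
        ← sub_div, abs_div, abs_of_pos hnpos]
      gcongr
      have hd : dist x (ctr q k) < δf := by
        rw [dist_pi_lt_iff hδf]
        intro p
        refine lt_of_le_of_lt ?_ hMf
        refine le_trans ?_ (hcell p).2
        have := Set.abs_projIcc_sub_projIcc (h := zero_le_one (α := ℝ))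
          (c := ((k p : ℝ) * n + (q.val:ℝ) + 1 - n) / M) (d := x p)
        rw [Set.projIcc_val] at this
        rw [dist_comm]
        exact this
      exact (hfu hd).le
  have e : f x - ∑ q, g q (∑ p, lam p * φ' q (x p)) =
      ∑ q, (f x / n - g q (∑ p, lam p * φ' q (x p))) := by
    rw [Finset.sum_sub_distrib]
    simp
    field_simp
  rw [e]
  refine (Finset.abs_sum_le_sum_abs _ _).trans ((Finset.sum_le_sum fun q _ => hterm q).trans ?_)
  rw [Finset.sum_add_distrib, Finset.sum_ite_mem]
  simp only [Finset.sum_const, Finset.card_univ, Fintype.card_fin, Finset.univ_inter, nsmul_eq_mul]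
  have hb' : (bad.card : ℝ) ≤ d := by exact_mod_cast hbad
  calc (n:ℝ) * (‖f‖/(2*n)/n) + bad.card * (2 * ‖f‖ / n)
      ≤ (n:ℝ) * (‖f‖/(2*n)/n) + d * (2 * ‖f‖ / n) := by gcongr
    _ = (4*d+1)/(4*d+2) * ‖f‖ := by
      have : (4*d+2 : ℝ) = 2 * n := by rw [hn1]; ring
      rw [this]
      field_simp
      ring

/-- The monotone functions in `C([0,1], ℝ)`. -/
abbrev BKMono : Type := {φ : C(BKI, ℝ) // Monotone φ}

lemma bk_closed : IsClosed {φ : C(BKI, ℝ) | Monotone φ} := by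
  have : {φ : C(BKI, ℝ) | Monotone φ} =
      ⋂ (x : BKI) (y : BKI) (_ : x ≤ y), {φ : C(BKI, ℝ) | φ x ≤ φ y} := by
    ext φ
    simp only [Set.mem_ofPred_eq, Set.mem_iInter]
    exact ⟨fun h x y hxy => h hxy, fun h x y hxy => h x y hxy⟩
  rw [this]
  refine isClosed_iInter fun x => isClosed_iInter fun y => isClosed_iInter fun _ => ?_
  exact isClosed_le (continuous_eval_const x) (continuous_eval_const y)

instance : CompleteSpace BKMono := bk_closed.completeSpace_coe

/-- The inner sum, as a continuous function on the cube. -/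
noncomputable def bkPhi {d : ℕ} (lam : Fin d → ℝ) (φ : C(BKI, ℝ)) : C(Fin d → BKI, ℝ) :=
  ∑ p, lam p • φ.comp ⟨fun x => x p, continuous_apply p⟩

lemma bkPhi_apply {d : ℕ} (lam : Fin d → ℝ) (φ : C(BKI, ℝ)) (x : Fin d → BKI) :
    bkPhi lam φ x = ∑ p, lam p * φ (x p) := by
  simp [bkPhi, ContinuousMap.sum_apply]

lemma bkPhi_cont {d : ℕ} (lam : Fin d → ℝ) : Continuous (bkPhi lam) := by
  unfold bkPhi
  refine continuous_finsetSum _ fun p _ => ?_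
  have h := ContinuousMap.continuous_precomp (Z := ℝ)
    (⟨fun x => x p, continuous_apply p⟩ : C(Fin d → BKI, BKI))
  exact (continuous_const_smul (lam p)).comp h

lemma bk_core (d n : ℕ) (hn : n = 2 * d + 1) (lam : Fin d → ℝ) (hlam : LinearIndependent ℚ lam) :
    ∃ φ : Fin n → C(BKI, ℝ), (∀ q, Monotone (φ q)) ∧ ∀ f : C(Fin d → BKI, ℝ),
      ∃ g : Fin n → C(ℝ, ℝ), ∀ x, f x = ∑ q, g q (bkPhi lam (φ q) x) := by
  obtain ⟨θ, hθ1, hθ2⟩ : ∃ θ : ℝ, (4*d+1)/(4*d+2) < θ ∧ θ < 1 := by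
    apply exists_between
    rw [div_lt_one (by positivity)]
    linarith
  have hθ0 : 0 < θ := lt_of_le_of_lt (by positivity) hθ1
  let Ω : C(Fin d → BKI, ℝ) → Set (Fin n → BKMono) := fun f =>
    ⋃ (g : Fin n → C(ℝ, ℝ)) (_ : ∀ q t, |g q t| ≤ ‖f‖),
      {φ | ‖f - ∑ q, (g q).comp (bkPhi lam (φ q).1)‖ < θ * ‖f‖}
  have hopen : ∀ f, IsOpen (Ω f) := by
    intro f
    refine isOpen_iUnion fun g => isOpen_iUnion fun _ => ?_
    refine isOpen_lt (Continuous.norm (continuous_const.sub ?_)) continuous_const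
    refine continuous_finsetSum _ fun q _ => (ContinuousMap.continuous_postcomp (g q)).comp ?_
    exact (bkPhi_cont lam).comp (continuous_subtype_val.comp (continuous_apply q))
  have hdense : ∀ f, 0 < ‖f‖ → Dense (Ω f) := by
    intro f hf
    rw [Metric.dense_iff]
    intro φ ε hε
    obtain ⟨φ', h1, h2, g, h3, h4⟩ := bk_dense d n hn lam hlam f hf (fun q => (φ q).1)
      (fun q => (φ q).2) (ε/2) (by linarith)
    refine ⟨fun q => ⟨φ' q, h1 q⟩, ?_, ?_⟩
    · rw [Metric.mem_ball, dist_pi_lt_iff hε]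
      intro q
      refine lt_of_le_of_lt ?_ (half_lt_self hε)
      exact (ContinuousMap.dist_le (by linarith)).mpr fun x => (h2 q x).le
    · refine Set.mem_iUnion₂.mpr ⟨g, h3, ?_⟩
      refine lt_of_le_of_lt (b := (4*d+1)/(4*d+2) * ‖f‖) ?_ (by gcongr)
      refine (ContinuousMap.norm_le _ (by positivity)).mpr fun x => ?_
      have := h4 x
      simpa [ContinuousMap.sum_apply, bkPhi_apply] using this
  let D : ℕ → C(Fin d → BKI, ℝ) := TopologicalSpace.denseSeq _
  have hD : DenseRange D := TopologicalSpace.denseRange_denseSeq _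
  have : Nonempty (Fin n → BKMono) := ⟨fun _ => ⟨0, fun _ _ _ => le_rfl⟩⟩
  have hB : Dense (⋂ i : {i : ℕ // 0 < ‖D i‖}, Ω (D i)) :=
    dense_iInter_of_isOpen (fun i => hopen _) (fun i => hdense _ i.2)
  obtain ⟨φ, hφ⟩ := hB.nonempty
  rw [Set.mem_iInter] at hφ
  refine ⟨fun q => (φ q).1, fun q => (φ q).2, fun f => ?_⟩
  refine bk_iter (fun q => bkPhi lam (φ q).1) ((1+θ)/2) (by linarith) (by linarith) ?_ f
  clear f
  intro f
  rcases (norm_nonneg f).eq_or_lt with hf | hf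
  · refine ⟨fun q => 0, by simp, ?_⟩
    have : f = 0 := norm_eq_zero.mp hf.symm
    subst this
    have : ∀ h : C(Fin d → BKI, ℝ), (0 : C(ℝ, ℝ)).comp h = 0 := fun h => by ext; simp
    simp [this]
  · obtain ⟨i, hi⟩ := hD.exists_dist_lt f (ε := (1-θ)/4 * ‖f‖) (by
      have : 0 < 1 - θ := by linarith
      positivity)
    rw [dist_eq_norm] at hi
    have hDi : ‖D i‖ ≤ ‖f‖ + ‖f - D i‖ := norm_le_norm_add_norm_sub f (D i)
    have hDi' : ‖f‖ ≤ ‖D i‖ + ‖f - D i‖ := norm_le_norm_add_norm_sub' f (D i)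
    obtain ⟨g, hg1, hg2⟩ := Set.mem_iUnion₂.mp (hφ ⟨i, by nlinarith⟩)
    refine ⟨g, fun q t => (hg1 q t).trans (by dsimp only; nlinarith), ?_⟩
    have hg2' : ‖D i - ∑ q, (g q).comp (bkPhi lam (φ q).1)‖ < θ * ‖D i‖ := hg2
    have e : f - ∑ q, (g q).comp (bkPhi lam (φ q).1) =
      (f - D i) + (D i - ∑ q, (g q).comp (bkPhi lam (φ q).1)) := by abel
    have := norm_add_le (f - D i) (D i - ∑ q, (g q).comp (bkPhi lam (φ q).1))
    rw [← e] at this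
    have h5 : θ * ‖D i‖ ≤ θ * ‖f‖ + ‖f - D i‖ := by nlinarith [norm_nonneg (f - D i)]
    refine this.trans ?_
    nlinarith

lemma bk_glue_inner (n : ℕ) (φ : Fin n → C(BKI, ℝ)) (hφ : ∀ q, Monotone (φ q)) :
    ∃ (ψ : ℝ → ℝ) (C : Fin n → ℝ), Continuous ψ ∧ Monotone ψ ∧
      ∀ (q : Fin n) (x : BKI), ψ ((x:ℝ) + (q.val:ℝ) * 2) = φ q x + C q := by
  refine ⟨fun y => ∑ r : Fin n, φ r (Set.projIcc 0 1 zero_le_one (y - r.val * 2)),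
    fun q => ∑ r ∈ Finset.univ.erase q, φ r (if r < q then 1 else 0), by fun_prop, ?_, ?_⟩
  · intro y z hyz
    exact Finset.sum_le_sum fun r _ => hφ r (Set.monotone_projIcc _ (by linarith))
  · intro q x
    dsimp only
    rw [← Finset.add_sum_erase _ _ (Finset.mem_univ q)]
    congr 1
    · rw [add_sub_cancel_right, Set.projIcc_val]
    · apply Finset.sum_congr rfl
      intro r hr
      have hne := Finset.ne_of_mem_erase hr
      have x0 := x.2.1
      have x1 := x.2.2
      congr 1
      split_ifs with h
      · have : r.val + 1 ≤ q.val := h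
        have : (r.val + 1 : ℝ) ≤ q.val := by exact_mod_cast this
        exact Set.projIcc_of_right_le _ (by linarith)
      · have : q.val + 1 ≤ r.val := by
          have := Fin.val_ne_of_ne hne
          have h' : ¬ r.val < q.val := h
          omega
        have : (q.val + 1 : ℝ) ≤ r.val := by exact_mod_cast this
        exact Set.projIcc_of_le_left _ (by linarith)

lemma bk_glue_outer (n : ℕ) (B : ℝ) (g : Fin n → C(ℝ, ℝ)) :
    ∃ G : ℝ → ℝ, Continuous G ∧
      ∀ (q : Fin n) (y : ℝ), |y| ≤ B → G (y + (q.val:ℝ) * (2 * B + 1)) = g q y := by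
  refine ⟨fun z => ∑ r : Fin n, max 0 (min 1 (B + 1 - |z - r.val * (2*B+1)|)) *
    g r (z - r.val * (2*B+1)), by fun_prop, ?_⟩
  intro q y hy
  have hB : 0 ≤ B := (abs_nonneg y).trans hy
  dsimp only
  rw [Finset.sum_eq_single q]
  · rw [add_sub_cancel_right, min_eq_left (by linarith)]; simp
  · intro r _ hr
    have hK : 2 * B + 1 ≤ |((q.val:ℝ) - r.val) * (2*B+1)| := by
      rw [abs_mul, abs_of_pos (by linarith : 0 < 2*B+1)]
      have : (1:ℝ) ≤ |(q.val:ℝ) - r.val| := by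
        have h1 : (1:ℤ) ≤ |(q.val:ℤ) - r.val| := by
          apply Int.one_le_abs
          have := Fin.val_ne_of_ne hr
          omega
        exact_mod_cast h1
      nlinarith
    have h2 : |((q.val:ℝ) - r.val) * (2*B+1)| ≤
        |y + q.val * (2*B+1) - r.val * (2*B+1)| + |y| := by
      have e : ((q.val:ℝ) - r.val) * (2*B+1) = (y + q.val * (2*B+1) - r.val * (2*B+1)) - y := by
        ring
      rw [e]
      exact abs_sub _ _
    rw [max_eq_left ((min_le_right _ _).trans (by linarith)), zero_mul]
  · simp


/-- **Braun's variant of the Kolmogorov–Arnold Representation Theorem** (2009):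
for every `d ≥ 2` there exist a constant `a > 0`, positive constants `λ_p`, real
constants `c_q` (`0 ≤ q ≤ 2d`), and a continuous, monotonically increasing
`ψ : ℝ → ℝ`, such that every continuous real function `f` on `[0,1]^d` is
representable as
`f(x₁,…,x_d) = Σ_{q=0}^{2d} g (Σ_{p=1}^{d} λ_p ψ(x_p + qa) + c_q)`
for some continuous function `g : ℝ → ℝ` depending on `f`. -/
theorem braun_kolmogorov_representation (d : ℕ) (hd : 2 ≤ d) :
    ∃ (a : ℝ), 0 < a ∧
    ∃ (lam : Fin d → ℝ), (∀ p, 0 < lam p) ∧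
    ∃ (c : Fin (2 * d + 1) → ℝ) (ψ : ℝ → ℝ),
      Continuous ψ ∧ Monotone ψ ∧
      ∀ f : (Fin d → Set.Icc (0:ℝ) 1) → ℝ, Continuous f →
        ∃ g : ℝ → ℝ, Continuous g ∧
          ∀ x, f x = ∑ q, g (∑ p, lam p * ψ ((x p : ℝ) + (q.val : ℝ) * a) + c q) := by
  obtain ⟨lam, hpos, hlam⟩ := bk_lam d
  obtain ⟨φ, hφ, hrep⟩ := bk_core d (2 * d + 1) rfl lam hlam
  obtain ⟨ψ, C, hψc, hψm, hψ⟩ := bk_glue_inner _ φ hφ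
  let B : ℝ := ∑ q, ‖bkPhi lam (φ q)‖
  refine ⟨2, two_pos, lam, hpos,
    fun q => (q.val:ℝ) * (2 * B + 1) - (∑ p, lam p) * C q, ψ, hψc, hψm, ?_⟩
  intro f hf
  obtain ⟨g, hg⟩ := hrep ⟨f, hf⟩
  obtain ⟨G, hGc, hG⟩ := bk_glue_outer _ B g
  refine ⟨G, hGc, fun x => ?_⟩
  have h1 := hg x
  rw [ContinuousMap.coe_mk] at h1
  rw [h1]
  apply Finset.sum_congr rfl
  intro q _
  rw [← hG q (bkPhi lam (φ q) x)]
  · congr 1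
    rw [bkPhi_apply]
    simp only [hψ, mul_add, Finset.sum_add_distrib, Finset.sum_mul]
    ring
  · refine ((bkPhi lam (φ q)).norm_coe_le_norm x).trans ?_
    exact Finset.single_le_sum (f := fun q => ‖bkPhi lam (φ q)‖)
      (fun _ _ => norm_nonneg _) (Finset.mem_univ q)
end

section
/- (Sternfeld's lower bound on the number of inner functions.) Let d ≥ 2 and m be positive integers. Suppose there exist continuous functions φ_1, …, φ_m : [0,1]^d → ℝ such that every continuous function f : [0,1]^d → ℝ can be written as f(x) = Σ_{q=1}^{m} g_q(φ_q(x)) for some continuous functions g_q : ℝ → ℝ (depending on f). Then m ≥ 2d + 1. -/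
namespace Stern

open Set Topology

/-- `F` is continuous and zero free on `C`. -/
def NV {W : Type*} [TopologicalSpace W] {N : ℕ} (F : W → Fin N → ℝ) (C : Set W) : Prop :=
  ContinuousOn F C ∧ ∀ x ∈ C, F x ≠ 0

/-- zero free maps into `ℝ^N` extend from closed subsets of `L` to `L`. -/
def Ext {W : Type*} [TopologicalSpace W] (L : Set W) (N : ℕ) : Prop :=
  ∀ (A : Set W) (f : W → Fin N → ℝ), IsClosed A → A ⊆ L → NV f A →
    ∃ F : W → Fin N → ℝ, NV F L ∧ EqOn F f A

/-- the unit cube -/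
def cube (j : ℕ) : Set (Fin j → ℝ) := Icc 0 1

lemma isCompact_cube (j : ℕ) : IsCompact (cube j) := isCompact_Icc

/-- the dimension notion: `E p K` is a version of `dim K < p`. -/
def E {X : Type*} [TopologicalSpace X] (p : ℕ) (K : Set X) : Prop :=
  ∀ j, Ext (K ×ˢ cube j) (p + j)

section

variable {W : Type*} [TopologicalSpace W] {N : ℕ}

lemma NV.mono {F : W → Fin N → ℝ} {C D : Set W} (h : NV F C) (hD : D ⊆ C) : NV F D :=
  ⟨h.1.mono hD, fun x hx => h.2 x (hD hx)⟩

lemma NV.congr {F G : W → Fin N → ℝ} {C : Set W} (h : NV F C) (hG : EqOn G F C) : NV G C :=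
  ⟨h.1.congr hG, fun x hx => by rw [hG hx]; exact h.2 x hx⟩

lemma NV.union {F : W → Fin N → ℝ} {C D : Set W} (h : NV F C) (h' : NV F D)
    (hC : IsClosed C) (hD : IsClosed D) : NV F (C ∪ D) :=
  ⟨h.1.union_of_isClosed h'.1 hC hD, fun x hx => hx.elim (h.2 x) (h'.2 x)⟩

lemma NV.glue {F G : W → Fin N → ℝ} {C D : Set W} (h : NV F C) (h' : NV G D)
    (hC : IsClosed C) (hD : IsClosed D) (hFG : EqOn F G (C ∩ D)) :
    ∃ H : W → Fin N → ℝ, NV H (C ∪ D) ∧ EqOn H F C ∧ EqOn H G D := by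
  classical
  let H : W → Fin N → ℝ := fun x => if x ∈ C then F x else G x
  have h1 : EqOn H F C := fun x hx => by simp [H, hx]
  have h2 : EqOn H G D := fun x hx => by
    by_cases hxC : x ∈ C
    · simp only [H, hxC, if_true]; exact hFG ⟨hxC, hx⟩
    · simp [H, hxC]
  exact ⟨H, (h.congr h1).union (h'.congr h2) hC hD, h1, h2⟩

lemma tietze [NormalSpace W] {A : Set W} (hA : IsClosed A) {f : W → Fin N → ℝ}
    (hf : ContinuousOn f A) : ∃ g : W → Fin N → ℝ, Continuous g ∧ EqOn g f A := by
  obtain ⟨g, hg⟩ := ContinuousMap.exists_restrict_eq hA ⟨A.domRestrict f, hf.domRestrict⟩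
  refine ⟨g, g.continuous, fun x hx => ?_⟩
  exact congrArg (fun k => k ⟨x, hx⟩) hg

lemma Ext.mono {L L' : Set W} (h : Ext L N) (hL : L' ⊆ L) : Ext L' N := by
  intro A f hA hAL hf
  obtain ⟨F, hF, hFf⟩ := h A f hA (hAL.trans hL) hf
  exact ⟨F, hF.mono hL, hFf⟩

/-- extension over a further piece having the extension property -/
lemma Ext.extend {L : Set W} (h : Ext L N) (hL : IsClosed L) {C : Set W} (hC : IsClosed C)
    {f : W → Fin N → ℝ} (hf : NV f C) : ∃ F, NV F (C ∪ L) ∧ EqOn F f C := by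
  obtain ⟨F, hF, hFf⟩ := h (C ∩ L) f (hC.inter hL) inter_subset_right
    (hf.mono inter_subset_left)
  obtain ⟨H, hH, h1, -⟩ := hf.glue hF hC hL hFf.symm
  exact ⟨H, hH, h1⟩

lemma Ext.extend_finset {ι : Type*} (s : Finset ι) {L : ι → Set W}
    (h : ∀ i ∈ s, Ext (L i) N) (hL : ∀ i ∈ s, IsClosed (L i)) {C : Set W} (hC : IsClosed C)
    {f : W → Fin N → ℝ} (hf : NV f C) : ∃ F, NV F (C ∪ ⋃ i ∈ s, L i) ∧ EqOn F f C := by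
  classical
  induction s using Finset.induction_on with
  | empty => exact ⟨f, by simpa using hf, fun _ _ => rfl⟩
  | insert a s ha ih =>
    obtain ⟨F, hF, hFf⟩ := ih (fun i hi => h i (Finset.mem_insert_of_mem hi))
      (fun i hi => hL i (Finset.mem_insert_of_mem hi))
    have hcl : IsClosed (C ∪ ⋃ i ∈ s, L i) :=
      hC.union (isClosed_biUnion_finset fun i hi => hL i (Finset.mem_insert_of_mem hi))
    obtain ⟨G, hG, hGF⟩ := (h a (Finset.mem_insert_self a s)).extend
      (hL a (Finset.mem_insert_self a s)) hcl hF
    refine ⟨G, hG.mono ?_, fun x hx => (hGF (Or.inl hx)).trans (hFf hx)⟩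
    rw [Finset.set_biUnion_insert]
    intro x hx
    simp only [mem_union] at hx ⊢
    tauto

end

/-- transport along a retract -/
lemma Ext.retract {W W' : Type*} [TopologicalSpace W] [TopologicalSpace W'] [T2Space W']
    {N : ℕ} {L : Set W} {L' : Set W'} (h : Ext L' N) (hL : IsCompact L)
    (i : W → W') (r : W' → W) (hi : Continuous i) (hr : Continuous r)
    (hiL : MapsTo i L L') (hri : ∀ x ∈ L, r (i x) = x) : Ext L N := by
  intro A f hA hAL hf
  have hAc : IsCompact A := hL.of_isClosed_subset hA hAL
  obtain ⟨F, hF, hFf⟩ := h (i '' A) (f ∘ r) (hAc.image hi).isClosed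
    (by rintro _ ⟨x, hx, rfl⟩; exact hiL (hAL hx)) (by
      constructor
      · refine hf.1.comp hr.continuousOn ?_
        rintro _ ⟨x, hx, rfl⟩
        rw [hri x (hAL hx)]; exact hx
      · rintro _ ⟨x, hx, rfl⟩
        simp only [Function.comp]
        rw [hri x (hAL hx)]; exact hf.2 x hx)
  refine ⟨F ∘ i, ⟨hF.1.comp hi.continuousOn hiL, fun x hx => hF.2 _ (hiL hx)⟩, fun x hx => ?_⟩
  have := hFf (mem_image_of_mem i hx)
  simp only [Function.comp] at this ⊢
  rw [this, hri x (hAL hx)]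

section

variable {W : Type*} [MetricSpace W] {N : ℕ}

/-- homotopy extension -/
lemma hep {Y A : Set W} (hY : IsCompact Y) (hA : IsClosed A) (_hAY : A ⊆ Y)
    {w : W → Fin N → ℝ} (hw : NV w Y) {h : W × ℝ → Fin N → ℝ}
    (hh : NV h (A ×ˢ Icc 0 1)) (h0 : ∀ x ∈ A, h (x, 0) = w x) :
    ∃ w' : W → Fin N → ℝ, NV w' Y ∧ ∀ x ∈ A, w' x = h (x, 1) := by
  have hw2 : NV (fun z : W × ℝ => w z.1) (Y ×ˢ {0}) :=
    ⟨hw.1.comp continuous_fst.continuousOn (fun z hz => hz.1), fun z hz => hw.2 _ hz.1⟩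
  obtain ⟨M0, hM0, hM1, hM2⟩ := hh.glue hw2 (hA.prod isClosed_Icc)
    (hY.isClosed.prod isClosed_singleton) (by
      rintro ⟨x, s⟩ ⟨hx, hx'⟩
      obtain ⟨hx1, hx2⟩ := hx'
      simp only [mem_singleton_iff] at hx2
      subst hx2
      exact h0 x hx.1)
  obtain ⟨M, hM, hMM⟩ := tietze ((hA.prod isClosed_Icc).union
    (hY.isClosed.prod isClosed_singleton)) hM0.1
  let Z : Set W := Prod.fst '' ((Y ×ˢ Icc (0:ℝ) 1) ∩ {z | M z = 0})
  have hZ : IsCompact Z :=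
    ((hY.prod isCompact_Icc).inter_right (isClosed_eq hM continuous_const)).image continuous_fst
  have hd : Disjoint Z A := by
    rw [Set.disjoint_left]
    rintro _ ⟨⟨x, s⟩, ⟨hx, hx0⟩, rfl⟩ hxA
    have hmem : (x, s) ∈ A ×ˢ Icc (0:ℝ) 1 := ⟨hxA, hx.2⟩
    apply hh.2 _ hmem
    rw [← hM1 hmem, ← hMM (Or.inl hmem)]
    exact hx0
  obtain ⟨u, hu0, hu1, hu⟩ := exists_continuous_zero_one_of_isClosed hZ.isClosed hA hd
  refine ⟨fun y => M (y, u y), ⟨(hM.comp (continuous_id.prodMk u.continuous)).continuousOn, ?_⟩,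
    ?_⟩
  · intro y hy hy0
    have hyZ : y ∈ Z := ⟨(y, u y), ⟨⟨hy, hu y⟩, hy0⟩, rfl⟩
    have h1 : u y = 0 := hu0 hyZ
    simp only [h1] at hy0
    have hmem : (y, (0:ℝ)) ∈ Y ×ˢ ({0} : Set ℝ) := ⟨hy, rfl⟩
    rw [hMM (Or.inr hmem), hM2 hmem] at hy0
    exact hw.2 y hy hy0
  · intro x hx
    have h1 : u x = 1 := hu1 hx
    have hmem : (x, (1:ℝ)) ∈ A ×ˢ Icc (0:ℝ) 1 := ⟨hx, by simp⟩
    simp only [h1]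
    rw [hMM (Or.inl hmem), hM1 hmem]

/-- gluing two extensions along a set `S` with `Ext (S × I)`. -/
lemma glue_homotopy {L₁ L₂ A : Set W} (hL₁ : IsCompact L₁) (hL₂ : IsCompact L₂)
    (hA : IsCompact A) (hS : Ext ((L₁ ∩ L₂) ×ˢ Icc (0:ℝ) 1) N)
    {F₁ F₂ f : W → Fin N → ℝ} (h1 : NV F₁ (A ∪ L₁)) (h2 : NV F₂ (A ∪ L₂))
    (h1f : EqOn F₁ f A) (h2f : EqOn F₂ f A) :
    ∃ F, NV F (A ∪ (L₁ ∪ L₂)) ∧ EqOn F f A := by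
  set S := L₁ ∩ L₂ with hSdef
  have hSc : IsCompact S := hL₁.inter hL₂
  have hfA : NV f A := (h1.mono subset_union_left).congr h1f.symm
  -- boundary data
  have b2 : NV (fun z : W × ℝ => F₂ z.1) (S ×ˢ {0}) :=
    ⟨h2.1.comp continuous_fst.continuousOn (fun z hz => Or.inr hz.1.2),
      fun z hz => h2.2 _ (Or.inr hz.1.2)⟩
  have b1 : NV (fun z : W × ℝ => F₁ z.1) (S ×ˢ {1}) :=
    ⟨h1.1.comp continuous_fst.continuousOn (fun z hz => Or.inr hz.1.1),
      fun z hz => h1.2 _ (Or.inr hz.1.1)⟩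
  have bA : NV (fun z : W × ℝ => f z.1) (A ×ˢ Icc 0 1) :=
    ⟨hfA.1.comp continuous_fst.continuousOn (fun z hz => hz.1), fun z hz => hfA.2 _ hz.1⟩
  have bA' : NV (fun z : W × ℝ => f z.1) ((A ∩ S) ×ˢ Icc 0 1) :=
    bA.mono (prod_mono inter_subset_left le_rfl)
  obtain ⟨g, hg, hg2, hg1⟩ := b2.glue b1 (hSc.isClosed.prod isClosed_singleton)
    (hSc.isClosed.prod isClosed_singleton) (by
      rintro ⟨x, s⟩ ⟨hx, hx'⟩
      have e1 := hx.2
      have e2 := hx'.2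
      simp only [mem_singleton_iff] at e1 e2
      rw [e1] at e2
      norm_num at e2)
  have hcl : IsClosed (S ×ˢ {(0:ℝ)} ∪ S ×ˢ {(1:ℝ)}) :=
    (hSc.isClosed.prod isClosed_singleton).union (hSc.isClosed.prod isClosed_singleton)
  have hclA : IsClosed ((A ∩ S) ×ˢ Icc (0:ℝ) 1) :=
    (hA.isClosed.inter hSc.isClosed).prod isClosed_Icc
  obtain ⟨g', hg', hg'g, hg'f⟩ := hg.glue bA' hcl hclA (by
      rintro z ⟨hx | hx, hx'⟩
      · rw [hg2 hx]; exact h2f hx'.1.1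
      · rw [hg1 hx]; exact h1f hx'.1.1)
  obtain ⟨H, hH, hHg⟩ := hS _ g' (hcl.union hclA) (by
      rintro ⟨x, s⟩ ((hx | hx) | hx)
      · have e1 := hx.2
        simp only [mem_singleton_iff] at e1
        subst e1
        exact ⟨hx.1, by simp⟩
      · have e1 := hx.2
        simp only [mem_singleton_iff] at e1
        subst e1
        exact ⟨hx.1, by simp⟩
      · exact ⟨hx.1.2, hx.2⟩) hg'
  obtain ⟨h, hh, hhH, hhf⟩ := hH.glue bA (hSc.isClosed.prod isClosed_Icc)
    (hA.isClosed.prod isClosed_Icc) (by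
      rintro z ⟨hz, hz'⟩
      have : z ∈ (A ∩ S) ×ˢ Icc (0:ℝ) 1 := ⟨⟨hz'.1, hz.1⟩, hz.2⟩
      rw [hHg (Or.inr this), hg'f this])
  rw [← union_prod] at hh
  obtain ⟨w, hw, hwh⟩ := hep (Y := A ∪ L₂) (A := S ∪ A) (hA.union hL₂)
    (hSc.isClosed.union hA.isClosed)
    (by rintro x (hx | hx); exacts [Or.inr hx.2, Or.inl hx]) h2 hh (by
      rintro x (hx | hx)
      · have hz : (x, (0:ℝ)) ∈ S ×ˢ Icc (0:ℝ) 1 := ⟨hx, by simp⟩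
        have hz' : (x, (0:ℝ)) ∈ S ×ˢ {(0:ℝ)} := ⟨hx, by simp⟩
        rw [hhH hz, hHg (Or.inl (Or.inl hz')), hg'g (Or.inl hz'), hg2 hz']
      · have hz : (x, (0:ℝ)) ∈ A ×ˢ Icc (0:ℝ) 1 := ⟨hx, by simp⟩
        rw [hhf hz]; exact (h2f hx).symm)
  have hwA : EqOn w f A := by
    intro x hx
    have hz : (x, (1:ℝ)) ∈ A ×ˢ Icc (0:ℝ) 1 := ⟨hx, by simp⟩
    rw [hwh x (Or.inr hx), hhf hz]
  have hwS : EqOn w F₁ S := by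
    intro x hx
    have hz : (x, (1:ℝ)) ∈ S ×ˢ Icc (0:ℝ) 1 := ⟨hx, by simp⟩
    have hz' : (x, (1:ℝ)) ∈ S ×ˢ {(1:ℝ)} := ⟨hx, by simp⟩
    rw [hwh x (Or.inl hx), hhH hz, hHg (Or.inl (Or.inr hz')), hg'g (Or.inr hz'), hg1 hz']
  obtain ⟨F, hF, hF1, hF2⟩ := h1.glue hw (hA.union hL₁).isClosed (hA.union hL₂).isClosed (by
    rintro x ⟨hx1 | hx1, hx2 | hx2⟩
    · rw [h1f hx1, hwA hx1]
    · rw [h1f hx1, hwA hx1]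
    · rw [h1f hx2, hwA hx2]
    · exact (hwS ⟨hx1, hx2⟩).symm)
  refine ⟨F, hF.mono ?_, fun x hx => (hF1 (Or.inl hx)).trans (h1f hx)⟩
  rintro x (hx | hx | hx)
  exacts [Or.inl (Or.inl hx), Or.inl (Or.inr hx), Or.inr (Or.inr hx)]

/-- an extension exists on a neighbourhood; compact version. -/
lemma zero_set_compact {L : Set W} (hL : IsCompact L) {M : W → Fin N → ℝ} (hM : Continuous M) :
    IsCompact (L ∩ {z | M z = 0}) :=
  hL.inter_right (isClosed_eq hM continuous_const)

end

lemma ext_cube {j N : ℕ} (hj : j < N) : Ext (cube j) N := by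
  intro A f hA hAL hf
  have hAc : IsCompact A := (isCompact_cube j).of_isClosed_subset hA hAL
  obtain ⟨M, hM, hMf⟩ := tietze hA hf.1
  obtain ⟨ε, hε, hεA⟩ : ∃ ε : ℝ, 0 < ε ∧ ∀ x ∈ A, ε ≤ ‖f x‖ := by
    rcases A.eq_empty_or_nonempty with h | h
    · exact ⟨1, one_pos, by simp [h]⟩
    · obtain ⟨x, hx, hmin⟩ := hAc.exists_isMinOn h hf.1.norm
      exact ⟨‖f x‖, norm_pos_iff.2 (hf.2 x hx), fun y hy => hmin hy⟩
  obtain ⟨G, hG, hGM, -⟩ := hM.exists_contDiff_approx (ε := fun _ => ε / 2) 1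
    continuous_const (fun _ => by positivity)
  have hdense := hG.dense_compl_range_of_finrank_lt_finrank (by simpa using hj)
  obtain ⟨v, hv, hv0⟩ := hdense.exists_dist_lt (0 : Fin N → ℝ) (ε := ε / 2) (by positivity)
  rw [dist_zero_left] at hv0
  have hw : NV (fun x => G x - v) (cube j) :=
    ⟨(hG.continuous.sub continuous_const).continuousOn, fun x _ h0 =>
      hv ⟨x, sub_eq_zero.1 h0⟩⟩
  have hclose : ∀ x ∈ A, ‖(G x - v) - f x‖ < ε := by
    intro x hx
    have h1 := hGM x
    rw [hMf hx, dist_eq_norm] at h1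
    calc ‖(G x - v) - f x‖ = ‖(G x - f x) - v‖ := by congr 1; abel
      _ ≤ ‖G x - f x‖ + ‖v‖ := norm_sub_le _ _
      _ < ε := by linarith
  obtain ⟨w, hw1, hw2⟩ := hep (isCompact_cube j) hA hAL hw
    (h := fun z => (1 - z.2) • (G z.1 - v) + z.2 • f z.1) (by
      constructor
      · have hf' : ContinuousOn (fun z : (Fin j → ℝ) × ℝ => f z.1) (A ×ˢ Icc 0 1) :=
          hf.1.comp continuous_fst.continuousOn (fun z hz => hz.1)
        have := hG.continuous
        have h2 : ContinuousOn (fun z : (Fin j → ℝ) × ℝ => (1 - z.2) • (G z.1 - v))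
          (A ×ˢ Icc 0 1) := by fun_prop
        exact h2.add (continuous_snd.continuousOn.smul hf')
      · rintro ⟨x, s⟩ ⟨hx, hs⟩ h0
        simp only at hx hs h0
        have e1 : (1 - s) • ((G x - v) - f x) = - f x := by
          have : (1 - s) • ((G x - v) - f x) = ((1 - s) • (G x - v) + s • f x) - f x := by
            module
          rw [this, h0, zero_sub]
        have e2 := congrArg norm e1
        rw [norm_neg, norm_smul, Real.norm_eq_abs, abs_of_nonneg (by linarith [hs.2])] at e2
        have := hclose x hx
        have := hεA x hx
        have := norm_nonneg ((G x - v) - f x)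
        nlinarith [hs.1, hs.2]) (by intro x _; simp)
  exact ⟨w, hw1, fun x hx => by rw [hw2 x hx]; simp⟩

section

variable {X : Type*} [MetricSpace X]

lemma E.mono {p : ℕ} {K K' : Set X} (h : E p K) (hK : K' ⊆ K) : E p K' :=
  fun j => (h j).mono (prod_mono hK le_rfl)

lemma E_empty (p : ℕ) : E p (∅ : Set X) := by
  intro j A f hA hAL hf
  exact ⟨f, by simp [NV], fun _ _ => rfl⟩

lemma not_E_zero {K : Set X} (hK : K.Nonempty) : ¬ E 0 K := by
  intro h
  obtain ⟨x, hx⟩ := hK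
  obtain ⟨F, hF, -⟩ := h 0 ∅ (fun _ => 0) isClosed_empty (empty_subset _)
    ⟨continuousOn_const, by simp⟩
  exact hF.2 (x, 0) ⟨hx, by simp [cube]⟩ (funext fun i => Fin.elim0 i)

lemma E_subsingleton {p : ℕ} {K : Set X} (hK : K.Subsingleton) : E (p + 1) K := by
  rcases K.eq_empty_or_nonempty with h | ⟨x, hx⟩
  · rw [h]; exact E_empty _
  · have : K = {x} := hK.eq_singleton_of_mem hx
    subst this
    intro j
    refine (ext_cube (show j < p + 1 + j by omega)).retract
      (isCompact_singleton.prod (isCompact_cube j)) Prod.snd (fun y => (x, y)) continuous_snd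
      (by fun_prop) (fun z hz => hz.2) ?_
    rintro ⟨a, b⟩ ⟨ha, -⟩
    simp only [mem_singleton_iff] at ha
    simp [ha]

/-- local sum theorem -/
lemma E_local {p : ℕ} {K K0 : Set X} (hK : IsCompact K) (hK0 : IsClosed K0)
    (_hK0K : K0 ⊆ K) (h0 : E p K0)
    (hloc : ∀ x ∈ K, x ∉ K0 → ∃ V, IsClosed V ∧ V ∈ 𝓝 x ∧ E p (K ∩ V)) : E p K := by
  intro j A f hA hAL hf
  have hLc : IsCompact (K ×ˢ cube j) := hK.prod (isCompact_cube j)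
  obtain ⟨F0, hF0, hF0f⟩ := (h0 j).extend (hK0.prod (isCompact_cube j).isClosed) hA hf
  have hcl0 : IsClosed (A ∪ K0 ×ˢ cube j) := hA.union (hK0.prod (isCompact_cube j).isClosed)
  obtain ⟨M, hM, hMF⟩ := tietze hcl0 hF0.1
  let Z : Set X := Prod.fst '' ((K ×ˢ cube j) ∩ {z | M z = 0})
  have hZ : IsCompact Z := (zero_set_compact hLc hM).image continuous_fst
  have hZK : ∀ x ∈ Z, x ∈ K ∧ x ∉ K0 := by
    rintro _ ⟨⟨x, y⟩, ⟨hx, hx0⟩, rfl⟩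
    refine ⟨hx.1, fun hxK => ?_⟩
    have hmem : (x, y) ∈ A ∪ K0 ×ˢ cube j := Or.inr ⟨hxK, hx.2⟩
    apply hF0.2 _ hmem
    rw [← hMF hmem]; exact hx0
  choose! V hV1 hV2 hV3 using hloc
  obtain ⟨t, ht, htZ⟩ := hZ.elim_nhds_subcover (fun x => interior (V x)) (fun x hx =>
    interior_mem_nhds.2 (hV2 x (hZK x hx).1 (hZK x hx).2))
  let R : Set X := K \ ⋃ x ∈ t, interior (V x)
  have hR : IsClosed R :=
    hK.isClosed.sdiff (isOpen_biUnion fun x _ => isOpen_interior)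
  have hMC : NV M (A ∪ R ×ˢ cube j) := by
    refine ⟨hM.continuousOn, ?_⟩
    rintro z (hz | hz) h
    · exact hF0.2 z (Or.inl hz) (by rw [← hMF (Or.inl hz)]; exact h)
    · exact hz.1.2 (htZ ⟨z, ⟨⟨hz.1.1, hz.2⟩, h⟩, rfl⟩)
  obtain ⟨F, hF, hFM⟩ := Ext.extend_finset t (L := fun x => (K ∩ V x) ×ˢ cube j)
    (fun x hx => hV3 x (hZK x (ht x hx)).1 (hZK x (ht x hx)).2 j)
    (fun x hx => (hK.isClosed.inter (hV1 x (hZK x (ht x hx)).1 (hZK x (ht x hx)).2)).prod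
      (isCompact_cube j).isClosed)
    (hA.union (hR.prod (isCompact_cube j).isClosed)) hMC
  refine ⟨F, hF.mono ?_, fun x hx => ?_⟩
  · rintro ⟨x, y⟩ ⟨hx, hy⟩
    by_cases hxR : x ∈ ⋃ x ∈ t, interior (V x)
    · right
      simp only [mem_iUnion] at hxR ⊢
      obtain ⟨i, hi, hxi⟩ := hxR
      exact ⟨i, hi, ⟨hx, interior_subset hxi⟩, hy⟩
    · left; right
      exact ⟨⟨hx, hxR⟩, hy⟩
  · rw [hFM (Or.inl hx), hMF (Or.inl hx), hF0f hx]

/-- dimension raising along a real function -/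
lemma E_fibers {p : ℕ} {K : Set X} (hK : IsCompact K) {φ : X → ℝ} (hφ : Continuous φ)
    (hall : ∀ c, E (p + 1) (K ∩ φ ⁻¹' {c})) (hd : Dense {c | E p (K ∩ φ ⁻¹' {c})}) :
    E (p + 1) K := by
  intro j A f hA hAL hf
  set L := K ×ˢ cube j with hL
  have hLc : IsCompact L := hK.prod (isCompact_cube j)
  have hAc : IsCompact A := hLc.of_isClosed_subset hA hAL
  let ψ : X × (Fin j → ℝ) → ℝ := fun z => φ z.1
  have hψ : Continuous ψ := hφ.comp continuous_fst
  -- local extensions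
  have hlocal : ∀ c : ℝ, ∃ δ > 0, ∃ F, NV F (A ∪ (L ∩ ψ ⁻¹' Icc (c - δ) (c + δ))) ∧
      EqOn F f A := by
    intro c
    have hcl : IsClosed ((K ∩ φ ⁻¹' {c}) ×ˢ cube j) :=
      (hK.isClosed.inter (isClosed_singleton.preimage hφ)).prod (isCompact_cube j).isClosed
    obtain ⟨F0, hF0, hF0f⟩ := (hall c j).extend hcl hA hf
    obtain ⟨M, hM, hMF⟩ := tietze (hA.union hcl) hF0.1
    have hZ := (zero_set_compact hLc hM).image hψ
    have hc : c ∈ (ψ '' (L ∩ {z | M z = 0}))ᶜ := by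
      rintro ⟨z, ⟨hz, hz0⟩, hzc⟩
      have hmem : z ∈ A ∪ (K ∩ φ ⁻¹' {c}) ×ˢ cube j := Or.inr ⟨⟨hz.1, hzc⟩, hz.2⟩
      exact hF0.2 z hmem (by rw [← hMF hmem]; exact hz0)
    obtain ⟨δ, hδ, hball⟩ := Metric.isOpen_iff.1 hZ.isClosed.isOpen_compl c hc
    refine ⟨δ / 2, by positivity, M, ⟨hM.continuousOn, ?_⟩, fun x hx => ?_⟩
    · rintro z (hz | hz) h
      · exact hF0.2 z (Or.inl hz) (by rw [← hMF (Or.inl hz)]; exact h)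
      · refine hball (a := ψ z) ?_ ⟨z, ⟨hz.1, h⟩, rfl⟩
        rw [Metric.mem_ball, Real.dist_eq, abs_lt]
        have := hz.2
        simp only [mem_preimage, mem_Icc] at this
        constructor <;> linarith
    · rw [hMF (Or.inl hx), hF0f hx]
  let P : ℝ → Prop := fun s => ∃ F, NV F (A ∪ (L ∩ ψ ⁻¹' Iic s)) ∧ EqOn F f A
  have hPmono : ∀ s s', s ≤ s' → P s' → P s := by
    rintro s s' hs ⟨F, hF, hFf⟩
    exact ⟨F, hF.mono (union_subset_union_right _ (inter_subset_inter_right _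
      (preimage_mono (Iic_subset_Iic.2 hs)))), hFf⟩
  obtain ⟨a, ha⟩ : ∃ a, ∀ z ∈ L, a < ψ z := by
    obtain ⟨a, ha⟩ := (hLc.image hψ).bddBelow
    exact ⟨a - 1, fun z hz => by have := ha (mem_image_of_mem ψ hz); linarith⟩
  obtain ⟨b, hb⟩ : ∃ b, ∀ z ∈ L, ψ z ≤ b := by
    obtain ⟨b, hb⟩ := (hLc.image hψ).bddAbove
    exact ⟨b, fun z hz => hb (mem_image_of_mem ψ hz)⟩
  have hPa : P a := by
    refine ⟨f, hf.mono ?_, fun _ _ => rfl⟩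
    rintro z (hz | hz)
    · exact hz
    · exact absurd (ha z hz.1) (not_lt.2 hz.2)
  have hunb : ¬ BddAbove {s | P s} := by
    intro hbdd
    set c := sSup {s | P s} with hc
    obtain ⟨δ, hδ, F, hF, hFf⟩ := hlocal c
    obtain ⟨s', hs', hs'c⟩ := exists_lt_of_lt_csSup ⟨a, hPa⟩
      (show c - δ < sSup {s | P s} by linarith)
    have hs'le : s' ≤ c := le_csSup hbdd hs'
    obtain ⟨s, hsE, hs⟩ := hd.exists_mem_open isOpen_Ioo (nonempty_Ioo.2 hs'c)
    obtain ⟨F1, hF1, hF1f⟩ := hPmono s s' hs.2.le hs'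
    have key := glue_homotopy (N := p + 1 + j) (L₁ := L ∩ ψ ⁻¹' Iic s)
      (L₂ := L ∩ ψ ⁻¹' Icc s (c + δ))
      (A := A) (hLc.inter_right (isClosed_Iic.preimage hψ))
      (hLc.inter_right (isClosed_Icc.preimage hψ)) hAc ?_ hF1
      (hF.mono (union_subset_union_right _ (inter_subset_inter_right _
      (preimage_mono (Icc_subset_Icc_left hs.1.le))))) hF1f hFf
    · obtain ⟨G, hG, hGf⟩ := key
      have : P (c + δ) := by
        refine ⟨G, hG.mono ?_, hGf⟩
        rintro z (hz | hz)
        · exact Or.inl hz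
        · right
          rcases le_total (ψ z) s with h | h
          · exact Or.inl ⟨hz.1, h⟩
          · exact Or.inr ⟨hz.1, h, hz.2⟩
      have := le_csSup hbdd this
      linarith
    · have h1 : Ext ((K ∩ φ ⁻¹' {s}) ×ˢ cube (j + 1)) (p + 1 + j) := by
        have := hsE (j + 1)
        rwa [show p + (j + 1) = p + 1 + j by ring] at this
      refine h1.retract (((hLc.inter_right (isClosed_Iic.preimage hψ)).inter
        (hLc.inter_right (isClosed_Icc.preimage hψ))).prod isCompact_Icc)
        (fun z => (z.1.1, Fin.cons z.2 z.1.2)) (fun y => ((y.1, Fin.tail y.2), y.2 0))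
        ?_ ?_ ?_ ?_
      · refine (continuous_fst.comp continuous_fst).prodMk (continuous_pi fun i => ?_)
        refine Fin.cases ?_ (fun i => ?_) i
        · simpa using continuous_snd
        · simp only [Fin.cons_succ]; fun_prop
      · unfold Fin.tail; fun_prop
      · rintro ⟨⟨x, y⟩, r⟩ ⟨⟨⟨hx, hx1⟩, hx2⟩, hr⟩
        refine ⟨⟨hx.1, le_antisymm hx1 hx2.2.1⟩, ?_⟩
        have hy := hx.2
        simp only [cube, mem_Icc, Pi.le_def] at hy ⊢
        constructor
        · intro i
          refine Fin.cases ?_ (fun i => ?_) i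
          · simpa using hr.1
          · simpa using hy.1 i
        · intro i
          refine Fin.cases ?_ (fun i => ?_) i
          · simpa using hr.2
          · simpa using hy.2 i
      · rintro ⟨⟨x, y⟩, r⟩ _
        simp
  rw [not_bddAbove_iff] at hunb
  obtain ⟨s, ⟨F, hF, hFf⟩, hbs⟩ := hunb b
  exact ⟨F, hF.mono (fun z hz => Or.inr ⟨hz, (hb z hz).trans hbs.le⟩), hFf⟩

end

end Stern

namespace Stern

open Set Topology MeasureTheory

/-- `det (1 + t A)` is interpolated by finitely many values -/
lemma det_interp {V : Type*} [NormedAddCommGroup V] [NormedSpace ℝ V] [FiniteDimensional ℝ V]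
    (A : V →L[ℝ] V) (s : Finset ℝ) (hs : Module.finrank ℝ V < s.card) (t : ℝ) :
    (ContinuousLinearMap.id ℝ V + t • A).det =
      ∑ i ∈ s, (ContinuousLinearMap.id ℝ V + i • A).det * (Lagrange.basis s id i).eval t := by
  classical
  let b := Module.finBasis ℝ V
  let M := LinearMap.toMatrix b b (A : V →ₗ[ℝ] V)
  let q : Polynomial ℝ := ((Polynomial.X : Polynomial ℝ) • M.map (Polynomial.C : ℝ →+* Polynomial ℝ) +
    (1 : Matrix (Fin (Module.finrank ℝ V)) (Fin (Module.finrank ℝ V)) ℝ).map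
      (Polynomial.C : ℝ →+* Polynomial ℝ)).det
  have hq : ∀ t, q.eval t = (ContinuousLinearMap.id ℝ V + t • A).det := by
    intro t
    have h1 : (ContinuousLinearMap.id ℝ V + t • A).det =
      LinearMap.det ((LinearMap.id : V →ₗ[ℝ] V) + t • (A : V →ₗ[ℝ] V)) := by
      unfold ContinuousLinearMap.det
      congr 1
    rw [h1, ← LinearMap.det_toMatrix b, map_add, map_smul, LinearMap.toMatrix_id]
    rw [← Polynomial.coe_evalRingHom, RingHom.map_det]
    congr 1
    ext i j
    simp only [Polynomial.coe_evalRingHom, RingHom.mapMatrix_apply, Matrix.map_apply,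
      Matrix.add_apply, Matrix.smul_apply, smul_eq_mul, Polynomial.eval_add, Polynomial.eval_mul,
      Polynomial.eval_X, Polynomial.eval_C]
    ring
  have hdeg : q.degree < s.card := by
    refine lt_of_le_of_lt Polynomial.degree_le_natDegree ?_
    have := Polynomial.natDegree_det_X_add_C_le M 1
    simp only [Fintype.card_fin] at this
    exact_mod_cast lt_of_le_of_lt this hs
  have := Lagrange.eq_interpolate (s := s) (v := id) (f := q) (injOn_id _) hdeg
  rw [Lagrange.interpolate_apply] at this
  have h2 := congrArg (Polynomial.eval t) this
  rw [hq, Polynomial.eval_finsetSum] at h2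
  rw [h2]
  refine Finset.sum_congr rfl fun i _ => ?_
  rw [Polynomial.eval_mul, Polynomial.eval_C, hq]
  rfl

section

variable {V : Type*} [NormedAddCommGroup V] [InnerProductSpace ℝ V] [FiniteDimensional ℝ V]
  [MeasurableSpace V] [BorelSpace V] [Nontrivial V]

open Metric

lemma small_t {h0 : V → V} (hh : ContDiff ℝ 1 h0) (hS : ∀ x, ‖x‖ = 1 → h0 x = 0)
    (hB : ∀ x, ‖x‖ ≤ 1 → ‖x + h0 x‖ ≤ 1) :
    ∃ τ : ℝ, 0 < τ ∧ ∀ t : ℝ, 0 < t → t < τ →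
      ∫ x in closedBall (0:V) 1, (ContinuousLinearMap.id ℝ V + t • fderiv ℝ h0 x).det =
        (volume (closedBall (0:V) 1)).toReal := by
  classical
  obtain ⟨C, hC⟩ := (hh.contDiffOn (s := closedBall (0:V) 1)).exists_lipschitzOnWith
    one_ne_zero (convex_closedBall _ _) (isCompact_closedBall _ _)
  have hcont : Continuous fun z : ℝ × V =>
      (ContinuousLinearMap.id ℝ V + z.1 • fderiv ℝ h0 z.2).det := by
    have h1 : Continuous (fderiv ℝ h0) := hh.continuous_fderiv one_ne_zero
    refine ContinuousLinearMap.continuous_det.comp ?_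
    fun_prop
  obtain ⟨u, v, hu, hv, h0u, hBv, huv⟩ := generalized_tube_lemma (isCompact_singleton (x := (0:ℝ)))
    (isCompact_closedBall (0:V) 1)
    (n := {z : ℝ × V | 0 < (ContinuousLinearMap.id ℝ V + z.1 • fderiv ℝ h0 z.2).det})
    (isOpen_lt continuous_const hcont) (by
      rintro ⟨t, x⟩ ⟨ht, -⟩
      simp only [mem_singleton_iff] at ht
      simp [ht, ContinuousLinearMap.det])
  obtain ⟨τ, hτ, hτu⟩ := Metric.isOpen_iff.1 hu 0 (h0u rfl)
  refine ⟨min τ (min 1 (1 / ((C:ℝ) + 1))), by positivity, fun t ht0 ht => ?_⟩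
  have ht1 : t < τ := lt_of_lt_of_le ht (min_le_left _ _)
  have ht2 : t < 1 := lt_of_lt_of_le ht ((min_le_right _ _).trans (min_le_left _ _))
  have ht3 : t < 1 / ((C:ℝ) + 1) := lt_of_lt_of_le ht ((min_le_right _ _).trans (min_le_right _ _))
  have hCt : t * C < 1 := by
    rw [lt_div_iff₀ (by positivity)] at ht3
    nlinarith
  have hpos : ∀ x ∈ closedBall (0:V) 1,
      0 < (ContinuousLinearMap.id ℝ V + t • fderiv ℝ h0 x).det := by
    intro x hx
    have : (t, x) ∈ u ×ˢ v := ⟨hτu (by simpa [abs_of_pos ht0] using ht1), hBv hx⟩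
    exact huv this
  -- the extended map
  let h : V → V := fun x => if ‖x‖ ≤ 1 then h0 x else 0
  have hbd : ∀ x, ‖x‖ ≤ 1 → ‖h0 x‖ ≤ C * (1 - ‖x‖) := by
    intro x hx
    obtain ⟨z, hz, hxz⟩ : ∃ z : V, ‖z‖ = 1 ∧ ‖x - z‖ = 1 - ‖x‖ := by
      by_cases hx0 : x = 0
      · obtain ⟨z, hz⟩ := exists_norm_eq V (zero_le_one (α := ℝ))
        exact ⟨z, hz, by simp [hx0, hz]⟩
      · have hn : 0 < ‖x‖ := norm_pos_iff.2 hx0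
        refine ⟨‖x‖⁻¹ • x, by rw [norm_smul, norm_inv, norm_norm, inv_mul_cancel₀ hn.ne'], ?_⟩
        have : x - ‖x‖⁻¹ • x = (1 - ‖x‖⁻¹) • x := by module
        have h1 : 1 ≤ ‖x‖⁻¹ := (one_le_inv₀ hn).2 hx
        rw [this, norm_smul, Real.norm_eq_abs, abs_of_nonpos (by linarith)]
        field_simp
        ring
    have h1 := hC.dist_le_mul x (by simpa using hx) z (by simp [hz])
    rw [dist_eq_norm, dist_eq_norm, hS z hz, sub_zero, hxz] at h1
    exact h1
  have hlip : ∀ x y, ‖h x - h y‖ ≤ C * ‖x - y‖ := by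
    have aux : ∀ x y, ‖x‖ ≤ 1 → ¬ ‖y‖ ≤ 1 → ‖h x - h y‖ ≤ C * ‖x - y‖ := by
      intro x y hx hy
      simp only [h, hx, hy, if_true, if_false, sub_zero]
      refine (hbd x hx).trans ?_
      have : ‖y‖ ≤ ‖x‖ + ‖x - y‖ := by
        have := norm_sub_le x (x - y)
        simpa using this
      have hC0 : (0:ℝ) ≤ C := C.2
      push Not at hy
      nlinarith
    intro x y
    by_cases hx : ‖x‖ ≤ 1 <;> by_cases hy : ‖y‖ ≤ 1
    · simp only [h, hx, hy, if_true]
      have := hC.dist_le_mul x (by simpa using hx) y (by simpa using hy)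
      rwa [dist_eq_norm, dist_eq_norm] at this
    · exact aux x y hx hy
    · rw [norm_sub_rev, norm_sub_rev x]
      exact aux y x hy hx
    · simp only [h, hx, hy, if_false, sub_zero, norm_zero]
      positivity
  let g : V → V := fun x => x + t • h x
  have happ : ApproximatesLinearOn g ((ContinuousLinearEquiv.refl ℝ V : V ≃L[ℝ] V) : V →L[ℝ] V)
      univ (t.toNNReal * C) := by
    intro x _ y _
    simp only [g, ContinuousLinearEquiv.coe_coe, ContinuousLinearEquiv.refl_apply, NNReal.coe_mul,
      Real.coe_toNNReal t ht0.le]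
    have : x + t • h x - (y + t • h y) - (x - y) = t • (h x - h y) := by module
    change ‖x + t • h x - (y + t • h y) - (x - y)‖ ≤ _
    rw [this, norm_smul, Real.norm_eq_abs, abs_of_pos ht0, mul_assoc]
    exact mul_le_mul_of_nonneg_left (hlip x y) ht0.le
  have hc : Subsingleton V ∨ t.toNNReal * C <
      ‖(((ContinuousLinearEquiv.refl ℝ V : V ≃L[ℝ] V).symm : V ≃L[ℝ] V) : V →L[ℝ] V)‖₊⁻¹ := by
    right
    have : ‖(((ContinuousLinearEquiv.refl ℝ V : V ≃L[ℝ] V).symm : V ≃L[ℝ] V) : V →L[ℝ] V)‖₊ = 1 := by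
      apply NNReal.eq
      simp only [coe_nnnorm, NNReal.coe_one]
      exact ContinuousLinearMap.norm_id
    rw [this, inv_one]
    rw [← NNReal.coe_lt_coe, NNReal.coe_mul, Real.coe_toNNReal t ht0.le]
    exact hCt
  have hsurj := happ.surjective hc
  have hinj : Function.Injective g := by
    intro x y hxy
    have := happ.injective hc
    exact congrArg Subtype.val (@this ⟨x, mem_univ _⟩ ⟨y, mem_univ _⟩ hxy)
  have himg : g '' closedBall (0:V) 1 = closedBall (0:V) 1 := by
    apply Subset.antisymm
    · rintro _ ⟨x, hx, rfl⟩
      have hx' : ‖x‖ ≤ 1 := by simpa using hx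
      simp only [g, h, hx', if_true, mem_closedBall, dist_zero_right]
      have : x + t • h0 x = (1 - t) • x + t • (x + h0 x) := by module
      rw [this]
      refine (norm_add_le _ _).trans ?_
      rw [norm_smul, norm_smul, Real.norm_eq_abs, Real.norm_eq_abs, abs_of_pos ht0,
        abs_of_pos (by linarith)]
      have := hB x hx'
      nlinarith
    · intro y hy
      obtain ⟨x, rfl⟩ := hsurj y
      refine ⟨x, ?_, rfl⟩
      by_contra hx
      have hx' : ¬ ‖x‖ ≤ 1 := by simpa using hx
      apply hx
      simp [g, h, hx'] at hy
  have hfd : ∀ x ∈ closedBall (0:V) 1, HasFDerivWithinAt g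
      (ContinuousLinearMap.id ℝ V + t • fderiv ℝ h0 x) (closedBall (0:V) 1) x := by
    intro x hx
    have h1 : HasFDerivAt h0 (fderiv ℝ h0 x) x :=
      (hh.differentiable one_ne_zero x).hasFDerivAt
    have h2 : HasFDerivAt (fun x => x + t • h0 x)
        (ContinuousLinearMap.id ℝ V + t • fderiv ℝ h0 x) x :=
      (hasFDerivAt_id x).add (h1.const_smul t)
    refine h2.hasFDerivWithinAt.congr (fun y hy => ?_) ?_
    · have hy' : ‖y‖ ≤ 1 := by simpa using hy
      simp [g, h, hy']
    · have hy' : ‖x‖ ≤ 1 := by simpa using hx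
      simp [g, h, hy']
  have key := integral_image_eq_integral_abs_det_fderiv_smul (volume : Measure V)
    measurableSet_closedBall hfd hinj.injOn (fun _ => (1:ℝ))
  rw [himg] at key
  simp only [smul_eq_mul, mul_one, integral_const, measureReal_restrict_apply_univ] at key
  rw [← Measure.real, key]
  refine setIntegral_congr_fun measurableSet_closedBall fun x hx => ?_
  exact (abs_of_pos (hpos x hx)).symm

lemma no_smooth {G : V → V} (hG : ContDiff ℝ 1 G) (h0 : ∀ x, G x ≠ 0)
    (h1 : ∀ x, 1 ≤ ‖x‖ → G x = x) : False := by
  let r : V → V := fun x => ‖G x‖⁻¹ • G x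
  have hr : ContDiff ℝ 1 r := by
    refine ContDiff.smul (ContDiff.inv (hG.norm ℝ h0) fun x => ?_) hG
    exact norm_ne_zero_iff.2 (h0 x)
  have hr1 : ∀ x, ‖r x‖ = 1 := by
    intro x
    simp only [r]
    rw [norm_smul, norm_inv, norm_norm, inv_mul_cancel₀ (norm_ne_zero_iff.2 (h0 x))]
  let k : V → V := fun x => r x - x
  have hk : ContDiff ℝ 1 k := hr.sub contDiff_id
  obtain ⟨τ, hτ, hintg⟩ := small_t hk (fun x hx => by
    simp only [k, r]
    rw [h1 x hx.ge, hx]; simp) (fun x _ => by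
    simp only [k, add_sub_cancel]
    exact (hr1 x).le)
  -- nodes
  let n := Module.finrank ℝ V
  obtain ⟨s, hsc, hs⟩ : ∃ s : Finset ℝ, s.card = n + 1 ∧ ∀ t ∈ s, 0 < t ∧ t < τ := by
    obtain ⟨s, hs, hsc⟩ := (Ioo_infinite hτ).exists_subset_card_eq (n + 1)
    exact ⟨s, hsc, fun t ht => hs ht⟩
  have hcont : ∀ t : ℝ, Continuous fun x : V =>
      (ContinuousLinearMap.id ℝ V + t • fderiv ℝ k x).det := by
    intro t
    have h1 : Continuous (fderiv ℝ k) := hk.continuous_fderiv one_ne_zero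
    refine ContinuousLinearMap.continuous_det.comp ?_
    fun_prop
  have hone : ∫ x in closedBall (0:V) 1, (ContinuousLinearMap.id ℝ V + (1:ℝ) • fderiv ℝ k x).det =
        (volume (closedBall (0:V) 1)).toReal := by
    have e1 : ∀ x, (ContinuousLinearMap.id ℝ V + (1:ℝ) • fderiv ℝ k x).det =
      ∑ i ∈ s, (ContinuousLinearMap.id ℝ V + i • fderiv ℝ k x).det *
        (Lagrange.basis s id i).eval 1 := fun x =>
      det_interp _ s (by rw [hsc]; exact Nat.lt_succ_self _) 1
    simp_rw [e1]
    rw [integral_finsetSum]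
    · have e2 : ∀ i ∈ s, ∫ x in closedBall (0:V) 1,
          (ContinuousLinearMap.id ℝ V + i • fderiv ℝ k x).det *
            (Lagrange.basis s id i).eval 1 =
          (volume (closedBall (0:V) 1)).toReal * (Lagrange.basis s id i).eval 1 := by
        intro i hi
        rw [integral_mul_const, hintg i (hs i hi).1 (hs i hi).2]
      rw [Finset.sum_congr rfl e2, ← Finset.mul_sum, ← Polynomial.eval_finsetSum,
        Lagrange.sum_basis (injOn_id _) (Finset.card_pos.1 (by omega))]
      simp
    · intro i _
      exact (((hcont i).mul continuous_const).continuousOn).integrableOn_compact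
        (isCompact_closedBall _ _)
  have hzero : ∀ x, (ContinuousLinearMap.id ℝ V + (1:ℝ) • fderiv ℝ k x).det = 0 := by
    intro x
    have hd : HasFDerivAt r (fderiv ℝ r x) x := (hr.differentiable one_ne_zero x).hasFDerivAt
    have e1 : ContinuousLinearMap.id ℝ V + (1:ℝ) • fderiv ℝ k x = fderiv ℝ r x := by
      have : fderiv ℝ k x = fderiv ℝ r x - ContinuousLinearMap.id ℝ V :=
        (hd.sub (hasFDerivAt_id x)).fderiv
      rw [this, one_smul]; abel
    rw [e1]
    by_contra hne
    have horth : ∀ v, inner ℝ (r x) (fderiv ℝ r x v) = 0 := by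
      intro v
      have h2 := hd.norm_sq
      have h3 : HasFDerivAt (fun y => ‖r y‖ ^ 2) (0 : V →L[ℝ] ℝ) x := by
        have : (fun y => ‖r y‖ ^ 2) = fun _ => (1:ℝ) := by
          funext y; rw [hr1]; norm_num
        rw [this]; exact hasFDerivAt_const _ _
      have h4 := h2.unique h3
      have h5 := congrArg (fun l : V →L[ℝ] ℝ => l v) h4
      simpa using h5
    let e := LinearMap.equivOfDetNeZero (fderiv ℝ r x : V →ₗ[ℝ] V) hne
    have h6 := horth (e.symm (r x))
    have h7 : fderiv ℝ r x (e.symm (r x)) = r x := by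
      have := e.apply_symm_apply (r x)
      simpa [e] using this
    rw [h7, real_inner_self_eq_norm_sq, hr1] at h6
    norm_num at h6
  simp_rw [hzero] at hone
  simp only [integral_zero] at hone
  have hp : 0 < volume (closedBall (0:V) 1) := measure_closedBall_pos _ _ one_pos
  have hf : volume (closedBall (0:V) 1) ≠ ⊤ := measure_closedBall_lt_top.ne
  have := ENNReal.toReal_pos hp.ne' hf
  linarith

lemma no_continuous {F : V → V} (hF : Continuous F) (h0 : ∀ x, F x ≠ 0)
    (h1 : ∀ x, 1 / 2 ≤ ‖x‖ → F x = x) : False := by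
  obtain ⟨y, hy, hmin⟩ := (isCompact_closedBall (0:V) 1).exists_isMinOn
    ⟨0, by simp⟩ hF.norm.continuousOn
  obtain ⟨G, hG, hGF, hGe, -⟩ := hF.exists_contDiff_approx_and_eqOn (ε := fun _ => ‖F y‖) 1
    continuous_const (fun _ => norm_pos_iff.2 (h0 y)) (S := {x | 1 ≤ ‖x‖}) (U := {x | 1 / 2 < ‖x‖})
    (isClosed_le continuous_const continuous_norm) (by
      refine (isOpen_lt continuous_const continuous_norm).mem_nhdsSet.2 fun x hx => ?_
      simp only [mem_ofPred_eq] at hx ⊢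
      linarith) (contDiffOn_id.congr fun x hx => h1 x (le_of_lt hx))
  refine no_smooth hG (fun x hx => ?_) (fun x hx => by
    rw [hGe hx, h1 x (by linarith)])
  rcases le_total 1 ‖x‖ with h | h
  · exact h0 x (by rw [← hGe h]; exact hx)
  · have h2 := hGF x
    rw [hx, dist_zero_left] at h2
    have h3 : ‖F y‖ ≤ ‖F x‖ := hmin (by simpa using h)
    linarith

end

lemma not_E_univ {n : ℕ} (hn : 0 < n) : ¬ E n (univ : Set (Fin n → Icc (0:ℝ) 1)) := by
  intro hE
  have : Nonempty (Fin n) := ⟨⟨0, hn⟩⟩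
  let A : Set ((Fin n → Icc (0:ℝ) 1) × (Fin 0 → ℝ)) := ⋃ i, {z | (z.1 i : ℝ) = 0} ∪ {z | (z.1 i : ℝ) = 1}
  have hA : IsClosed A := by
    refine isClosed_iUnion_of_finite fun i => ?_
    exact (isClosed_eq (by fun_prop) continuous_const).union
      (isClosed_eq (by fun_prop) continuous_const)
  let f : ((Fin n → Icc (0:ℝ) 1) × (Fin 0 → ℝ)) → Fin (n + 0) → ℝ := fun z i => (z.1 (i : Fin n) : ℝ) - 1 / 2
  obtain ⟨F, hF, hFf⟩ := hE 0 A f hA (fun z _ => ⟨mem_univ _, by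
      simp [cube, Subsingleton.elim z.2 0]⟩) (by
    constructor
    · exact Continuous.continuousOn (by fun_prop)
    · intro z hz h0
      simp only [A, mem_iUnion] at hz
      obtain ⟨i, hi | hi⟩ := hz
      · have := congrFun h0 i
        simp only [mem_ofPred_eq] at hi
        simp only [f, hi] at this
        norm_num at this
      · have := congrFun h0 i
        simp only [mem_ofPred_eq] at hi
        simp only [f, hi] at this
        norm_num at this)
  have huniv : (univ : Set (Fin n → Icc (0:ℝ) 1)) ×ˢ cube 0 = univ := by
    ext z
    simp [cube, Subsingleton.elim z.2 0]
  rw [huniv] at hF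
  let s : ℝ := n + 1
  have hs : 0 < s := by positivity
  let cl : EuclideanSpace ℝ (Fin n) → ((Fin n → Icc (0:ℝ) 1) × (Fin 0 → ℝ)) := fun y => (fun i => projIcc 0 1 zero_le_one (s * y i + 1 / 2), 0)
  have hcl : Continuous cl := by
    refine (continuous_pi fun i => ?_).prodMk continuous_const
    refine continuous_projIcc.comp ?_
    fun_prop
  let Q : Set (EuclideanSpace ℝ (Fin n)) := ⋂ i, {y | |s * y i| ≤ 1 / 2}
  let Q' : Set (EuclideanSpace ℝ (Fin n)) := ⋃ i, {y | 1 / 2 ≤ |s * y i|}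
  have hQ : IsClosed Q := isClosed_iInter fun i => isClosed_le (by fun_prop) continuous_const
  have hQ' : IsClosed Q' :=
    isClosed_iUnion_of_finite fun i => isClosed_le continuous_const (by fun_prop)
  have hclQ : ∀ y ∈ Q, ∀ i, (((cl y).1 i : Icc (0:ℝ) 1) : ℝ) = s * y i + 1 / 2 := by
    intro y hy i
    have h1 : |s * y i| ≤ 1 / 2 := mem_iInter.1 hy i
    rw [abs_le] at h1
    simp only [cl]
    rw [projIcc_of_mem _ (⟨by linarith, by linarith⟩ : s * y i + 1 / 2 ∈ Icc (0:ℝ) 1)]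
  have n1 : NV (fun y : EuclideanSpace ℝ (Fin n) => (s⁻¹ • (F (cl y) : Fin n → ℝ) : Fin n → ℝ)) Q := by
    constructor
    · have hFc : Continuous F := continuousOn_univ.1 hF.1
      have : Continuous fun y => F (cl y) := hFc.comp hcl
      exact (this.const_smul s⁻¹).continuousOn
    · intro y _ h
      refine hF.2 (cl y) (mem_univ _) ?_
      exact (smul_eq_zero.1 h).resolve_left (inv_ne_zero hs.ne')
  have n2 : NV (fun y : EuclideanSpace ℝ (Fin n) => (fun i => y i : Fin n → ℝ)) Q' := by
    constructor
    · exact Continuous.continuousOn (by fun_prop)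
    · intro y hy h
      simp only [Q', mem_iUnion, mem_ofPred_eq] at hy
      obtain ⟨i, hi⟩ := hy
      have : y i = 0 := congrFun h i
      rw [this] at hi
      norm_num at hi
  obtain ⟨H, hH, -, hH2⟩ := n1.glue n2 hQ hQ' (by
    rintro y ⟨hy, hy'⟩
    simp only [Q', mem_iUnion, mem_ofPred_eq] at hy'
    obtain ⟨i, hi⟩ := hy'
    have hyA : cl y ∈ A := by
      have h1 : |s * y i| ≤ 1 / 2 := mem_iInter.1 hy i
      have h2 := le_antisymm h1 hi
      refine mem_iUnion.2 ⟨i, ?_⟩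
      rcases (abs_eq (by norm_num)).1 h2 with h | h
      · right
        change (((cl y).1 i : Icc (0:ℝ) 1) : ℝ) = 1
        rw [hclQ y hy i, h]; norm_num
      · left
        change (((cl y).1 i : Icc (0:ℝ) 1) : ℝ) = 0
        rw [hclQ y hy i, h]; norm_num
    have h3 := hFf hyA
    funext k
    have h4 : F (cl y) k = (((cl y).1 k : Icc (0:ℝ) 1) : ℝ) - 1 / 2 := congrFun h3 k
    change s⁻¹ * F (cl y) k = y k
    rw [h4, hclQ y hy k]
    field_simp
    ring)
  have hQQ : Q ∪ Q' = univ := by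
    ext y
    simp only [mem_union, mem_univ, iff_true, Q, Q', mem_iInter, mem_iUnion, mem_ofPred_eq]
    by_contra h
    push Not at h
    obtain ⟨⟨i, hi⟩, h⟩ := h
    linarith [h i]
  rw [hQQ] at hH
  refine no_continuous (V := EuclideanSpace ℝ (Fin n)) (F := fun y => WithLp.toLp 2 (H y)) ?_ ?_ ?_
  · exact (PiLp.continuous_toLp 2 _).comp (continuousOn_univ.1 hH.1)
  · intro y h
    refine hH.2 y (mem_univ _) ?_
    have := congrArg WithLp.ofLp h
    simpa using this
  · intro y hy
    have hyQ : y ∈ Q' := by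
      by_contra hc
      simp only [Q', mem_iUnion, mem_ofPred_eq, not_exists, not_le] at hc
      have hb : ∀ i, (y i) ^ 2 ≤ (1 / (2 * s)) ^ 2 := by
        intro i
        have h1 := hc i
        rw [abs_mul, abs_of_pos hs] at h1
        rw [sq_le_sq, abs_of_pos (show 0 < 1 / (2 * s) by positivity)]
        rw [le_div_iff₀ (by positivity)]
        linarith
      have h2 : ‖y‖ ^ 2 ≤ n * (1 / (2 * s)) ^ 2 := by
        rw [EuclideanSpace.real_norm_sq_eq]
        refine (Finset.sum_le_sum fun i _ => hb i).trans ?_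
        simp
      have h3 : (n:ℝ) * (1 / (2 * s)) ^ 2 < 1 / 4 := by
        have : (n:ℝ) * (1 / (2 * s)) ^ 2 = n / (4 * s ^ 2) := by field_simp; norm_num
        rw [this, div_lt_div_iff₀ (by positivity) (by norm_num)]
        have : (0:ℝ) ≤ n := by positivity
        simp only [s]
        nlinarith
      nlinarith
    have := hH2 hyQ
    simp only [this]

end Stern

namespace Stern

open Set Topology

/-- pairing of a finitely supported measure with a function -/
noncomputable def pr {X : Type*} (μ : X →₀ ℝ) (g : X → ℝ) : ℝ := Finsupp.linearCombination ℝ g μ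

section pr

variable {X Y : Type*}

lemma pr_def (μ : X →₀ ℝ) (g : X → ℝ) : pr μ g = μ.sum fun x a => a * g x := by
  simp [pr, Finsupp.linearCombination_apply]

lemma pr_add (μ ν : X →₀ ℝ) (g : X → ℝ) : pr (μ + ν) g = pr μ g + pr ν g := by
  simp [pr]

lemma pr_sub (μ ν : X →₀ ℝ) (g : X → ℝ) : pr (μ - ν) g = pr μ g - pr ν g := by
  simp [pr]

lemma pr_smul (c : ℝ) (μ : X →₀ ℝ) (g : X → ℝ) : pr (c • μ) g = c * pr μ g := by
  simp [pr]

lemma pr_single (x : X) (a : ℝ) (g : X → ℝ) : pr (Finsupp.single x a) g = a * g x := by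
  simp [pr]

lemma pr_map (f : X → Y) (μ : X →₀ ℝ) (g : Y → ℝ) : pr (μ.mapDomain f) g = pr μ (g ∘ f) := by
  simp [pr, Finsupp.linearCombination_mapDomain]

lemma pr_congr {μ : X →₀ ℝ} {g h : X → ℝ} (H : ∀ x ∈ μ.support, g x = h x) :
    pr μ g = pr μ h := by
  rw [pr_def, pr_def]
  exact Finsupp.sum_congr fun x hx => by rw [H x hx]

lemma pr_sum {κ : Type*} (s : Finset κ) (μ : X →₀ ℝ) (g : κ → X → ℝ) :
    pr μ (fun x => ∑ q ∈ s, g q x) = ∑ q ∈ s, pr μ (g q) := by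
  simp only [pr_def, Finsupp.sum, Finset.mul_sum]
  exact Finset.sum_comm

lemma pr_const_mul (c : ℝ) (μ : X →₀ ℝ) (g : X → ℝ) : pr μ (fun x => c * g x) = c * pr μ g := by
  simp only [pr_def, Finsupp.sum, Finset.mul_sum]
  exact Finset.sum_congr rfl fun x _ => by ring

/-- a probability measure -/
def Prob (μ : X →₀ ℝ) : Prop := (∀ x, 0 ≤ μ x) ∧ pr μ (fun _ => 1) = 1

lemma Prob.le {μ : X →₀ ℝ} (h : Prob μ) {g : X → ℝ} {c : ℝ} (hg : ∀ x ∈ μ.support, g x ≤ c) :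
    pr μ g ≤ c := by
  have h1 : pr μ g ≤ pr μ (fun _ => c) := by
    rw [pr_def, pr_def]
    exact Finset.sum_le_sum fun x hx => mul_le_mul_of_nonneg_left (hg x hx) (h.1 x)
  have h2 : pr μ (fun _ => c) = c := by
    have := pr_const_mul c μ (fun _ => 1)
    rw [h.2] at this
    simpa using this
  linarith

lemma Prob.ge {μ : X →₀ ℝ} (h : Prob μ) {g : X → ℝ} {c : ℝ} (hg : ∀ x ∈ μ.support, c ≤ g x) :
    c ≤ pr μ g := by
  have := h.le (g := fun x => (-1) * g x) (c := -c) (fun x hx => by have := hg x hx; linarith)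
  rw [pr_const_mul] at this
  linarith

lemma Prob.single (x : X) : Prob (Finsupp.single x (1:ℝ)) := by
  classical
  refine ⟨fun y => ?_, by simp [pr_single]⟩
  rw [Finsupp.single_apply]
  split_ifs <;> norm_num

lemma Prob.map {μ : X →₀ ℝ} (h : Prob μ) (f : X → Y) : Prob (μ.mapDomain f) := by
  classical
  constructor
  · intro y
    simp only [Finsupp.mapDomain, Finsupp.sum_apply]
    refine Finset.sum_nonneg fun x _ => ?_
    simp only [Finsupp.single_apply]
    split_ifs
    · exact h.1 x
    · exact le_rfl
  · rw [pr_map]; exact h.2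

lemma coupling {ι : Type*} [DecidableEq ι] (p : ι → (ℝ →₀ ℝ)) (S : Finset ι)
    (hp : ∀ q ∈ S, Prob (p q)) :
    ∃ P : (ι → ℝ) →₀ ℝ, Prob P ∧ (∀ u ∈ P.support, ∀ q ∈ S, u q ∈ (p q).support) ∧
      ∀ q ∈ S, ∀ h : ℝ → ℝ, pr P (fun u => h (u q)) = pr (p q) h := by
  induction S using Finset.induction_on with
  | empty => exact ⟨Finsupp.single 0 1, Prob.single _, by simp, by simp⟩
  | insert a S ha ih =>
    obtain ⟨P, hP, hP1, hP2⟩ := ih fun q hq => hp q (Finset.mem_insert_of_mem hq)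
    have hpa := hp a (Finset.mem_insert_self a S)
    let Q : (ι → ℝ) →₀ ℝ := P.sum fun u w => w • (p a).mapDomain (fun v => Function.update u a v)
    have hQ : ∀ g : (ι → ℝ) → ℝ, pr Q g =
        pr P (fun u => pr (p a) (fun v => g (Function.update u a v))) := by
      intro g
      simp only [Q, Finsupp.sum]
      rw [pr, map_sum, pr_def, Finsupp.sum]
      refine Finset.sum_congr rfl fun u _ => ?_
      rw [← pr, pr_smul, pr_map]
      rfl
    have hQs : ∀ z, Q z ≠ 0 → ∃ u ∈ P.support, ∃ v ∈ (p a).support, z = Function.update u a v := by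
      intro z hz
      simp only [Q, Finsupp.sum_apply] at hz
      obtain ⟨u, hu, huz⟩ := Finset.exists_ne_zero_of_sum_ne_zero hz
      have h2 : z ∈ ((p a).mapDomain (fun v => Function.update u a v)).support := by
        rw [Finsupp.mem_support_iff]
        intro h0
        apply huz
        simp [h0]
      classical
      have h3 := Finsupp.mapDomain_support h2
      obtain ⟨v, hv, rfl⟩ := Finset.mem_image.1 h3
      exact ⟨u, hu, v, hv, rfl⟩
    refine ⟨Q, ⟨fun z => ?_, ?_⟩, ?_, ?_⟩
    · simp only [Q, Finsupp.sum_apply]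
      refine Finset.sum_nonneg fun u _ => ?_
      simp only [Finsupp.smul_apply, smul_eq_mul]
      exact mul_nonneg (hP.1 u) ((hpa.map _).1 z)
    · rw [hQ, hpa.2, hP.2]
    · intro z hz q hq
      obtain ⟨u, hu, v, hv, rfl⟩ := hQs z (Finsupp.mem_support_iff.1 hz)
      by_cases hqa : q = a
      · subst hqa; simpa using hv
      · rw [Function.update_of_ne hqa]
        exact hP1 u hu q ((Finset.mem_insert.1 hq).resolve_left hqa)
    · intro q hq h
      rw [hQ]
      by_cases hqa : q = a
      · subst hqa
        simp only [Function.update_self]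
        have := pr_const_mul (pr (p q) h) P (fun _ => 1)
        rw [hP.2] at this
        simpa using this
      · have hqS := (Finset.mem_insert.1 hq).resolve_left hqa
        rw [← hP2 q hqS h]
        refine pr_congr fun u _ => ?_
        simp only [Function.update_of_ne hqa]
        have := pr_const_mul (h (u q)) (p a) (fun _ => 1)
        rw [hpa.2] at this
        simpa using this

end pr

/-- uniformly separating families -/
def USF {X ι : Type*} [Fintype ι] (φ : ι → X → ℝ) (C : ℝ) : Prop :=
  ∀ (μ : X →₀ ℝ) (r : ι → ℝ),
    (∀ q, ∀ h : ℝ → ℝ, (∀ t, |h t| ≤ 1) → pr μ (h ∘ φ q) ≤ r q) →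
    ∀ s : X → ℝ, (∀ x, |s x| ≤ 1) → pr μ s ≤ C * ∑ q, r q

lemma exists_USF {X ι : Type*} [MetricSpace X] [CompactSpace X] [Fintype ι]
    (φ : ι → X → ℝ) (hφ : ∀ q, Continuous (φ q))
    (hrep : ∀ f : X → ℝ, Continuous f →
      ∃ g : ι → ℝ → ℝ, (∀ q, Continuous (g q)) ∧ ∀ x, f x = ∑ q, g q (φ q x)) :
    ∃ C > 0, USF φ C := by
  classical
  obtain ⟨R, hR⟩ : ∃ R : ℝ, ∀ q x, |φ q x| ≤ R := by
    have : ∀ q, ∃ R : ℝ, ∀ x, |φ q x| ≤ R := by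
      intro q
      obtain ⟨R, hR⟩ := (isCompact_range (hφ q).abs).bddAbove
      exact ⟨R, fun x => hR ⟨x, rfl⟩⟩
    choose R hR using this
    refine ⟨∑ q, |R q|, fun q x => ?_⟩
    exact (hR q x).trans ((le_abs_self _).trans
      (Finset.single_le_sum (f := fun q => |R q|) (fun i _ => abs_nonneg _) (Finset.mem_univ q)))
  let I : Set ℝ := Icc (-R) R
  let φ' : ι → C(X, I) := fun q => ⟨fun x => ⟨φ q x, abs_le.1 (hR q x)⟩, by
    exact (hφ q).subtype_mk _⟩
  let T1 : ∀ q, C(I, ℝ) →L[ℝ] C(X, ℝ) := fun q =>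
    { toFun := fun g => g.comp (φ' q)
      map_add' := fun _ _ => rfl
      map_smul' := fun _ _ => rfl
      cont := ContinuousMap.continuous_precomp (φ' q) }
  let T : (ι → C(I, ℝ)) →L[ℝ] C(X, ℝ) := ∑ q, (T1 q).comp (ContinuousLinearMap.proj q)
  have hT : ∀ g x, T g x = ∑ q, g q (φ' q x) := by
    intro g x
    simp [T, T1, ContinuousMap.sum_apply]
  have hsurj : Function.Surjective T := by
    intro f
    obtain ⟨g, hg, hfg⟩ := hrep f f.continuous
    refine ⟨fun q => ⟨fun t => g q t, (hg q).comp continuous_subtype_val⟩, ?_⟩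
    ext x
    rw [hT, hfg]
    rfl
  obtain ⟨C, hC, hCT⟩ := T.exists_preimage_norm_le hsurj
  refine ⟨C, hC, fun μ r hr s hs => ?_⟩
  -- a continuous function agreeing with `s` on the support
  obtain ⟨f, hf1, hfs⟩ : ∃ f : C(X, ℝ), ‖f‖ ≤ 1 ∧ ∀ x ∈ μ.support, f x = s x := by
    have hfin : (μ.support : Set X).Finite := μ.support.finite_toSet
    obtain ⟨g, hg, hgs⟩ := tietze (N := 1) (f := fun x _ => s x) hfin.isClosed
      (by
        have : DiscreteTopology (μ.support : Set X) := hfin.isDiscrete.1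
        rw [continuousOn_iff_continuous_domRestrict]
        exact continuous_of_discreteTopology)
    refine ⟨⟨fun x => max (-1) (min 1 (g x 0)), by fun_prop⟩, ?_, fun x hx => ?_⟩
    · refine (ContinuousMap.norm_le _ zero_le_one).2 fun x => ?_
      simp only [ContinuousMap.coe_mk, Real.norm_eq_abs]
      rw [abs_le]
      exact ⟨le_max_left _ _, max_le (by norm_num) (min_le_left _ _)⟩
    · have h1 := congrFun (hgs hx) 0
      have h2 := abs_le.1 (hs x)
      simp only [ContinuousMap.coe_mk, h1, min_eq_right h2.2, max_eq_right h2.1]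
  obtain ⟨g, hg, hgn⟩ := hCT f
  have hgC : ∀ q t, |g q t| ≤ C := by
    intro q t
    have h1 : ‖g q t‖ ≤ ‖g q‖ := ContinuousMap.norm_coe_le_norm _ _
    have h2 : ‖g q‖ ≤ ‖g‖ := norm_le_pi_norm g q
    have h3 : C * ‖f‖ ≤ C * 1 := mul_le_mul_of_nonneg_left hf1 hC.le
    rw [Real.norm_eq_abs] at h1
    linarith
  let h : ι → ℝ → ℝ := fun q t => if ht : t ∈ I then C⁻¹ * g q ⟨t, ht⟩ else 0
  have hh : ∀ q t, |h q t| ≤ 1 := by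
    intro q t
    simp only [h]
    split_ifs with ht
    · rw [abs_mul, abs_of_pos (inv_pos.2 hC), inv_mul_le_iff₀ hC, mul_one]
      exact hgC _ _
    · simp
  have e : pr μ s = ∑ q, C * pr μ (h q ∘ φ q) := by
    simp_rw [← pr_const_mul]
    rw [← pr_sum]
    refine pr_congr fun x hx => ?_
    rw [← hfs x hx, ← hg, hT]
    refine Finset.sum_congr rfl fun q _ => ?_
    have hm : φ q x ∈ I := abs_le.1 (hR q x)
    simp only [Function.comp, h, hm, dif_pos]
    rw [← mul_assoc, mul_inv_cancel₀ hC.ne', one_mul]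
    rfl
  rw [e, Finset.mul_sum]
  exact Finset.sum_le_sum fun q _ => mul_le_mul_of_nonneg_left (hr q _ (hh q)) hC.le

end Stern

namespace Stern

open Set Topology

variable {X ι : Type*} [MetricSpace X] [CompactSpace X] [Fintype ι] [DecidableEq ι]

/-- number of elements of `S` in the list `l` -/
def cnt (S : Finset ι) (l : List ι) : ℕ := (S.filter (· ∈ l)).card

/-- the point `u` lies in the box -/
def InBox (S : Finset ι) (lo hi : ι → ℚ) (u : ι → ℝ) : Prop :=
  ∀ q ∈ S, (lo q : ℝ) ≤ u q ∧ u q ≤ hi q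

/-- a hierarchical selection over a box -/
def Sel (φ : ι → X → ℝ) (l : List ι) (S : Finset ι) (lo hi : ι → ℚ) (K : Set X)
    (x : (ι → ℝ) → X) : Prop :=
  (∀ u, InBox S lo hi u → x u ∈ K) ∧
  (∀ u, InBox S lo hi u → ∀ q ∈ S, φ q (x u) = u q) ∧
  (∀ l1, l1 <+: l → ∀ u u', InBox S lo hi u → InBox S lo hi u' →
    (∀ q ∈ S, q ∈ l1 → u q = u' q) → ∀ q ∈ l1, φ q (x u) = φ q (x u'))

/-- the dimension states along the list -/
def States (φ : ι → X → ℝ) (l : List ι) (S : Finset ι) (K : Set X) (p : ℕ) : Prop :=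
  ∀ l1, l1 <+: l → ∃ K1 ⊆ K, IsClosed K1 ∧ (∀ q ∈ l1, ∃ c, ∀ x ∈ K1, φ q x = c) ∧
    ∃ p1, p1 + cnt S l1 = p ∧ ¬ E p1 K1

lemma not_E_nonempty {p : ℕ} {K : Set X} (h : ¬ E p K) : K.Nonempty := by
  rw [nonempty_iff_ne_empty]
  rintro rfl
  exact h (E_empty p)

lemma sel_closed (φ : ι → X → ℝ) (hφ : ∀ q, Continuous (φ q)) (q0 : ι) (l : List ι)
    (S : Finset ι) (lo hi : ι → ℚ) {K : Set X} (hK : IsClosed K) :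
    IsClosed {c : ℝ | ∃ x, Sel φ l S lo hi (K ∩ φ q0 ⁻¹' {c}) x} := by
  let D : Set (ℝ × ((ι → ℝ) → X)) := {z | Sel φ l S lo hi (K ∩ φ q0 ⁻¹' {z.1}) z.2}
  have hev : ∀ u : ι → ℝ, Continuous fun z : ℝ × ((ι → ℝ) → X) => z.2 u := fun u => by fun_prop
  have hD : IsClosed D := by
    have e : D = (⋂ u, ⋂ (_ : InBox S lo hi u), ({z | z.2 u ∈ K} ∩ {z | φ q0 (z.2 u) = z.1})) ∩
      ((⋂ u, ⋂ (_ : InBox S lo hi u), ⋂ q, ⋂ (_ : q ∈ S), {z | φ q (z.2 u) = u q}) ∩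
      (⋂ l1, ⋂ (_ : l1 <+: l), ⋂ u, ⋂ u', ⋂ (_ : InBox S lo hi u), ⋂ (_ : InBox S lo hi u'),
        ⋂ (_ : ∀ q ∈ S, q ∈ l1 → u q = u' q), ⋂ q, ⋂ (_ : q ∈ l1),
          {z | φ q (z.2 u) = φ q (z.2 u')})) := by
      ext z
      simp only [D, Sel, mem_ofPred_eq, mem_inter_iff, mem_iInter, mem_preimage,
        mem_singleton_iff]
    rw [e]
    refine IsClosed.inter ?_ (IsClosed.inter ?_ ?_)
    · refine isClosed_iInter fun u => isClosed_iInter fun _ => ?_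
      exact (hK.preimage (hev u)).inter
        (isClosed_eq ((hφ q0).comp (hev u)) continuous_fst)
    · refine isClosed_iInter fun u => isClosed_iInter fun _ => isClosed_iInter fun q =>
        isClosed_iInter fun _ => ?_
      exact isClosed_eq ((hφ q).comp (hev u)) continuous_const
    · refine isClosed_iInter fun _ => isClosed_iInter fun _ => isClosed_iInter fun u =>
        isClosed_iInter fun u' => isClosed_iInter fun _ => isClosed_iInter fun _ =>
        isClosed_iInter fun _ => isClosed_iInter fun q => isClosed_iInter fun _ => ?_
      exact isClosed_eq ((hφ q).comp (hev u)) ((hφ q).comp (hev u'))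
  have := isClosedMap_fst_of_compactSpace D hD
  convert this using 1
  ext c
  constructor
  · rintro ⟨x, hx⟩
    exact ⟨(c, x), hx, rfl⟩
  · rintro ⟨⟨c', x⟩, hx, rfl⟩
    exact ⟨x, hx⟩

lemma cnt_nil (S : Finset ι) : cnt S [] = 0 := by simp [cnt]

lemma cnt_cons_not {S : Finset ι} {q : ι} (h : q ∉ S) (l : List ι) : cnt S (q :: l) = cnt S l := by
  unfold cnt
  congr 1
  ext a
  simp only [Finset.mem_filter, List.mem_cons]
  constructor
  · rintro ⟨ha, rfl | h'⟩
    · exact absurd ha h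
    · exact ⟨ha, h'⟩
  · rintro ⟨ha, h'⟩
    exact ⟨ha, Or.inr h'⟩

lemma cnt_cons_insert {S : Finset ι} {q : ι} (h : q ∉ S) {l : List ι} (hl : q ∉ l) :
    cnt (insert q S) (q :: l) = cnt S l + 1 := by
  unfold cnt
  have : (insert q S).filter (· ∈ q :: l) = insert q (S.filter (· ∈ l)) := by
    ext a
    simp only [Finset.mem_filter, List.mem_cons, Finset.mem_insert]
    constructor
    · rintro ⟨ha | ha, h' | h'⟩
      · exact Or.inl ha
      · exact Or.inl ha
      · exact Or.inl h'
      · exact Or.inr ⟨ha, h'⟩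
    · rintro (ha | ⟨ha, h'⟩)
      · exact ⟨Or.inl ha, Or.inl ha⟩
      · exact ⟨Or.inr ha, Or.inr h'⟩
  rw [this, Finset.card_insert_of_notMem]
  simp [h]

lemma selection (φ : ι → X → ℝ) (hφ : ∀ q, Continuous (φ q)) (l : List ι) (hl : l.Nodup) :
    ∀ (K : Set X) (p : ℕ), IsClosed K → ¬ E p K →
      ∃ (S : Finset ι) (lo hi : ι → ℚ) (x : (ι → ℝ) → X), (∀ q ∈ S, q ∈ l) ∧
        (∀ q, lo q < hi q) ∧ Sel φ l S lo hi K x ∧ States φ l S K p := by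
  induction l with
  | nil =>
    intro K p hK hB
    obtain ⟨y, hy⟩ := not_E_nonempty hB
    refine ⟨∅, 0, 1, fun _ => y, by simp, by simp, ⟨fun _ _ => hy, by simp, ?_⟩, ?_⟩
    · intro l1 hl1
      rw [List.prefix_nil] at hl1
      subst hl1
      simp
    · intro l1 hl1
      rw [List.prefix_nil] at hl1
      subst hl1
      exact ⟨K, le_rfl, hK, by simp, p, by simp [cnt_nil], hB⟩
  | cons q0 l ih =>
    intro K p hK hB
    have hql : q0 ∉ l := (List.nodup_cons.1 hl).1
    have ih := ih (List.nodup_cons.1 hl).2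
    have hKc : ∀ c, IsClosed (K ∩ φ q0 ⁻¹' {c}) := fun c =>
      hK.inter (isClosed_singleton.preimage (hφ q0))
    by_cases hcase : ∃ c, ¬ E p (K ∩ φ q0 ⁻¹' {c})
    · obtain ⟨c, hc⟩ := hcase
      obtain ⟨S, lo, hi, x, hS, hlt, ⟨hx1, hx2, hx3⟩, hst⟩ := ih _ p (hKc c) hc
      have hq0S : q0 ∉ S := fun h => hql (hS q0 h)
      refine ⟨S, lo, hi, x, fun q hq => List.mem_cons_of_mem _ (hS q hq), hlt,
        ⟨fun u hu => (hx1 u hu).1, hx2, ?_⟩, ?_⟩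
      · intro l1 hl1 u u' hu hu' huu q hq
        rcases List.prefix_cons_iff.1 hl1 with rfl | ⟨l1', rfl, hl1'⟩
        · simp at hq
        · rcases List.mem_cons.1 hq with rfl | hq
          · have h1 : φ q (x u) = c := (hx1 u hu).2
            have h2 : φ q (x u') = c := (hx1 u' hu').2
            rw [h1, h2]
          · exact hx3 l1' hl1' u u' hu hu'
              (fun q hq h => huu q hq (List.mem_cons_of_mem _ h)) q hq
      · intro l1 hl1
        rcases List.prefix_cons_iff.1 hl1 with rfl | ⟨l1', rfl, hl1'⟩
        · exact ⟨K, le_rfl, hK, by simp, p, by simp [cnt_nil], hB⟩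
        · obtain ⟨K1, hK1, hcl, hconst, p1, hp1, hB1⟩ := hst l1' hl1'
          refine ⟨K1, hK1.trans inter_subset_left, hcl, ?_, p1, ?_, hB1⟩
          · intro q hq
            rcases List.mem_cons.1 hq with rfl | hq
            · exact ⟨c, fun y hy => (hK1 hy).2⟩
            · exact hconst q hq
          · rw [cnt_cons_not hq0S, hp1]
    · push Not at hcase
      have hp : p ≠ 0 := by
        rintro rfl
        obtain ⟨y, hy⟩ := not_E_nonempty hB
        have hne : (K ∩ φ q0 ⁻¹' {φ q0 y}).Nonempty := ⟨y, hy, rfl⟩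
        exact not_E_zero hne (hcase _)
      obtain ⟨p, rfl⟩ := Nat.exists_eq_succ_of_ne_zero hp
      have hnd : ¬ Dense {c | E p (K ∩ φ q0 ⁻¹' {c})} := fun hd =>
        hB (E_fibers hK.isCompact (hφ q0) hcase hd)
      obtain ⟨U, hU, hUne, hUB⟩ : ∃ U : Set ℝ, IsOpen U ∧ U.Nonempty ∧
          ∀ c ∈ U, ¬ E p (K ∩ φ q0 ⁻¹' {c}) := by
        rw [dense_iff_inter_open] at hnd
        push Not at hnd
        obtain ⟨U, hU, hne, h⟩ := hnd
        refine ⟨U, hU, hne, fun c hc hE => ?_⟩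
        have : c ∈ U ∩ {c | E p (K ∩ φ q0 ⁻¹' {c})} := ⟨hc, hE⟩
        rw [h] at this
        exact this
      let I := Finset ι × (ι → ℚ) × (ι → ℚ)
      let A : I → Set ℝ := fun i => {c | c ∈ U ∧ (∀ q ∈ i.1, q ∈ l) ∧ (∀ q, i.2.1 q < i.2.2 q) ∧
        States φ l i.1 (K ∩ φ q0 ⁻¹' {c}) p ∧
        ∃ x, Sel φ l i.1 i.2.1 i.2.2 (K ∩ φ q0 ⁻¹' {c}) x}
      let f : Option I → Set ℝ := fun o => o.elim Uᶜ (fun i => closure (A i))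
      have hf : Dense (⋃ o, interior (f o)) := by
        refine dense_iUnion_interior_of_closed ?_ ?_
        · rintro (_ | i)
          · exact hU.isClosed_compl
          · exact isClosed_closure
        · rw [eq_univ_iff_forall]
          intro c
          by_cases hc : c ∈ U
          · obtain ⟨S, lo, hi, x, hS, hlt, hx, hst⟩ := ih _ p (hKc c) (hUB c hc)
            exact mem_iUnion.2 ⟨some (S, lo, hi), subset_closure ⟨hc, hS, hlt, hst, x, hx⟩⟩
          · exact mem_iUnion.2 ⟨none, hc⟩
      obtain ⟨c1, hc1, hc1U⟩ := hf.inter_open_nonempty U hU hUne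
      obtain ⟨o, ho⟩ := mem_iUnion.1 hc1U
      rcases o with _ | ⟨S, lo, hi⟩
      · exact absurd hc1 (interior_subset ho)
      obtain ⟨ε, hε, hball⟩ := Metric.isOpen_iff.1 isOpen_interior c1 ho
      obtain ⟨a, ha1, ha2⟩ := exists_rat_btwn (show c1 - ε < c1 by linarith)
      obtain ⟨b, hb1, hb2⟩ := exists_rat_btwn (show c1 < c1 + ε by linarith)
      have hIcc : Icc (a:ℝ) b ⊆ closure (A (S, lo, hi)) := by
        intro c hc
        refine interior_subset (hball ?_)
        rw [Metric.mem_ball, Real.dist_eq, abs_lt]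
        constructor <;> linarith [hc.1, hc.2]
      have hab : (a:ℝ) < b := ha2.trans hb1
      obtain ⟨c0, hc0U, hS, hlt, hst, -⟩ : (A (S, lo, hi)).Nonempty := by
        rw [← closure_nonempty_iff]
        exact ⟨a, hIcc ⟨le_rfl, hab.le⟩⟩
      simp only at hS hlt hst
      have hsel : ∀ c ∈ Icc (a:ℝ) b, ∃ x, Sel φ l S lo hi (K ∩ φ q0 ⁻¹' {c}) x := by
        intro c hc
        have := closure_minimal (t := {c : ℝ | ∃ x, Sel φ l S lo hi (K ∩ φ q0 ⁻¹' {c}) x})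
          (fun c hc => hc.2.2.2.2) (sel_closed φ hφ q0 l S lo hi hK) (hIcc hc)
        exact this
      obtain ⟨y0, hy0⟩ := not_E_nonempty hB
      have : Nonempty ((ι → ℝ) → X) := ⟨fun _ => y0⟩
      choose! x hx using hsel
      have hq0S : q0 ∉ S := fun h => hql (hS q0 h)
      have hbox : ∀ u, InBox (insert q0 S) (Function.update lo q0 a) (Function.update hi q0 b) u →
          InBox S lo hi u ∧ u q0 ∈ Icc (a:ℝ) b := by
        intro u hu
        constructor
        · intro q hq
          have hne : q ≠ q0 := fun h => hq0S (h ▸ hq)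
          have := hu q (Finset.mem_insert_of_mem hq)
          rwa [Function.update_of_ne hne, Function.update_of_ne hne] at this
        · have := hu q0 (Finset.mem_insert_self _ _)
          rwa [Function.update_self, Function.update_self] at this
      refine ⟨insert q0 S, Function.update lo q0 a, Function.update hi q0 b,
        fun u => x (u q0) u, ?_, ?_, ⟨?_, ?_, ?_⟩, ?_⟩
      · intro q hq
        rcases Finset.mem_insert.1 hq with rfl | hq
        · exact List.mem_cons_self
        · exact List.mem_cons_of_mem _ (hS q hq)
      · intro q
        by_cases h : q = q0
        · subst h
          rw [Function.update_self, Function.update_self]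
          exact_mod_cast hab
        · rw [Function.update_of_ne h, Function.update_of_ne h]
          exact hlt q
      · intro u hu
        obtain ⟨h1, h2⟩ := hbox u hu
        exact ((hx _ h2).1 u h1).1
      · intro u hu q hq
        obtain ⟨h1, h2⟩ := hbox u hu
        rcases Finset.mem_insert.1 hq with rfl | hq
        · exact ((hx _ h2).1 u h1).2
        · exact (hx _ h2).2.1 u h1 q hq
      · intro l1 hl1 u u' hu hu' huu q hq
        obtain ⟨h1, h2⟩ := hbox u hu
        obtain ⟨h1', h2'⟩ := hbox u' hu'
        rcases List.prefix_cons_iff.1 hl1 with rfl | ⟨l1', rfl, hl1'⟩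
        · simp at hq
        · have e : u q0 = u' q0 := huu q0 (Finset.mem_insert_self _ _) List.mem_cons_self
          simp only [← e]
          rw [← e] at h2'
          rcases List.mem_cons.1 hq with rfl | hq
          · have e1 : φ q (x (u q) u) = u q := ((hx _ h2).1 u h1).2
            have e2 : φ q (x (u q) u') = u q := ((hx _ h2).1 u' h1').2
            rw [e1, e2]
          · exact (hx _ h2).2.2 l1' hl1' u u' h1 h1' (fun q hq h =>
              huu q (Finset.mem_insert_of_mem hq) (List.mem_cons_of_mem _ h)) q hq
      · intro l1 hl1
        rcases List.prefix_cons_iff.1 hl1 with rfl | ⟨l1', rfl, hl1'⟩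
        · exact ⟨K, le_rfl, hK, by simp, p + 1, by simp [cnt_nil], hB⟩
        · obtain ⟨K1, hK1, hcl, hconst, p1, hp1, hB1⟩ := hst l1' hl1'
          refine ⟨K1, hK1.trans inter_subset_left, hcl, ?_, p1, ?_, hB1⟩
          · intro q hq
            rcases List.mem_cons.1 hq with rfl | hq
            · exact ⟨c0, fun y hy => (hK1 hy).2⟩
            · exact hconst q hq
          · rw [cnt_cons_insert hq0S (fun h => hql (hl1'.subset h))]
            omega

end Stern

namespace Stern

open Set Topology

variable {X ι : Type*} [MetricSpace X] [CompactSpace X] [Fintype ι] [DecidableEq ι]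

/-- the maximal configuration -/
structure Core (φ : ι → X → ℝ) (C : ℝ) (K0 : Set X) (T : Finset ι) (p : ℕ) : Prop where
  cont : ∀ q, Continuous (φ q)
  usf : USF φ C
  two : 2 ≤ p
  card : Fintype.card ι ≤ T.card + 2 * p
  const : ∀ q ∈ T, ∃ c, ∀ x ∈ K0, φ q x = c
  closed : IsClosed K0
  big : ¬ E p K0
  max : ∀ K1 ⊆ K0, IsClosed K1 → ∀ (T1 : Finset ι) (p1 : ℕ), T ⊆ T1 →
    (∀ q ∈ T1, ∃ c, ∀ x ∈ K1, φ q x = c) → 2 ≤ p1 → p1 ≤ p → ¬ E p1 K1 →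
    T1.card + 2 * p1 ≤ T.card + 2 * p

lemma exists_core (φ : ι → X → ℝ) (hφ : ∀ q, Continuous (φ q)) {C : ℝ} (hC : USF φ C) {n : ℕ}
    (hn : 2 ≤ n) (hcard : Fintype.card ι ≤ 2 * n) (hbig : ¬ E n (univ : Set X)) :
    ∃ K0 T p, Core φ C K0 T p := by
  let Q : ℕ → Prop := fun k => ∃ (K : Set X) (T : Finset ι) (p : ℕ), IsClosed K ∧
    (∀ q ∈ T, ∃ c, ∀ x ∈ K, φ q x = c) ∧ 2 ≤ p ∧ p ≤ n ∧ ¬ E p K ∧ k = T.card + 2 * p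
  classical
  have hQ : Q (2 * n) := ⟨univ, ∅, n, isClosed_univ, by simp, hn, le_rfl, hbig, by simp⟩
  have hb : 2 * n ≤ 2 * n + Fintype.card ι := by omega
  have hspec := Nat.findGreatest_spec (P := Q) hb hQ
  have hge := Nat.le_findGreatest (P := Q) hb hQ
  have hgr : ∀ k, Q k → k ≤ Nat.findGreatest Q (2 * n + Fintype.card ι) := by
    rintro k hk
    refine Nat.le_findGreatest ?_ hk
    obtain ⟨K, T, p, -, -, -, hp, -, rfl⟩ := hk
    have := T.card_le_univ
    omega
  obtain ⟨K, T, p, hcl, hT, hp2, hpn, hB, he⟩ := hspec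
  rw [he] at hge hgr
  refine ⟨K, T, p, hφ, hC, hp2, by omega, hT, hcl, hB, ?_⟩
  intro K1 hK1 hcl1 T1 p1 hT1 hc1 h2 hpp hB1
  exact hgr _ ⟨K1, T1, p1, hcl1, hc1, h2, by omega, hB1, rfl⟩

lemma USF.sep {φ : ι → X → ℝ} {C : ℝ} (h : USF φ C) {x y : X} (hxy : ∀ q, φ q x = φ q y) :
    x = y := by
  classical
  by_contra hne
  have := h (Finsupp.single x 1 - Finsupp.single y 1) (fun _ => 0) (by
    intro q g _
    rw [pr_sub, pr_single, pr_single]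
    simp [hxy q]) (fun z => if z = x then 1 else 0) (by
    intro z
    split_ifs <;> simp)
  rw [pr_sub, pr_single, pr_single] at this
  simp [Ne.symm hne] at this
  linarith

lemma USF.four {φ : ι → X → ℝ} {C : ℝ} (h : USF φ C) (x : Bool → Bool → X)
    (h1 : ∀ q, (∀ a, φ q (x a false) = φ q (x a true)) ∨
      (∀ b, φ q (x false b) = φ q (x true b)))
    (hd1 : x false false ≠ x true false) (hd2 : x false false ≠ x false true)
    (hd3 : x false false ≠ x true true) : False := by
  classical
  have := h (Finsupp.single (x false false) 1 - Finsupp.single (x true false) 1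
      - (Finsupp.single (x false true) 1 - Finsupp.single (x true true) 1)) (fun _ => 0) (by
    intro q g _
    rw [pr_sub, pr_sub, pr_sub, pr_single, pr_single, pr_single, pr_single]
    simp only [Function.comp]
    rcases h1 q with h1 | h1
    · rw [h1, h1]; simp
    · rw [h1, h1]; simp) (fun z => if z = x false false then 1 else 0) (by
    intro z
    split_ifs <;> simp)
  rw [pr_sub, pr_sub, pr_sub, pr_single, pr_single, pr_single, pr_single] at this
  simp [Ne.symm hd1, Ne.symm hd2, Ne.symm hd3] at this
  linarith

/-- a good choice of coordinates for an order -/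
def Half (l : List ι) (S : Finset ι) (p : ℕ) : Prop :=
  (∀ q ∈ S, q ∈ l) ∧ S.card = p ∧ ∀ l1, l1 <+: l → l1.length ≤ 2 * cnt S l1

lemma Core.lemB {φ : ι → X → ℝ} {C : ℝ} {K0 : Set X} {T : Finset ι} {p : ℕ}
    (H : Core φ C K0 T p) {K : Set X} (hKK : K ⊆ K0) (hK : IsClosed K) (hB : ¬ E p K)
    {l : List ι} (hl : l.Nodup) (hlT : ∀ q, q ∈ l ↔ q ∉ T) :
    ∃ (S : Finset ι) (lo hi : ι → ℚ), Half l S p ∧ (∀ q, lo q < hi q) ∧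
      ∀ u, InBox S lo hi u → ∃ x ∈ K, ∀ q ∈ S, φ q x = u q := by
  obtain ⟨S, lo, hi, x, hSl, hlt, ⟨hx1, hx2, hx3⟩, hst⟩ := selection φ H.cont l hl K p hK hB
  have hp2 := H.two
  have hlen : l.length + T.card = Fintype.card ι := by
    have e : l.toFinset = Tᶜ := by
      ext q
      simp [hlT]
    rw [← List.toFinset_card_of_nodup hl, e, Finset.card_compl]
    have := T.card_le_univ
    omega
  have hlen2 : l.length ≤ 2 * p := by
    have := H.card
    omega
  have hfilt : S.filter (· ∈ l) = S := Finset.filter_true_of_mem hSl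
  have hTc : ∀ K1 ⊆ K, ∀ q ∈ T, ∃ c, ∀ x ∈ K1, φ q x = c := by
    intro K1 hK1 q hq
    obtain ⟨c, hc⟩ := H.const q hq
    exact ⟨c, fun x hx => hc x (hKK (hK1 hx))⟩
  have hfull : cnt S l = p := by
    obtain ⟨K1, hK1, hcl, hconst, p1, hp1, hB1⟩ := hst l (List.prefix_refl l)
    have hsub : K1.Subsingleton := by
      intro y hy z hz
      refine H.usf.sep fun q => ?_
      obtain ⟨c, hc⟩ : ∃ c, ∀ x ∈ K1, φ q x = c := by
        by_cases hq : q ∈ T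
        · exact hTc K1 hK1 q hq
        · exact hconst q ((hlT q).2 hq)
      rw [hc y hy, hc z hz]
    rcases p1 with _ | p1
    · omega
    · exact absurd (E_subsingleton hsub) hB1
  refine ⟨S, lo, hi, ⟨hSl, ?_, ?_⟩, hlt, fun u hu => ⟨x u, hx1 u hu, hx2 u hu⟩⟩
  · rw [← hfull, cnt, hfilt]
  intro l1 hl1
  obtain ⟨K1, hK1, hcl, hconst, p1, hp1, hB1⟩ := hst l1 hl1
  have hl1len := hl1.length_le
  have hl1nd : l1.Nodup := hl1.sublist.nodup hl
  by_contra hcon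
  have hp1 : p1 = 1 := by
    by_contra hne
    have h2 : 2 ≤ p1 := by
      by_contra h
      have : p1 = 0 := by omega
      omega
    have := H.max K1 (hK1.trans hKK) hcl (T ∪ l1.toFinset) p1 Finset.subset_union_left (by
      intro q hq
      rcases Finset.mem_union.1 hq with hq | hq
      · exact hTc K1 hK1 q hq
      · exact hconst q (List.mem_toFinset.1 hq)) h2 (by omega) hB1
    rw [Finset.card_union_of_disjoint, List.toFinset_card_of_nodup hl1nd] at this
    · omega
    · rw [Finset.disjoint_left]
      intro q hq hq'
      exact (hlT q).1 (hl1.subset (List.mem_toFinset.1 hq')) hq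
  have hne : l1 ≠ l := by
    rintro rfl
    omega
  have hlt1 : l1.length < l.length := by
    refine lt_of_le_of_ne hl1len fun h => hne (hl1.eq_of_length h)
  obtain ⟨t, rfl⟩ := hl1
  rw [List.length_append] at *
  obtain ⟨qL, rfl⟩ : ∃ qL, t = [qL] := List.length_eq_one_iff.1 (by omega)
  have hqLl : qL ∉ l1 := by
    have := List.disjoint_of_nodup_append hl
    intro h
    exact this h (by simp)
  have hqLS : qL ∈ S := by
    by_contra hq
    have : cnt S (l1 ++ [qL]) = cnt S l1 := by
      unfold cnt
      congr 1
      ext a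
      simp only [Finset.mem_filter, List.mem_append, List.mem_singleton]
      constructor
      · rintro ⟨ha, h | rfl⟩
        · exact ⟨ha, h⟩
        · exact absurd ha hq
      · rintro ⟨ha, h⟩
        exact ⟨ha, Or.inl h⟩
    omega
  obtain ⟨q1, hq1⟩ : (S.filter (· ∈ l1)).Nonempty := by
    rw [← Finset.card_pos]
    have : cnt S l1 = (S.filter (· ∈ l1)).card := rfl
    omega
  obtain ⟨hq1S, hq1l⟩ := Finset.mem_filter.1 hq1
  have hq1L : q1 ≠ qL := fun h => hqLl (h ▸ hq1l)
  let u : Bool → Bool → ι → ℝ := fun a b q => if q = qL then (if b then hi q else lo q) else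
    if q = q1 then (if a then hi q else lo q) else lo q
  have hlt' : ∀ q, (lo q : ℝ) < hi q := fun q => by exact_mod_cast hlt q
  have hu : ∀ a b, InBox S lo hi (u a b) := by
    intro a b q _
    have := (hlt' q).le
    dsimp only [u]
    split_ifs <;> constructor <;> first | exact le_rfl | exact this
  refine H.usf.four (fun a b => x (u a b)) ?_ ?_ ?_ ?_
  · intro q
    by_cases hqT : q ∈ T
    · left
      intro a
      obtain ⟨c, hc⟩ := H.const q hqT
      rw [hc _ (hKK (hx1 _ (hu _ _))), hc _ (hKK (hx1 _ (hu _ _)))]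
    · have := (hlT q).2 hqT
      rw [List.mem_append, List.mem_singleton] at this
      rcases this with hq | rfl
      · left
        intro a
        refine hx3 l1 (List.prefix_append _ _) _ _ (hu _ _) (hu _ _) ?_ q hq
        intro q' _ hq'
        have : q' ≠ qL := fun h => hqLl (h ▸ hq')
        simp [u, this]
      · right
        intro b
        rw [hx2 _ (hu _ _) _ hqLS, hx2 _ (hu _ _) _ hqLS]
        simp [u]
  · intro h
    have h2 := congrArg (φ q1) h
    rw [hx2 _ (hu _ _) _ hq1S, hx2 _ (hu _ _) _ hq1S] at h2
    simp [u, hq1L] at h2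
    exact absurd h2 (hlt q1).ne
  · intro h
    have h2 := congrArg (φ qL) h
    rw [hx2 _ (hu _ _) _ hqLS, hx2 _ (hu _ _) _ hqLS] at h2
    simp [u] at h2
    exact absurd h2 (hlt qL).ne
  · intro h
    have h2 := congrArg (φ qL) h
    rw [hx2 _ (hu _ _) _ hqLS, hx2 _ (hu _ _) _ hqLS] at h2
    simp [u] at h2
    exact absurd h2 (hlt qL).ne

end Stern

namespace Stern

open Set Topology

variable {X ι : Type*} [MetricSpace X] [CompactSpace X] [Fintype ι] [DecidableEq ι]

lemma Core.lemC {φ : ι → X → ℝ} {C : ℝ} {K0 : Set X} {T : Finset ι} {p : ℕ}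
    (H : Core φ C K0 T p) {K : Set X} (hKK : K ⊆ K0) (hK : IsClosed K) (hB : ¬ E p K)
    {l : List ι} (hl : l.Nodup) (hlT : ∀ q, q ∈ l ↔ q ∉ T) :
    ∃ S : Finset ι, Half l S p ∧ ∃ K1 ⊆ K, IsClosed K1 ∧ ¬ E p K1 ∧
      ∀ u : ι → ℝ, (∀ q ∈ S, u q ∈ φ q '' K1) → ∃ x ∈ K, ∀ q ∈ S, φ q x = u q := by
  by_contra hcon
  push Not at hcon
  let Good : Finset ι → (ι → ℚ) → (ι → ℚ) → Prop := fun S lo hi => Half l S p ∧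
    (∀ q, lo q < hi q) ∧ ∀ u, InBox S lo hi u → ∃ x ∈ K, ∀ q ∈ S, φ q x = u q
  let O : Set X := ⋃ S, ⋃ lo, ⋃ hi, ⋃ (_ : Good S lo hi), ⋂ q ∈ S,
    (φ q ⁻¹' Ioo (lo q : ℝ) (hi q))
  have hO : IsOpen O := by
    refine isOpen_iUnion fun S => isOpen_iUnion fun lo => isOpen_iUnion fun hi =>
      isOpen_iUnion fun _ => isOpen_biInter_finset fun q _ => isOpen_Ioo.preimage (H.cont q)
  have hOmem : ∀ x, x ∈ O ↔ ∃ S lo hi, Good S lo hi ∧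
      ∀ q ∈ S, (lo q : ℝ) < φ q x ∧ φ q x < hi q := by
    intro x
    simp [O]
  refine hB (E_local (K0 := K \ O) hK.isCompact (hK.sdiff hO) sdiff_subset ?_ ?_)
  · by_contra hbad
    obtain ⟨S, lo, hi, hh, hlt, hu⟩ := H.lemB (sdiff_subset.trans hKK) (hK.sdiff hO) hbad hl hlT
    have hlt' : ∀ q, (lo q : ℝ) < hi q := fun q => by exact_mod_cast hlt q
    obtain ⟨x, hx, hxq⟩ := hu (fun q => ((lo q : ℝ) + hi q) / 2) (fun q _ => by
      have := hlt' q
      constructor <;> linarith)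
    refine hx.2 ((hOmem x).2 ⟨S, lo, hi, ⟨hh, hlt, fun u hu' => ?_⟩, fun q hq => ?_⟩)
    · obtain ⟨y, hy, hyq⟩ := hu u hu'
      exact ⟨y, hy.1, hyq⟩
    · rw [hxq q hq]
      have := hlt' q
      constructor <;> linarith
  · intro x hx hxO
    have hxO : x ∈ O := by
      by_contra h
      exact hxO ⟨hx, h⟩
    obtain ⟨S, lo, hi, ⟨hh, hlt, hu⟩, hxq⟩ := (hOmem x).1 hxO
    let V : Set X := ⋂ q ∈ S, φ q ⁻¹' Icc (lo q : ℝ) (hi q)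
    have hV : IsClosed V := isClosed_biInter fun q _ => isClosed_Icc.preimage (H.cont q)
    refine ⟨V, hV, ?_, ?_⟩
    · refine (Filter.biInter_finset_mem S).2 fun q hq => ?_
      exact (H.cont q).continuousAt.preimage_mem_nhds (Icc_mem_nhds (hxq q hq).1 (hxq q hq).2)
    · by_contra hbad
      obtain ⟨u, hu1, hu2⟩ := hcon S hh (K ∩ V) inter_subset_left (hK.inter hV) hbad
      obtain ⟨y, hy, hyq⟩ := hu u (by
        intro q hq
        obtain ⟨z, hz, hzq⟩ := hu1 q hq
        rw [← hzq]
        have := hz.2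
        simp only [V, mem_iInter] at this
        exact this q hq)
      obtain ⟨q, hq, hne⟩ := hu2 y hy
      exact hne (hyq q hq)

lemma Core.lemC_list {φ : ι → X → ℝ} {C : ℝ} {K0 : Set X} {T : Finset ι} {p : ℕ}
    (H : Core φ C K0 T p) {K : Set X} (hKK : K ⊆ K0) (hK : IsClosed K) (hB : ¬ E p K)
    (Ls : List (List ι)) (hLs : ∀ l ∈ Ls, l.Nodup ∧ ∀ q, q ∈ l ↔ q ∉ T) :
    ∃ K1 ⊆ K, IsClosed K1 ∧ ¬ E p K1 ∧ ∀ l ∈ Ls, ∃ S : Finset ι, Half l S p ∧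
      ∀ u : ι → ℝ, (∀ q ∈ S, u q ∈ φ q '' K1) → ∃ x ∈ K, ∀ q ∈ S, φ q x = u q := by
  induction Ls with
  | nil => exact ⟨K, le_rfl, hK, hB, by simp⟩
  | cons l Ls ih =>
    obtain ⟨K1, hK1, hcl1, hB1, h1⟩ := ih fun l hl => hLs l (List.mem_cons_of_mem _ hl)
    obtain ⟨hnd, hlT⟩ := hLs l List.mem_cons_self
    obtain ⟨S, hS, K2, hK2, hcl2, hB2, h2⟩ := H.lemC (hK1.trans hKK) hcl1 hB1 hnd hlT
    refine ⟨K2, hK2.trans hK1, hcl2, hB2, fun l' hl' => ?_⟩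
    rcases List.mem_cons.1 hl' with rfl | hl'
    · refine ⟨S, hS, fun u hu => ?_⟩
      obtain ⟨x, hx, hxq⟩ := h2 u hu
      exact ⟨x, hK1 hx, hxq⟩
    · obtain ⟨S', hS', h'⟩ := h1 l' hl'
      exact ⟨S', hS', fun u hu => h' u fun q hq => image_mono hK2 (hu q hq)⟩

lemma Core.lemC_all {φ : ι → X → ℝ} {C : ℝ} {K0 : Set X} {T : Finset ι} {p : ℕ}
    (H : Core φ C K0 T p) {K : Set X} (hKK : K ⊆ K0) (hK : IsClosed K) (hB : ¬ E p K) :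
    ∃ K1 ⊆ K, IsClosed K1 ∧ ¬ E p K1 ∧ ∀ l : List ι, l.Nodup → (∀ q, q ∈ l ↔ q ∉ T) →
      ∃ S : Finset ι, Half l S p ∧
      ∀ u : ι → ℝ, (∀ q ∈ S, u q ∈ φ q '' K1) → ∃ x ∈ K, ∀ q ∈ S, φ q x = u q := by
  obtain ⟨K1, h1, h2, h3, h4⟩ := H.lemC_list hKK hK hB (Tᶜ).toList.permutations (by
    intro l hl
    rw [List.mem_permutations] at hl
    refine ⟨hl.nodup_iff.2 (Finset.nodup_toList _), fun q => ?_⟩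
    rw [hl.mem_iff]
    simp)
  refine ⟨K1, h1, h2, h3, fun l hl hlT => h4 l ?_⟩
  rw [List.mem_permutations, List.perm_ext_iff_of_nodup hl (Finset.nodup_toList _)]
  intro q
  simp [hlT]

lemma E_biUnion {p : ℕ} (s : Finset ι) (L : ι → Set X) (hL : ∀ i ∈ s, IsClosed (L i))
    (h : ∀ i ∈ s, E p (L i)) : E p (⋃ i ∈ s, L i) := by
  intro j A f hA hAL hf
  obtain ⟨F, hF, hFf⟩ := Ext.extend_finset s (L := fun i => L i ×ˢ cube j)
    (fun i hi => h i hi j) (fun i hi => (hL i hi).prod (isCompact_cube j).isClosed) hA hf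
  refine ⟨F, hF.mono ?_, hFf⟩
  rintro ⟨x, c⟩ ⟨hx, hc⟩
  right
  obtain ⟨i, hi, hxi⟩ := mem_iUnion₂.1 hx
  exact mem_iUnion₂.2 ⟨i, hi, hxi, hc⟩

lemma Core.lemC2 {φ : ι → X → ℝ} {C : ℝ} {K0 : Set X} {T : Finset ι} {p : ℕ}
    (H : Core φ C K0 T p) {K : Set X} (hKK : K ⊆ K0) (hK : IsClosed K) (hB : ¬ E p K) :
    ∃ K1 ⊆ K, ∃ K2 ⊆ K, IsClosed K1 ∧ IsClosed K2 ∧ ¬ E p K1 ∧ ¬ E p K2 ∧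
      ∀ q, q ∉ T → ∀ x ∈ K1, ∀ y ∈ K2, φ q x ≠ φ q y := by
  have hslice : ∀ q, q ∉ T → ∀ c, E p (K ∩ φ q ⁻¹' {c}) := by
    intro q hq c
    by_contra hbad
    have := H.max _ (inter_subset_left.trans hKK)
      (hK.inter (isClosed_singleton.preimage (H.cont q))) (insert q T) p
      (Finset.subset_insert _ _) (by
        intro q' hq'
        rcases Finset.mem_insert.1 hq' with rfl | hq'
        · exact ⟨c, fun x hx => hx.2⟩
        · obtain ⟨c, hc⟩ := H.const q' hq'
          exact ⟨c, fun x hx => hc x (hKK hx.1)⟩) H.two le_rfl hbad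
    rw [Finset.card_insert_of_notMem hq] at this
    omega
  obtain ⟨z, hz, hzV⟩ : ∃ z ∈ K, ∀ V, IsClosed V → V ∈ 𝓝 z → ¬ E p (K ∩ V) := by
    by_contra hcon
    push Not at hcon
    exact hB (E_local (K0 := ∅) hK.isCompact isClosed_empty (empty_subset _) (E_empty p)
      fun x hx _ => hcon x hx)
  by_contra hcon
  push Not at hcon
  refine hB (E_local (K0 := ⋃ q ∈ Tᶜ, K ∩ φ q ⁻¹' {φ q z}) hK.isCompact ?_ ?_ ?_ ?_)
  · exact isClosed_biUnion_finset fun q _ => hK.inter (isClosed_singleton.preimage (H.cont q))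
  · exact iUnion₂_subset fun q _ => inter_subset_left
  · exact E_biUnion _ _ (fun q _ => hK.inter (isClosed_singleton.preimage (H.cont q)))
      fun q hq => hslice q (by simpa using hq) _
  · intro x hx hx0
    have hne : ∀ q, q ∉ T → 0 < |φ q x - φ q z| := by
      intro q hq
      rw [abs_pos, sub_ne_zero]
      intro h
      exact hx0 (mem_iUnion₂.2 ⟨q, by simpa using hq, hx, h⟩)
    obtain ⟨δ, hδ, hδ0⟩ : ∃ δ : ℝ, (∀ q, q ∉ T → 2 * δ < |φ q x - φ q z|) ∧ 0 < δ := by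
      have h1 : ∀ᶠ δ : ℝ in 𝓝[>] 0, ∀ q, q ∉ T → 2 * δ < |φ q x - φ q z| := by
        rw [Filter.eventually_all]
        intro q
        by_cases hq : q ∈ T
        · simp [hq]
        · have h2 : Filter.Tendsto (fun δ : ℝ => 2 * δ) (𝓝[>] 0) (𝓝 (2 * 0)) :=
            (Continuous.tendsto (by fun_prop) 0).mono_left nhdsWithin_le_nhds
          rw [mul_zero] at h2
          filter_upwards [h2.eventually_lt_const (hne q hq)] with δ hδ _ using hδ
      obtain ⟨δ, h1, h2⟩ := (h1.and self_mem_nhdsWithin).exists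
      exact ⟨δ, h1, h2⟩
    have hc : ∀ q, Continuous fun y => |φ q y - φ q z| := fun q =>
      ((H.cont q).sub continuous_const).abs
    let V : Set X := ⋂ q ∈ Tᶜ, (fun y => |φ q y - φ q z|) ⁻¹' Ici (2 * δ)
    let W : Set X := ⋂ q ∈ Tᶜ, (fun y => |φ q y - φ q z|) ⁻¹' Iic δ
    have hV : IsClosed V := isClosed_biInter fun q _ => isClosed_Ici.preimage (hc q)
    have hW : IsClosed W := isClosed_biInter fun q _ => isClosed_Iic.preimage (hc q)
    refine ⟨V, hV, ?_, ?_⟩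
    · refine (Filter.biInter_finset_mem _).2 fun q hq => ?_
      exact (hc q).continuousAt.preimage_mem_nhds (Ici_mem_nhds (hδ q (by simpa using hq)))
    · by_contra hbad
      have hWz : W ∈ 𝓝 z := by
        refine (Filter.biInter_finset_mem _).2 fun q hq => ?_
        exact (hc q).continuousAt.preimage_mem_nhds (Iic_mem_nhds (by simpa using hδ0))
      obtain ⟨q, hq, y, hy, w, hw, hyw⟩ := hcon (K ∩ W) inter_subset_left (K ∩ V)
        inter_subset_left (hK.inter hW) (hK.inter hV) (hzV W hW hWz) hbad
      have h1 := hy.2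
      have h2 := hw.2
      simp only [W, V, mem_iInter] at h1 h2
      have h1 : |φ q y - φ q z| ≤ δ := h1 q (by simpa using hq)
      have h2 : 2 * δ ≤ |φ q w - φ q z| := h2 q (by simpa using hq)
      rw [hyw] at h1
      linarith

end Stern

namespace Stern

open Set Topology

/-- a sign without zero -/
noncomputable def sgn (a : ℝ) : ℝ := if 0 ≤ a then 1 else -1

lemma abs_sgn (a : ℝ) : |sgn a| ≤ 1 := by
  unfold sgn
  split_ifs <;> simp

lemma mul_sgn (a : ℝ) : a * sgn a = |a| := by
  unfold sgn
  split_ifs with h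
  · rw [mul_one, abs_of_nonneg h]
  · rw [abs_of_neg (not_le.1 h)]; ring

section

variable {X : Type*}

/-- total variation -/
noncomputable def nrm (ν : X →₀ ℝ) : ℝ := ν.sum fun _ a => |a|

lemma nrm_nonneg (ν : X →₀ ℝ) : 0 ≤ nrm ν := Finset.sum_nonneg fun _ _ => abs_nonneg _

lemma le_nrm (ν : X →₀ ℝ) {h : X → ℝ} (hh : ∀ t, |h t| ≤ 1) : pr ν h ≤ nrm ν := by
  rw [pr_def]
  refine Finset.sum_le_sum fun t _ => ?_
  calc ν t * h t ≤ |ν t * h t| := le_abs_self _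
    _ = |ν t| * |h t| := abs_mul _ _
    _ ≤ |ν t| * 1 := mul_le_mul_of_nonneg_left (hh t) (abs_nonneg _)
    _ = |ν t| := mul_one _

lemma nrm_eq (ν : X →₀ ℝ) : nrm ν = pr ν fun t => sgn (ν t) := by
  rw [pr_def]
  exact Finset.sum_congr rfl fun t _ => (mul_sgn _).symm

lemma nrm_le {ν : X →₀ ℝ} {c : ℝ} (h : ∀ h : X → ℝ, (∀ t, |h t| ≤ 1) → pr ν h ≤ c) :
    nrm ν ≤ c := by
  rw [nrm_eq]
  exact h _ fun t => abs_sgn _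

lemma split_measure {ν : X →₀ ℝ} (h0 : pr ν (fun _ => 1) = 0) (hr : 0 < nrm ν) :
    ∃ P M : X →₀ ℝ, Prob P ∧ Prob M ∧ P.support ⊆ ν.support ∧ M.support ⊆ ν.support ∧
      (∀ h, pr P h - pr M h = 2 / nrm ν * pr ν h) ∧ (∀ t ∈ P.support, sgn (ν t) = 1) ∧
      (∀ t ∈ M.support, sgn (ν t) = -1) := by
  set r := nrm ν with hrdef
  let A : X →₀ ℝ := ν.mapRange abs abs_zero
  have hA : ∀ t, A t = |ν t| := fun t => by simp [A]
  have hA1 : pr A (fun _ => 1) = r := by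
    rw [pr_def, hrdef, nrm]
    simp only [A, mul_one]
    rw [Finsupp.sum_mapRange_index]
    intro; rfl
  have hPv : ∀ t, (r⁻¹ • (A + ν)) t = r⁻¹ * (|ν t| + ν t) := fun t => by simp [hA, mul_add, mul_sub]
  have hMv : ∀ t, (r⁻¹ • (A - ν)) t = r⁻¹ * (|ν t| - ν t) := fun t => by simp [hA, mul_add, mul_sub]
  have hri : 0 < r⁻¹ := inv_pos.2 hr
  refine ⟨r⁻¹ • (A + ν), r⁻¹ • (A - ν), ⟨fun t => ?_, ?_⟩, ⟨fun t => ?_, ?_⟩, ?_, ?_, ?_, ?_, ?_⟩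
  · rw [hPv]
    exact mul_nonneg hri.le (by linarith [neg_abs_le (ν t)])
  · rw [pr_smul, pr_add, hA1, h0, add_zero, inv_mul_cancel₀ hr.ne']
  · rw [hMv]
    exact mul_nonneg hri.le (by linarith [le_abs_self (ν t)])
  · rw [pr_smul, pr_sub, hA1, h0, sub_zero, inv_mul_cancel₀ hr.ne']
  · intro t ht
    rw [Finsupp.mem_support_iff] at ht ⊢
    rw [hPv] at ht
    intro h
    simp [h] at ht
  · intro t ht
    rw [Finsupp.mem_support_iff] at ht ⊢
    rw [hMv] at ht
    intro h
    simp [h] at ht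
  · intro h
    rw [pr_smul, pr_smul, pr_add, pr_sub]
    ring
  · intro t ht
    rw [Finsupp.mem_support_iff, hPv] at ht
    unfold sgn
    rw [if_pos]
    by_contra hn
    rw [abs_of_neg (not_le.1 hn)] at ht
    simp at ht
  · intro t ht
    rw [Finsupp.mem_support_iff, hMv] at ht
    unfold sgn
    rw [if_neg]
    intro hn
    rw [abs_of_nonneg hn] at ht
    simp at ht

lemma kappa {ι : Type*} [DecidableEq ι] (φ : ι → X → ℝ) (S : Finset ι) (P M : ι → (ℝ →₀ ℝ))
    (hP : ∀ q ∈ S, Prob (P q)) (hM : ∀ q ∈ S, Prob (M q)) (A : ι → Set ℝ)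
    (hPA : ∀ q ∈ S, ∀ t ∈ (P q).support, t ∈ A q) (hMA : ∀ q ∈ S, ∀ t ∈ (M q).support, t ∈ A q)
    (K : Set X) (hne : K.Nonempty)
    (hK : ∀ u : ι → ℝ, (∀ q ∈ S, u q ∈ A q) → ∃ x ∈ K, ∀ q ∈ S, φ q x = u q)
    {ρ : ℝ} (hρ : 0 ≤ ρ) :
    ∃ κ : X →₀ ℝ, (∀ x ∈ κ.support, x ∈ K ∧ ∀ q ∈ S, φ q x ∈ A q) ∧ pr κ (fun _ => 1) = 0 ∧
      (∀ g : X → ℝ, (∀ x, |g x| ≤ 1) → pr κ g ≤ ρ) ∧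
      ∀ q ∈ S, ∀ h : ℝ → ℝ, pr κ (h ∘ φ q) = ρ / 2 * (pr (M q) h - pr (P q) h) := by
  classical
  obtain ⟨x0, hx0⟩ := hne
  have : Nonempty X := ⟨x0⟩
  choose! y hy1 hy2 using hK
  obtain ⟨P', hP', hP1, hP2⟩ := coupling P S hP
  obtain ⟨M', hM', hM1, hM2⟩ := coupling M S hM
  have hcomp : ∀ (Q : (ι → ℝ) →₀ ℝ), (∀ u ∈ Q.support, ∀ q ∈ S, u q ∈ A q) → ∀ q ∈ S,
      ∀ h : ℝ → ℝ, pr (Q.mapDomain y) (h ∘ φ q) = pr Q (fun u => h (u q)) := by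
    intro Q hQ q hq h
    rw [pr_map]
    refine pr_congr fun u hu => ?_
    simp only [Function.comp]
    rw [hy2 u (hQ u hu) q hq]
  have hsupp : ∀ (Q : (ι → ℝ) →₀ ℝ), (∀ u ∈ Q.support, ∀ q ∈ S, u q ∈ A q) →
      ∀ x ∈ (Q.mapDomain y).support, x ∈ K ∧ ∀ q ∈ S, φ q x ∈ A q := by
    intro Q hQ x hx
    obtain ⟨u, hu, rfl⟩ := Finset.mem_image.1 (Finsupp.mapDomain_support hx)
    refine ⟨hy1 u (hQ u hu), fun q hq => ?_⟩
    rw [hy2 u (hQ u hu) q hq]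
    exact hQ u hu q hq
  have hPs : ∀ u ∈ P'.support, ∀ q ∈ S, u q ∈ A q := fun u hu q hq => hPA q hq _ (hP1 u hu q hq)
  have hMs : ∀ u ∈ M'.support, ∀ q ∈ S, u q ∈ A q := fun u hu q hq => hMA q hq _ (hM1 u hu q hq)
  refine ⟨(ρ / 2) • (M'.mapDomain y - P'.mapDomain y), ?_, ?_, ?_, ?_⟩
  · intro x hx
    have hx2 := Finsupp.support_sub (Finsupp.support_smul hx)
    rcases Finset.mem_union.1 hx2 with h | h
    · exact hsupp M' hMs x h
    · exact hsupp P' hPs x h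
  · rw [pr_smul, pr_sub, (hM'.map y).2, (hP'.map y).2]
    simp
  · intro g hg
    rw [pr_smul, pr_sub]
    have h1 := (hM'.map y).le (g := g) (c := 1) fun x _ => (abs_le.1 (hg x)).2
    have h2 := (hP'.map y).ge (g := g) (c := -1) fun x _ => (abs_le.1 (hg x)).1
    nlinarith
  · intro q hq h
    rw [pr_smul, pr_sub, hcomp M' hMs q hq, hcomp P' hPs q hq, hM2 q hq, hP2 q hq]

end

section abel

variable {ι : Type*}

lemma abel_list (R e : ι → ℝ) (l : List ι) :
    l.Pairwise (fun a b => R b ≤ R a) →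
    (∀ l1, l1 <+: l → 0 ≤ (l1.map e).sum) → ∀ b, 0 ≤ b → (∀ q ∈ l, b ≤ R q) →
    b * (l.map e).sum ≤ (l.map fun q => R q * e q).sum := by
  induction l using List.reverseRecOn with
  | nil => simp
  | append_singleton l a ih =>
    intro hs hpre b hb hbl
    rw [List.pairwise_append] at hs
    have ha : b ≤ R a := hbl a (by simp)
    have h1 := ih hs.1 (fun l1 h => hpre l1 (h.trans (List.prefix_append _ _))) (R a)
      (hb.trans ha) (fun q hq => hs.2.2 q hq a (by simp))
    have h2 := hpre _ (List.prefix_refl _)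
    simp only [List.map_append, List.sum_append, List.map_cons, List.map_nil, List.sum_cons,
      List.sum_nil, add_zero] at h2 ⊢
    nlinarith

lemma abel [Fintype ι] [DecidableEq ι] {R : ι → ℝ} (hR : ∀ q, 0 ≤ R q) {l : List ι}
    (hl : l.Nodup) (hs : l.Pairwise (fun a b => R b ≤ R a)) {S : Finset ι} {p : ℕ}
    (hS : Half l S p) :
    ∑ q ∈ l.toFinset \ S, R q ≤ ∑ q ∈ S, R q := by
  let e : ι → ℝ := fun q => if q ∈ S then 1 else -1
  have hsum : ∀ l1 : List ι, l1.Nodup → (l1.map e).sum = 2 * cnt S l1 - l1.length := by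
    intro l1 h1
    rw [← List.sum_toFinset e h1, ← List.toFinset_card_of_nodup h1]
    have : ∀ q, e q = 2 * (if q ∈ S then 1 else 0) - 1 := by
      intro q
      simp only [e]
      split_ifs <;> norm_num
    simp only [this]
    rw [Finset.sum_sub_distrib, ← Finset.mul_sum, Finset.sum_boole]
    have e2 : l1.toFinset.filter (· ∈ S) = S.filter (· ∈ l1) := by
      ext q
      simp [and_comm]
    rw [e2]
    simp [cnt]
  have h := abel_list R e l hs (by
    intro l1 h1
    rw [hsum l1 (h1.sublist.nodup hl)]
    have := hS.2.2 l1 h1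
    have : (l1.length : ℝ) ≤ 2 * cnt S l1 := by exact_mod_cast this
    linarith) 0 le_rfl (fun q _ => hR q)
  rw [zero_mul, ← List.sum_toFinset _ hl] at h
  have hSl : S ⊆ l.toFinset := fun q hq => List.mem_toFinset.2 (hS.1 q hq)
  rw [← Finset.sum_sdiff hSl] at h
  have h1 : ∑ q ∈ l.toFinset \ S, R q * e q = - ∑ q ∈ l.toFinset \ S, R q := by
    rw [← Finset.sum_neg_distrib]
    refine Finset.sum_congr rfl fun q hq => ?_
    simp [e, (Finset.mem_sdiff.1 hq).2]
  have h2 : ∑ q ∈ S, R q * e q = ∑ q ∈ S, R q := by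
    refine Finset.sum_congr rfl fun q hq => ?_
    simp [e, hq]
  linarith

lemma exists_sorted [Fintype ι] [DecidableEq ι] (R : ι → ℝ) (T : Finset ι) :
    ∃ l : List ι, l.Nodup ∧ (∀ q, q ∈ l ↔ q ∉ T) ∧ l.Pairwise (fun a b => R b ≤ R a) := by
  classical
  have : Std.Total (fun a b : ι => R b ≤ R a) := ⟨fun a b => le_total _ _⟩
  have : IsTrans ι (fun a b : ι => R b ≤ R a) := ⟨fun a b c h1 h2 => h2.trans h1⟩
  refine ⟨(Tᶜ).toList.insertionSort (fun a b => R b ≤ R a), ?_, ?_, ?_⟩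
  · exact (List.perm_insertionSort _ _).nodup_iff.2 (Finset.nodup_toList _)
  · intro q
    rw [(List.perm_insertionSort _ _).mem_iff]
    simp
  · exact List.pairwise_insertionSort _ _

end abel

end Stern

namespace Stern

open Set Topology

lemma improve_num {ι : Type*} [Fintype ι] [DecidableEq ι] {S T G : Finset ι} (_hG : G ⊆ S)
    {R N : ι → ℝ} {ρ t t0 : ℝ} (hρ : 0 < ρ) (hρ1 : ρ ≤ 1)
    (hρ2 : (5 * Fintype.card ι + 1) * ρ ≤ 2 * t0) (ht : t0 ≤ t)
    (hR : ∀ q, 0 ≤ R q) (hN : ∀ q, 0 ≤ N q) (hST : S ⊆ Tᶜ)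
    (h1 : ∀ q ∈ G, (1 + ρ) * N q ≤ R q - ρ)
    (h2 : ∀ q ∈ S, q ∉ G → (1 + ρ) * N q ≤ R q ∧ R q ≤ 2 * ρ)
    (h3 : ∀ q, q ∉ S → q ∉ T → (1 + ρ) * N q ≤ R q + ρ)
    (h4 : ∀ q ∈ T, (1 + ρ) * N q ≤ R q)
    (hab : ∑ q ∈ Tᶜ \ S, R q ≤ ∑ q ∈ S, R q) (hRt : ∑ q, R q ^ 2 ≤ t) :
    ∑ q, N q ^ 2 ≤ t - ρ ^ 2 / 4 := by
  let e : ι → ℝ := fun q => if q ∈ G then -1 else if q ∈ S then 0 else if q ∈ T then 0 else 1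
  have he : ∀ q, (1 + ρ) * N q ≤ R q + ρ * e q := by
    intro q
    simp only [e]
    split_ifs with a b c
    · linarith [h1 q a]
    · linarith [(h2 q b a).1]
    · linarith [h4 q c]
    · linarith [h3 q b c]
  have he2 : ∀ q, e q ^ 2 ≤ 1 := by
    intro q
    simp only [e]
    split_ifs <;> norm_num
  have hRe : ∀ q, R q * e q ≤ (if q ∈ Tᶜ \ S then R q else 0) - (if q ∈ S then R q else 0) + 2 * ρ := by
    intro q
    have := hR q
    by_cases hS : q ∈ S
    · have hT : q ∉ T := by simpa using hST hS
      by_cases hGq : q ∈ G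
      · simp [e, hS, hGq]; linarith
      · have := (h2 q hS hGq).2
        simp [e, hS, hGq]; linarith
    · have hGq : q ∉ G := fun h => hS (_hG h)
      by_cases hT : q ∈ T
      · simp [e, hS, hGq, hT]; linarith
      · simp [e, hS, hGq, hT]; linarith
  have hReS : ∑ q, R q * e q ≤ 2 * Fintype.card ι * ρ := by
    refine (Finset.sum_le_sum fun q _ => hRe q).trans ?_
    rw [Finset.sum_add_distrib, Finset.sum_sub_distrib, Finset.sum_ite_mem, Finset.sum_ite_mem,
      Finset.univ_inter, Finset.univ_inter, Finset.sum_const, Finset.card_univ, nsmul_eq_mul]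
    linarith
  have hsq : ∀ q, (1 + ρ) ^ 2 * N q ^ 2 ≤ R q ^ 2 + 2 * ρ * (R q * e q) + ρ ^ 2 := by
    intro q
    have h0 : 0 ≤ (1 + ρ) * N q := mul_nonneg (by linarith) (hN q)
    have := pow_le_pow_left₀ h0 (he q) 2
    nlinarith [he2 q, sq_nonneg ρ]
  have hsum : (1 + ρ) ^ 2 * ∑ q, N q ^ 2 ≤ t + 5 * Fintype.card ι * ρ ^ 2 := by
    rw [Finset.mul_sum]
    refine (Finset.sum_le_sum fun q _ => hsq q).trans ?_
    rw [Finset.sum_add_distrib, Finset.sum_add_distrib, ← Finset.mul_sum, Finset.sum_const,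
      Finset.card_univ, nsmul_eq_mul]
    nlinarith
  have hpos : 0 < (1 + ρ) ^ 2 := by positivity
  refine le_of_mul_le_mul_left (hsum.trans ?_) hpos
  have a1 : (5 * Fintype.card ι + 1) * ρ * ρ ≤ 2 * t0 * ρ := mul_le_mul_of_nonneg_right hρ2 hρ.le
  have a2 : t0 * ρ ≤ t * ρ := mul_le_mul_of_nonneg_right ht hρ.le
  have a3 : 0 ≤ t := (Finset.sum_nonneg fun q _ => sq_nonneg _).trans hRt
  have a4 : (1 + ρ) ^ 2 ≤ 4 := by nlinarith
  have a5 : (1 + ρ) ^ 2 * (ρ ^ 2 / 4) ≤ ρ ^ 2 := by nlinarith [sq_nonneg ρ]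
  nlinarith [mul_nonneg a3 (sq_nonneg ρ)]

variable {X ι : Type*} [MetricSpace X] [CompactSpace X] [Fintype ι] [DecidableEq ι]

/-- admissible measures on `K` -/
def Adm (K : Set X) (μ : X →₀ ℝ) : Prop :=
  (∀ x ∈ μ.support, x ∈ K) ∧ pr μ (fun _ => 1) = 0 ∧
    ∃ s : X → ℝ, (∀ x, |s x| ≤ 1) ∧ 1 ≤ pr μ s

/-- norm of the image -/
noncomputable def Nq (φ : ι → X → ℝ) (μ : X →₀ ℝ) (q : ι) : ℝ := nrm (μ.mapDomain (φ q))

/-- the potential -/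
noncomputable def Pot (φ : ι → X → ℝ) (μ : X →₀ ℝ) : ℝ := ∑ q, Nq φ μ q ^ 2

lemma Nq_nonneg (φ : ι → X → ℝ) (μ : X →₀ ℝ) (q : ι) : 0 ≤ Nq φ μ q := nrm_nonneg _

lemma le_Nq (φ : ι → X → ℝ) (μ : X →₀ ℝ) (q : ι) {h : ℝ → ℝ} (hh : ∀ t, |h t| ≤ 1) :
    pr μ (h ∘ φ q) ≤ Nq φ μ q := by
  rw [← pr_map]
  exact le_nrm _ hh

lemma Nq_le {φ : ι → X → ℝ} {μ : X →₀ ℝ} {q : ι} {c : ℝ}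
    (H : ∀ h : ℝ → ℝ, (∀ t, |h t| ≤ 1) → pr μ (h ∘ φ q) ≤ c) : Nq φ μ q ≤ c :=
  nrm_le fun h hh => by rw [pr_map]; exact H h hh

/-- every big closed subset carries a measure of potential at most `t` -/
def PP (φ : ι → X → ℝ) (K0 : Set X) (p : ℕ) (t : ℝ) : Prop :=
  ∀ K ⊆ K0, IsClosed K → ¬ E p K → ∃ μ, Adm K μ ∧ Pot φ μ ≤ t

lemma Core.improve {φ : ι → X → ℝ} {C : ℝ} (hC : 0 < C) {K0 : Set X} {T : Finset ι} {p : ℕ}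
    (H : Core φ C K0 T p) {ρ t t0 : ℝ} (hρ : 0 < ρ) (hρ1 : ρ ≤ 1)
    (hρ2 : (5 * Fintype.card ι + 1) * ρ ≤ 2 * t0) (hρ3 : 4 * Fintype.card ι * ρ * C < 1)
    (ht : t0 ≤ t) (hP : PP φ K0 p t) : PP φ K0 p (t - ρ ^ 2 / 4) := by
  classical
  intro K hKK hK hB
  by_contra hcon
  push Not at hcon
  obtain ⟨KL, hKL, hclL, hBL, hord⟩ := H.lemC_all hKK hK hB
  obtain ⟨K1, hK1, K2, hK2, hcl1, hcl2, hB1, hB2, hdis0⟩ := H.lemC2 (hKL.trans hKK) hclL hBL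
  let Kc : Bool → Set X := fun i => bif i then K2 else K1
  have hKcL : ∀ i, Kc i ⊆ KL := by rintro (_ | _); exacts [hK1, hK2]
  have hKcB : ∀ i, ¬ E p (Kc i) := by rintro (_ | _); exacts [hB1, hB2]
  have hKccl : ∀ i, IsClosed (Kc i) := by rintro (_ | _); exacts [hcl1, hcl2]
  have hdis : ∀ q, q ∉ T → ∀ i j, i ≠ j → ∀ x ∈ Kc i, ∀ y ∈ Kc j, φ q x ≠ φ q y := by
    rintro q hq (_ | _) (_ | _) hij x hx y hy
    · exact absurd rfl hij
    · exact hdis0 q hq x hx y hy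
    · exact (hdis0 q hq y hy x hx).symm
    · exact absurd rfl hij
  have hKcK : ∀ i, Kc i ⊆ K := fun i => (hKcL i).trans hKL
  have hμe : ∀ i, ∃ μ, Adm (Kc i) μ ∧ Pot φ μ ≤ t := fun i =>
    hP (Kc i) ((hKcK i).trans hKK) (hKccl i) (hKcB i)
  choose μ hμ hPot using hμe
  have hsupp : ∀ i, ∀ x ∈ (μ i).support, x ∈ Kc i := fun i => (hμ i).1
  have hone : ∀ i, pr (μ i) (fun _ => 1) = 0 := fun i => (hμ i).2.1
  choose s hs1 hs2 using fun i => (hμ i).2.2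
  let r : Bool → ι → ℝ := fun i q => Nq φ (μ i) q
  have hr : ∀ i q (h : ℝ → ℝ), (∀ t, |h t| ≤ 1) → pr (μ i) (h ∘ φ q) ≤ r i q :=
    fun i q h hh => le_Nq φ (μ i) q hh
  have hr0 : ∀ i q, 0 ≤ r i q := fun i q => Nq_nonneg _ _ _
  let R : ι → ℝ := fun q => (r false q + r true q) / 2
  have hRdef : ∀ q, R q = (r false q + r true q) / 2 := fun q => rfl
  have hR0 : ∀ q, 0 ≤ R q := fun q => by
    rw [hRdef]; linarith [hr0 false q, hr0 true q]
  have hTz : ∀ ν : X →₀ ℝ, (∀ x ∈ ν.support, x ∈ K) → pr ν (fun _ => 1) = 0 →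
      ∀ q ∈ T, ∀ h : ℝ → ℝ, pr ν (h ∘ φ q) = 0 := by
    intro ν hν hν1 q hq h
    obtain ⟨c, hc⟩ := H.const q hq
    have e : pr ν (h ∘ φ q) = pr ν (fun _ => h c * 1) := by
      refine pr_congr fun x hx => ?_
      simp only [Function.comp, mul_one]
      rw [hc x (hKK (hν x hx))]
    rw [e, pr_const_mul, hν1, mul_zero]
  have hrT : ∀ i, ∀ q ∈ T, r i q = 0 := by
    intro i q hq
    refine le_antisymm (Nq_le fun h _ => ?_) (hr0 i q)
    rw [hTz _ (fun x hx => hKcK i (hsupp i x hx)) (hone i) q hq]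
  have hRT : ∀ q ∈ T, R q = 0 := fun q hq => by
    rw [hRdef, hrT false q hq, hrT true q hq]; norm_num
  -- order and selection
  obtain ⟨l, hlnd, hlT, hlsort⟩ := exists_sorted R T
  obtain ⟨S, hSH, hSsel⟩ := hord l hlnd hlT
  have hST : ∀ q ∈ S, q ∉ T := fun q hq => (hlT q).1 (hSH.1 q hq)
  have habel : ∑ q ∈ Tᶜ \ S, R q ≤ ∑ q ∈ S, R q := by
    have e : l.toFinset = Tᶜ := by
      ext q
      simp [hlT]
    rw [← e]
    exact abel hR0 hlnd hlsort hSH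
  obtain ⟨q1, hq1, q2, hq2, hq12⟩ : ∃ q1 ∈ S, ∃ q2 ∈ S, q1 ≠ q2 := by
    have : 1 < S.card := by rw [hSH.2.1]; exact H.two
    exact Finset.one_lt_card.1 this
  have hKdisj : ∀ i j, i ≠ j → ∀ x ∈ Kc i, x ∉ Kc j := fun i j hij x hx hx' =>
    hdis q1 (hST q1 hq1) i j hij x hx x hx' rfl
  -- combined sign functions
  have hcomb : ∀ σ : X → ℝ, (∀ x, |σ x| ≤ 1) → ∃ g : X → ℝ, (∀ x, |g x| ≤ 1) ∧
      (∀ i, 1 ≤ pr (μ i) g) ∧ ∀ x, (∀ i, x ∉ Kc i) → g x = σ x := by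
    intro σ hσ
    let g : X → ℝ := fun x => if x ∈ Kc false then s false x else
      if x ∈ Kc true then s true x else σ x
    refine ⟨g, ?_, ?_, ?_⟩
    · intro x
      simp only [g]
      split_ifs
      exacts [hs1 _ _, hs1 _ _, hσ x]
    · intro i
      refine (hs2 i).trans (le_of_eq (pr_congr fun x hx => ?_))
      have hx' := hsupp i x hx
      rcases i with _ | _
      · simp [g, hx']
      · have := hKdisj true false (by simp) x hx'
        simp [g, hx', this]
    · intro x hx
      simp [g, hx false, hx true]
  -- the mean
  have hclose : ∀ q, |r false q - r true q| ≤ ρ := by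
    have hadm : Adm K ((2:ℝ)⁻¹ • (μ false + μ true)) := by
      refine ⟨?_, ?_, ?_⟩
      · intro x hx
        have hx2 := Finsupp.support_add (Finsupp.support_smul hx)
        rcases Finset.mem_union.1 hx2 with h | h
        · exact hKcK _ (hsupp _ x h)
        · exact hKcK _ (hsupp _ x h)
      · rw [pr_smul, pr_add, hone, hone]; simp
      · obtain ⟨g, hg1, hg2, -⟩ := hcomb (fun _ => 0) (by simp)
        refine ⟨g, hg1, ?_⟩
        rw [pr_smul, pr_add]
        linarith [hg2 false, hg2 true]
    have h1 := hcon _ hadm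
    have h2 : Pot φ ((2:ℝ)⁻¹ • (μ false + μ true)) ≤ ∑ q, R q ^ 2 := by
      refine Finset.sum_le_sum fun q _ => ?_
      refine pow_le_pow_left₀ (Nq_nonneg _ _ _) (Nq_le fun h hh => ?_) 2
      rw [pr_smul, pr_add, hRdef]
      linarith [hr false q h hh, hr true q h hh]
    have h3 : ∑ q, (r false q - r true q) ^ 2 + 4 * ∑ q, R q ^ 2 =
        2 * Pot φ (μ false) + 2 * Pot φ (μ true) := by
      simp only [Pot, Finset.mul_sum, ← Finset.sum_add_distrib]
      refine Finset.sum_congr rfl fun q _ => ?_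
      rw [hRdef]
      simp only [r]
      ring
    have h4 := hPot false
    have h5 := hPot true
    intro q
    have h6 : (r false q - r true q) ^ 2 ≤ ∑ q, (r false q - r true q) ^ 2 :=
      Finset.single_le_sum (f := fun q => (r false q - r true q) ^ 2)
        (fun q _ => sq_nonneg _) (Finset.mem_univ q)
    exact abs_le_of_sq_le_sq (by nlinarith) hρ.le
  have hRt : ∑ q, R q ^ 2 ≤ t := by
    have h3 : 2 * ∑ q, R q ^ 2 ≤ Pot φ (μ false) + Pot φ (μ true) := by
      simp only [Pot, Finset.mul_sum, ← Finset.sum_add_distrib]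
      refine Finset.sum_le_sum fun q _ => ?_
      rw [hRdef]
      simp only [r]
      nlinarith [sq_nonneg (Nq φ (μ false) q - Nq φ (μ true) q)]
    linarith [hPot false, hPot true]
  -- good indices
  let G : Finset ι := S.filter fun q => ρ ≤ r false q ∧ ρ ≤ r true q
  have hGS : G ⊆ S := Finset.filter_subset _ _
  have hGr : ∀ q ∈ G, ∀ i, ρ ≤ r i q := by
    intro q hq i
    have := (Finset.mem_filter.1 hq).2
    rcases i with _ | _
    exacts [this.1, this.2]
  have hsmall : ∀ q ∈ S, q ∉ G → R q ≤ 2 * ρ := by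
    intro q hq hqG
    have h1 := abs_le.1 (hclose q)
    rw [hRdef]
    by_contra hbad
    push Not at hbad
    exact hqG (Finset.mem_filter.2 ⟨hq, by linarith, by linarith⟩)
  obtain ⟨qs, hqs⟩ : G.Nonempty := by
    by_contra hG
    rw [Finset.not_nonempty_iff_eq_empty] at hG
    have h1 : ∑ q ∈ S, R q ≤ Fintype.card ι * (2 * ρ) := by
      calc ∑ q ∈ S, R q ≤ ∑ q ∈ S, 2 * ρ :=
            Finset.sum_le_sum fun q hq => hsmall q hq (by simp [hG])
        _ = S.card * (2 * ρ) := by rw [Finset.sum_const, nsmul_eq_mul]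
        _ ≤ Fintype.card ι * (2 * ρ) := by
            refine mul_le_mul_of_nonneg_right ?_ (by linarith)
            exact_mod_cast S.card_le_univ
    have hSsub : S ⊆ Tᶜ := fun q hq => by simpa using hST q hq
    have h2 : ∑ q, R q = ∑ q ∈ Tᶜ \ S, R q + ∑ q ∈ S, R q := by
      rw [Finset.sum_sdiff hSsub]
      refine (Finset.sum_subset (Finset.subset_univ _) fun q _ hq => hRT q ?_).symm
      simpa using hq
    have h3 : ∀ i, 1 ≤ C * ∑ q, r i q := fun i =>
      (hs2 i).trans (H.usf (μ i) (r i) (fun q h hh => hr i q h hh) (s i) (hs1 i))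
    have h4 : ∑ q, R q = (∑ q, r false q + ∑ q, r true q) / 2 := by
      rw [← Finset.sum_add_distrib, Finset.sum_div]
    have h5 : 1 ≤ C * ∑ q, R q := by
      rw [h4]; linarith [h3 false, h3 true]
    have h6 : C * ∑ q, R q ≤ C * (4 * Fintype.card ι * ρ) :=
      mul_le_mul_of_nonneg_left (by rw [h2]; linarith) hC.le
    linarith
  have hqsT := hST qs (hGS hqs)
  -- the pieces
  have hpieces : ∀ i q, ∃ P M : ℝ →₀ ℝ, Prob P ∧ Prob M ∧
      (∀ t ∈ P.support, t ∈ φ q '' Kc i) ∧ (∀ t ∈ M.support, t ∈ φ q '' Kc i) ∧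
      (q ∈ G → (∀ h, pr P h - pr M h = 2 / r i q * pr (μ i) (h ∘ φ q)) ∧
        (∀ t ∈ P.support, sgn ((μ i).mapDomain (φ q) t) = 1) ∧
        (∀ t ∈ M.support, sgn ((μ i).mapDomain (φ q) t) = -1)) ∧ (q ∉ G → P = M) := by
    intro i q
    by_cases hq : q ∈ G
    · have hrp : 0 < nrm ((μ i).mapDomain (φ q)) := hρ.trans_le (hGr q hq i)
      obtain ⟨P, M, h1, h2, h3, h4, h5, h6, h7⟩ :=
        split_measure (ν := (μ i).mapDomain (φ q)) (by rw [pr_map]; exact hone i) hrp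
      have hsub : ∀ t ∈ ((μ i).mapDomain (φ q)).support, t ∈ φ q '' Kc i := by
        intro t ht
        obtain ⟨x, hx, rfl⟩ := Finset.mem_image.1 (Finsupp.mapDomain_support ht)
        exact ⟨x, hsupp i x hx, rfl⟩
      refine ⟨P, M, h1, h2, fun t ht => hsub t (h3 ht), fun t ht => hsub t (h4 ht),
        fun _ => ⟨fun h => ?_, h6, h7⟩, fun h => absurd hq h⟩
      rw [h5, pr_map]
      rfl
    · obtain ⟨x, hx⟩ := not_E_nonempty (hKcB i)
      have hsub : ∀ t ∈ (Finsupp.single (φ q x) (1:ℝ)).support, t ∈ φ q '' Kc i := by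
        intro t ht
        have := Finset.mem_singleton.1 (Finsupp.support_single_subset ht)
        exact ⟨x, hx, this.symm⟩
      exact ⟨_, _, Prob.single (φ q x), Prob.single (φ q x), hsub, hsub,
        fun h => absurd h hq, fun _ => rfl⟩
  choose P M hPp hMp hPs hMs hgood hbad using hpieces
  let c : Bool → ι → Bool := fun j q => if q = q1 then j else !j
  have hcsum : ∀ (f : Bool → ℝ) q, f (c false q) + f (c true q) = f false + f true := by
    intro f q
    simp only [c]
    split_ifs
    · rfl
    · simp [add_comm]
  have hκe := fun j => kappa φ S (fun q => P (c j q) q) (fun q => M (c j q) q)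
    (fun q _ => hPp _ q) (fun q _ => hMp _ q) (fun q => φ q '' Kc (c j q))
    (fun q _ => hPs _ q) (fun q _ => hMs _ q) K (not_E_nonempty hB)
    (fun u hu => hSsel u fun q hq => image_mono (hKcL _) (hu q hq)) hρ.le
  choose κ hκs hκ1 hκρ hκS using hκe
  have hκK : ∀ j, ∀ x ∈ (κ j).support, ∀ i, x ∉ Kc i := by
    intro j x hx i hxi
    have h := (hκs j x hx).2
    by_cases hij : i = j
    · obtain ⟨y, hy, hyx⟩ := h q2 hq2
      have hc : c j q2 = !j := by simp [c, hq12.symm]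
      rw [hc] at hy
      exact hdis q2 (hST q2 hq2) (!j) i (by simp [hij]) y hy x hxi hyx
    · obtain ⟨y, hy, hyx⟩ := h q1 hq1
      have hc : c j q1 = j := by simp [c]
      rw [hc] at hy
      exact hdis q1 (hST q1 hq1) j i (Ne.symm hij) y hy x hxi hyx
  -- the sign function off the pieces
  let σ : ℝ → ℝ := fun t => if t ∈ φ qs '' Kc false then - sgn ((μ false).mapDomain (φ qs) t)
    else - sgn ((μ true).mapDomain (φ qs) t)
  have hσ1 : ∀ t, |σ t| ≤ 1 := by
    intro t
    simp only [σ]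
    split_ifs <;> rw [abs_neg] <;> exact abs_sgn _
  have hσ : ∀ i, ∀ t ∈ φ qs '' Kc i, σ t = - sgn ((μ i).mapDomain (φ qs) t) := by
    rintro (_ | _) t ht
    · simp only [σ]; rw [if_pos ht]
    · simp only [σ]
      rw [if_neg]
      rintro ⟨x, hx, hxt⟩
      obtain ⟨y, hy, hyt⟩ := ht
      exact hdis qs hqsT false true (by simp) x hx y hy (hxt.trans hyt.symm)
  have hκσ : ∀ j, pr (κ j) (σ ∘ φ qs) = ρ := by
    intro j
    rw [hκS j qs (hGS hqs)]
    have h1 : pr (M (c j qs) qs) σ = 1 := by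
      rw [← (hMp (c j qs) qs).2]
      refine pr_congr fun t ht => ?_
      rw [hσ _ t (hMs _ _ t ht), (hgood _ qs hqs).2.2 t ht, neg_neg]
    have h2 : pr (P (c j qs) qs) σ = -1 := by
      have e : pr (P (c j qs) qs) σ = pr (P (c j qs) qs) (fun _ => (-1) * 1) := by
        refine pr_congr fun t ht => ?_
        rw [hσ _ t (hPs _ _ t ht), (hgood _ qs hqs).2.1 t ht, mul_one]
      rw [e, pr_const_mul, (hPp (c j qs) qs).2, mul_one]
    rw [h1, h2]
    ring
  -- the new measure
  let μ' : X →₀ ℝ := (2 + 2 * ρ)⁻¹ • (μ false + μ true + (κ false + κ true))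
  have hcpos : 0 < (2 + 2 * ρ)⁻¹ := inv_pos.2 (by linarith)
  have hμ'pr : ∀ g, (2 + 2 * ρ) * pr μ' g =
      pr (μ false) g + pr (μ true) g + (pr (κ false) g + pr (κ true) g) := by
    intro g
    simp only [μ']
    rw [pr_smul, pr_add, pr_add, pr_add, mul_inv_cancel_left₀ (by linarith : (2 + 2 * ρ) ≠ 0)]
  have hμ's : ∀ x ∈ μ'.support, x ∈ K := by
    intro x hx
    have hx2 := Finsupp.support_add (Finsupp.support_smul hx)
    rcases Finset.mem_union.1 hx2 with h | h
    · rcases Finset.mem_union.1 (Finsupp.support_add h) with h | h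
      · exact hKcK _ (hsupp _ x h)
      · exact hKcK _ (hsupp _ x h)
    · rcases Finset.mem_union.1 (Finsupp.support_add h) with h | h
      · exact (hκs _ x h).1
      · exact (hκs _ x h).1
  have hμ'1 : pr μ' (fun _ => 1) = 0 := by
    have := hμ'pr (fun _ => 1)
    rw [hone, hone, hκ1, hκ1] at this
    simp only [add_zero] at this
    exact (mul_eq_zero.1 this).resolve_left (by linarith)
  have hadm : Adm K μ' := by
    refine ⟨hμ's, hμ'1, ?_⟩
    obtain ⟨g, hg1, hg2, hg3⟩ := hcomb (σ ∘ φ qs) (fun x => hσ1 _)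
    refine ⟨g, hg1, ?_⟩
    have hκg : ∀ j, pr (κ j) g = ρ := fun j => by
      rw [← hκσ j]
      exact pr_congr fun x hx => hg3 x (hκK j x hx)
    have := hμ'pr g
    rw [hκg, hκg] at this
    have h1 := hg2 false
    have h2 := hg2 true
    have h3 : (2 + 2 * ρ) * 1 ≤ (2 + 2 * ρ) * pr μ' g := by linarith
    exact le_of_mul_le_mul_left h3 (by linarith)
  have hNle : ∀ q B, (∀ h : ℝ → ℝ, (∀ t, |h t| ≤ 1) → (2 + 2 * ρ) * pr μ' (h ∘ φ q) ≤ 2 * B) →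
      (1 + ρ) * Nq φ μ' q ≤ B := by
    intro q B hB
    have h1 : Nq φ μ' q ≤ (2 * B) / (2 + 2 * ρ) := by
      refine Nq_le fun h hh => ?_
      rw [le_div_iff₀ (by linarith)]
      linarith [hB h hh]
    rw [le_div_iff₀ (by linarith)] at h1
    linarith
  have hmain : Pot φ μ' ≤ t - ρ ^ 2 / 4 := by
    refine improve_num (S := S) (T := T) (R := R) hGS hρ hρ1 hρ2 ht hR0
      (fun q => Nq_nonneg _ _ _)
      (fun q hq => by simpa using hST q hq) ?_ ?_ ?_ ?_ habel hRt
    · intro q hq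
      refine hNle q _ fun h hh => ?_
      rw [hμ'pr, hκS _ q (hGS hq), hκS _ q (hGS hq)]
      have e : ∀ i, ρ / 2 * (pr (M i q) h - pr (P i q) h) =
          - (ρ / r i q) * pr (μ i) (h ∘ φ q) := by
        intro i
        have := (hgood i q hq).1 h
        have e2 : pr (M i q) h - pr (P i q) h = - (2 / r i q * pr (μ i) (h ∘ φ q)) := by
          linarith
        rw [e2]
        ring
      have e3 := hcsum (fun i => ρ / 2 * (pr (M i q) h - pr (P i q) h)) q
      rw [e3, e, e]
      have e4 : ∀ i, pr (μ i) (h ∘ φ q) + - (ρ / r i q) * pr (μ i) (h ∘ φ q) ≤ r i q - ρ := by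
        intro i
        have hri : ρ ≤ r i q := hGr q hq i
        have hpos : 0 < r i q := hρ.trans_le hri
        have h1 : 0 ≤ 1 - ρ / r i q := by
          rw [sub_nonneg, div_le_one hpos]; exact hri
        have h2 := mul_le_mul_of_nonneg_left (hr i q h hh) h1
        have h3 : (1 - ρ / r i q) * r i q = r i q - ρ := by
          field_simp
        linarith
      rw [hRdef]
      linarith [e4 false, e4 true]
    · intro q hq hqG
      refine ⟨hNle q _ fun h hh => ?_, hsmall q hq hqG⟩
      rw [hμ'pr, hκS _ q hq, hκS _ q hq, hbad _ q hqG, hbad _ q hqG, hRdef]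
      simp only [sub_self, mul_zero, add_zero]
      linarith [hr false q h hh, hr true q h hh]
    · intro q hqS hqT
      refine hNle q _ fun h hh => ?_
      rw [hμ'pr, hRdef]
      have h1 := hκρ false (h ∘ φ q) (fun x => hh _)
      have h2 := hκρ true (h ∘ φ q) (fun x => hh _)
      linarith [hr false q h hh, hr true q h hh]
    · intro q hq
      refine hNle q _ fun h hh => ?_
      rw [hTz μ' hμ's hμ'1 q hq, hRT q hq]
      simp
  exact absurd (hcon μ' hadm) (not_lt.2 hmain)

end Stern

namespace Stern

open Set Topology

variable {X ι : Type*} [MetricSpace X] [CompactSpace X] [Fintype ι] [DecidableEq ι]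

lemma Core.false {φ : ι → X → ℝ} {C : ℝ} (hC : 0 < C) {K0 : Set X} {T : Finset ι} {p : ℕ}
    (H : Core φ C K0 T p) : False := by
  classical
  set m : ℝ := (Fintype.card ι : ℝ) with hm
  have hm0 : 0 ≤ m := Nat.cast_nonneg _
  set t0 : ℝ := 1 / (C ^ 2 * (m + 1)) with ht0
  have hden : 0 < C ^ 2 * (m + 1) := by positivity
  have ht0p : 0 < t0 := by positivity
  set ρ : ℝ := min 1 (min (2 * t0 / (5 * m + 1)) (1 / (4 * m * C + 1))) with hρdef
  have hd1 : 0 < 5 * m + 1 := by positivity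
  have hd2 : 0 < 4 * m * C + 1 := by positivity
  have hρ : 0 < ρ := by
    refine lt_min one_pos (lt_min ?_ ?_) <;> positivity
  have hρ1 : ρ ≤ 1 := min_le_left _ _
  have hρ2 : (5 * m + 1) * ρ ≤ 2 * t0 := by
    have : ρ ≤ 2 * t0 / (5 * m + 1) := (min_le_right _ _).trans (min_le_left _ _)
    rw [le_div_iff₀ hd1] at this
    linarith
  have hρ3 : 4 * m * ρ * C < 1 := by
    have : ρ ≤ 1 / (4 * m * C + 1) := (min_le_right _ _).trans (min_le_right _ _)
    rw [le_div_iff₀ hd2] at this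
    nlinarith
  have hlow : ∀ t, PP φ K0 p t → t0 ≤ t := by
    intro t ht
    obtain ⟨μ, ⟨-, -, s, hs1, hs2⟩, hP⟩ := ht K0 le_rfl H.closed H.big
    have h1 : 1 ≤ C * ∑ q, Nq φ μ q :=
      hs2.trans (H.usf μ _ (fun q h hh => le_Nq φ μ q hh) s hs1)
    have h2 : (∑ q, Nq φ μ q) ^ 2 ≤ m * Pot φ μ := by
      have := sq_sum_le_card_mul_sum_sq (s := Finset.univ) (f := Nq φ μ)
      simpa [Pot, hm] using this
    have h3 : 1 ≤ C ^ 2 * (∑ q, Nq φ μ q) ^ 2 := by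
      rw [← mul_pow]
      exact one_le_pow₀ h1
    have hp0 : 0 ≤ Pot φ μ := Finset.sum_nonneg fun q _ => sq_nonneg _
    refine le_trans ?_ hP
    rw [ht0, div_le_iff₀ hden]
    nlinarith [mul_le_mul_of_nonneg_left h2 (sq_nonneg C), mul_nonneg hp0 (sq_nonneg C)]
  have hstart : PP φ K0 p m := by
    intro K _ _ hB
    have hns : ¬ K.Subsingleton := by
      intro h
      obtain ⟨p', rfl⟩ : ∃ p', p = p' + 1 := ⟨p - 1, by have := H.two; omega⟩
      exact hB (E_subsingleton h)
    rw [not_subsingleton_iff] at hns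
    obtain ⟨x, hx, y, hy, hxy⟩ := hns
    refine ⟨Finsupp.single x (1/2) - Finsupp.single y (1/2), ⟨?_, ?_, ?_⟩, ?_⟩
    · intro z hz
      rcases Finset.mem_union.1 (Finsupp.support_sub hz) with h | h
      · rw [Finset.mem_singleton.1 (Finsupp.support_single_subset h)]; exact hx
      · rw [Finset.mem_singleton.1 (Finsupp.support_single_subset h)]; exact hy
    · rw [pr_sub, pr_single, pr_single]; simp
    · refine ⟨fun z => if z = x then 1 else -1, ?_, ?_⟩
      · intro z
        beta_reduce
        split_ifs <;> simp
      · rw [pr_sub, pr_single, pr_single, if_pos rfl, if_neg hxy.symm]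
        norm_num
    · have h1 : ∀ q, Nq φ (Finsupp.single x (1/2) - Finsupp.single y (1/2)) q ≤ 1 := by
        intro q
        refine Nq_le fun h hh => ?_
        rw [pr_sub, pr_single, pr_single]
        have h1 := abs_le.1 (hh (φ q x))
        have h2 := abs_le.1 (hh (φ q y))
        simp only [Function.comp]
        linarith
      calc Pot φ _ ≤ ∑ _q : ι, (1:ℝ) :=
            Finset.sum_le_sum fun q _ => pow_le_one₀ (Nq_nonneg _ _ _) (h1 q)
        _ = m := by simp [hm]
  have hdesc : ∀ k : ℕ, PP φ K0 p (m - k * (ρ ^ 2 / 4)) := by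
    intro k
    induction k with
    | zero => simpa using hstart
    | succ k ih =>
      have := H.improve hC hρ hρ1 hρ2 hρ3 (hlow _ ih) ih
      convert this using 1
      push_cast
      ring
  obtain ⟨k, hk⟩ := exists_nat_gt (m / (ρ ^ 2 / 4))
  rw [div_lt_iff₀ (by positivity)] at hk
  have := hlow _ (hdesc k)
  linarith

end Stern

theorem sternfeld_lower_bound
    (d m : ℕ) (hd : 2 ≤ d) (hm : 0 < m)
    (φ : Fin m → (Fin d → Set.Icc (0:ℝ) 1) → ℝ)
    (hφ : ∀ q, Continuous (φ q))
    (hrep : ∀ f : (Fin d → Set.Icc (0:ℝ) 1) → ℝ, Continuous f →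
      ∃ g : Fin m → ℝ → ℝ, (∀ q, Continuous (g q)) ∧
        ∀ x, f x = ∑ q, g q (φ q x)) :
    2 * d + 1 ≤ m := by
  by_contra hcon
  obtain ⟨C, hC, hU⟩ := Stern.exists_USF φ hφ hrep
  obtain ⟨K0, T, p, H⟩ := Stern.exists_core φ hφ hU hd (by rw [Fintype.card_fin]; omega)
    (Stern.not_E_univ (by omega))
  exact H.false hC
end
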